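/- arXiv:0908.0906 — 9 statements merged into one kernel-verified Lean document; each statement's English description precedes it below -/
import Mathlib

section
/- Let R = M_n(F) be endowed with a G-grading in which every homogeneous component R_g has dimension at most 1. Then every nonzero homogeneous element of R is invertible in R (i.e., R is a graded division algebra). -/
open DirectSum in
/-- Left multiplication by a homogeneous element of degree `h` carries the identity component of
`y` to the component of degree `h` of the product. -/
theorem coe_decompose_homogeneous_mul {F A G : Type*} [Field F] [Ring A] [Algebra F A]
    [Group G] [DecidableEq G] (ℛ : G → Submodule F A) [DirectSum.Decomposition ℛ]
    (hmul : ∀ g h : G, ∀ x ∈ ℛ g, ∀ y ∈ ℛ h, x * y ∈ ℛ (g * h))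
    {h : G} {x : A} (hx : x ∈ ℛ h) (y : A) :
    (decompose ℛ (x * y) h : A) = x * (decompose ℛ y 1 : A) := by
  induction y using DirectSum.Decomposition.inductionOn ℛ with
  | zero => simp
  | @homogeneous g m =>
    have hxm := hmul h g x hx m m.2
    by_cases hg : g = 1
    · subst hg
      rw [mul_one] at hxm
      rw [decompose_of_mem_same ℛ hxm, decompose_of_mem_same ℛ m.2]
    · rw [decompose_of_mem_ne ℛ hxm (by simpa using hg), decompose_of_mem_ne ℛ m.2 hg, mul_zero]
  | add a b ha hb => simp [mul_add, ha, hb]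

open DirectSum in
/-- The unit of an algebra graded by a group is homogeneous of degree `1`. -/
theorem one_mem_identity_component {F A G : Type*} [Field F] [Ring A] [Algebra F A]
    [Group G] [DecidableEq G] (ℛ : G → Submodule F A) [DirectSum.Decomposition ℛ]
    (hmul : ∀ g h : G, ∀ x ∈ ℛ g, ∀ y ∈ ℛ h, x * y ∈ ℛ (g * h)) :
    (1 : A) ∈ ℛ 1 := by
  have key (x : A) : x * (decompose ℛ (1 : A) 1 : A) = x := by
    induction x using DirectSum.Decomposition.inductionOn ℛ with
    | zero => simp
    | homogeneous m =>
      rw [← coe_decompose_homogeneous_mul ℛ hmul m.2, mul_one, decompose_of_mem_same ℛ m.2]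
    | add a b ha hb => rw [add_mul, ha, hb]
  have h := key 1
  rw [one_mul] at h
  exact h ▸ (decompose ℛ (1 : A) 1).2

open DirectSum in
/-- If `x` is homogeneous and some `a * x * b` has a nonzero identity component, then `a` and `b`
may be chosen such that `a * x * b` is itself nonzero of degree `1`. -/
theorem exists_mul_mul_mem_identity_component {F A G : Type*} [Field F] [Ring A] [Algebra F A]
    [Group G] [DecidableEq G] (ℛ : G → Submodule F A) [DirectSum.Decomposition ℛ]
    (hmul : ∀ g h : G, ∀ x ∈ ℛ g, ∀ y ∈ ℛ h, x * y ∈ ℛ (g * h))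
    {g : G} {x : A} (hx : x ∈ ℛ g) {a b : A} (hab : (decompose ℛ (a * x * b) 1 : A) ≠ 0) :
    ∃ c d : A, c * x * d ∈ ℛ 1 ∧ c * x * d ≠ 0 := by
  contrapose! hab
  induction a using DirectSum.Decomposition.inductionOn ℛ with
  | zero => simp
  | add a a' ha ha' => simp [add_mul, ha, ha']
  | @homogeneous h a =>
    induction b using DirectSum.Decomposition.inductionOn ℛ with
    | zero => simp
    | add b b' hb hb' => simp [mul_add, hb, hb']
    | @homogeneous k b =>
      have hmem := hmul _ _ _ (hmul _ _ _ a.2 _ hx) _ b.2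
      by_cases hk : h * g * k = 1
      · rw [hk] at hmem
        simp [hab a b hmem]
      · exact decompose_of_mem_ne ℛ hmem hk

/-- The two-sided ideal generated by a nonzero matrix contains the identity matrix. -/
theorem Matrix.sum_single_mul_mul_single_eq_one {F ι : Type*} [Field F] [Fintype ι] [DecidableEq ι]
    (x : Matrix ι ι F) {i j : ι} (hx : x i j ≠ 0) :
    ∑ k, Matrix.single k i (x i j)⁻¹ * x * Matrix.single j k 1 = 1 := by
  simp [Matrix.single_mul_mul_single, hx, Matrix.sum_single_one]

/-- In a division `G`-grading on `Mₙ(F)` (all homogeneous components of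
dimension at most 1), every nonzero homogeneous element is invertible. -/
theorem division_grading_homogeneous_invertible
    {F : Type*} [Field F] [IsAlgClosed F]
    {G : Type*} [CommGroup G] [DecidableEq G] {n : ℕ}
    (ℛ : G → Submodule F (Matrix (Fin n) (Fin n) F))
    (hinternal : DirectSum.IsInternal ℛ)
    (hmul : ∀ g h : G, ∀ x ∈ ℛ g, ∀ y ∈ ℛ h, x * y ∈ ℛ (g * h))
    (hdim : ∀ g : G, Module.finrank F (ℛ g) ≤ 1) :
    ∀ g : G, ∀ x ∈ ℛ g, x ≠ 0 → IsUnit x := by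
  intro g x hx hx0
  let _ := hinternal.chooseDecomposition
  obtain ⟨i, j, hij⟩ : ∃ i j, x i j ≠ 0 := by
    contrapose! hx0
    ext i j
    exact hx0 i j
  have : Nonempty (Fin n) := ⟨i⟩
  have h1 := one_mem_identity_component ℛ hmul
  obtain ⟨a, b, hab⟩ : ∃ a b : Matrix (Fin n) (Fin n) F,
      (DirectSum.decompose ℛ (a * x * b) 1 : Matrix (Fin n) (Fin n) F) ≠ 0 := by
    by_contra! h
    have h10 := DirectSum.decompose_of_mem_same ℛ h1
    rw [← Matrix.sum_single_mul_mul_single_eq_one x hij, DirectSum.decompose_sum,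
      DFinsupp.finsetSum_apply, Submodule.coe_sum, Finset.sum_eq_zero fun k _ => h _ _,
      Matrix.sum_single_mul_mul_single_eq_one x hij] at h10
    exact zero_ne_one h10
  obtain ⟨c, d, hmem, hne⟩ := exists_mul_mul_mem_identity_component ℛ hmul hx hab
  obtain ⟨v, hv⟩ := finrank_le_one_iff.mp (hdim 1)
  obtain ⟨r, hr⟩ := hv ⟨_, h1⟩
  obtain ⟨s, hs⟩ := hv ⟨_, hmem⟩
  replace hr : r • (v : Matrix (Fin n) (Fin n) F) = 1 := congrArg Subtype.val hr
  replace hs : s • (v : Matrix (Fin n) (Fin n) F) = c * x * d := congrArg Subtype.val hs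
  have hr0 : r ≠ 0 := by
    rintro rfl
    simp at hr
  have hs0 : s ≠ 0 := by
    rintro rfl
    exact hne (by simpa using hs.symm)
  have hunit : IsUnit (c * x * d) := by
    have hv' : (v : Matrix (Fin n) (Fin n) F) = r⁻¹ • 1 := by rw [← hr, inv_smul_smul₀ hr0]
    rw [← hs, hv', smul_smul, ← Algebra.algebraMap_eq_smul_one]
    exact (IsUnit.mk0 _ (mul_ne_zero hs0 (inv_ne_zero hr0))).map _
  exact (IsUnit.mul_iff.mp (IsUnit.mul_iff.mp hunit).1).2
end

section
/- Let R = M_n(F) be endowed with a division G-grading. Then the support T = {g ∈ G : R_g ≠ 0} is a subgroup of G of order n², every homogeneous component R_t with t ∈ T is one-dimensional, and the characteristic of F does not divide n. -/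
section MatrixGrading

variable {F G : Type*} [Field F] [CommGroup G] {n : ℕ}
  {ℛ : G → Submodule F (Matrix (Fin n) (Fin n) F)}

theorem one_mem_of_isInternal [DecidableEq G] (hint : DirectSum.IsInternal ℛ)
    (hmul : ∀ g h : G, ∀ x ∈ ℛ g, ∀ y ∈ ℛ h, x * y ∈ ℛ (g * h)) : 1 ∈ ℛ 1 := by
  have htop := hint.submodule_iSup_eq_top
  have hsplit : (⊤ : Submodule F (Matrix (Fin n) (Fin n) F)) ≤ ℛ 1 ⊔ ⨆ j, ⨆ _ : j ≠ 1, ℛ j := by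
    rw [← htop]
    refine iSup_le fun g => ?_
    by_cases hg : g = 1
    · exact hg ▸ le_sup_left
    · exact le_sup_of_le_right (le_iSup₂_of_le g hg le_rfl)
  obtain ⟨u, hu, w, hw, huw⟩ :=
    Submodule.mem_sup.1 (hsplit (Submodule.mem_top (x := (1 : Matrix (Fin n) (Fin n) F))))
  have hhom : ∀ g, ∀ x ∈ ℛ g, x * u = x := by
    intro g x hx
    have hxw : x * w ∈ ⨆ j, ⨆ _ : j ≠ g, ℛ j := by
      have hle : (⨆ j, ⨆ _ : j ≠ 1, ℛ j) ≤
          (⨆ j, ⨆ _ : j ≠ g, ℛ j).comap (LinearMap.mulLeft F x) := by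
        refine iSup₂_le fun j hj y hy => ?_
        have hgj : g * j ≠ g := by simpa using hj
        exact (le_iSup₂_of_le (f := fun j (_ : j ≠ g) => ℛ j) (g * j) hgj le_rfl)
          (hmul g j x hx y hy)
      exact hle hw
    have hsum : x * u + x * w = x := by rw [← mul_add, huw, mul_one]
    have hxu : x * w ∈ ℛ g := by
      rw [← eq_sub_iff_add_eq'.2 hsum |>.symm]
      exact sub_mem hx (by simpa using hmul g 1 x hx u hu)
    have hzero := Submodule.disjoint_def.1 (hint.submodule_iSupIndep g) _ hxu hxw
    simpa [hzero] using hsum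
  have hle : (⊤ : Submodule F (Matrix (Fin n) (Fin n) F)) ≤
      LinearMap.eqLocus (LinearMap.mulRight F u) LinearMap.id := by
    rw [← htop]
    exact iSup_le fun g x hx => hhom g x hx
  have hone : (1 : Matrix (Fin n) (Fin n) F) * u = 1 := hle Submodule.mem_top
  rw [one_mul] at hone
  exact hone ▸ hu

/-- Matrices are a simple ring: a subspace containing all products `A * x * B` contains `1`. -/
theorem one_mem_of_forall_mul_mul_mem {x : Matrix (Fin n) (Fin n) F} (hx : x ≠ 0)
    {W : Submodule F (Matrix (Fin n) (Fin n) F)} (h : ∀ A B, A * x * B ∈ W) : 1 ∈ W := by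
  obtain ⟨i, j, hij⟩ : ∃ i j, x i j ≠ 0 := by
    by_contra! hc
    exact hx (Matrix.ext hc)
  have hsum : (1 : Matrix (Fin n) (Fin n) F) =
      ∑ k, Matrix.single k i (x i j)⁻¹ * x * Matrix.single j k 1 := by
    simp only [Matrix.single_mul_mul_single, inv_mul_cancel₀ hij, mul_one]
    exact (Matrix.sum_single_one).symm
  rw [hsum]
  exact sum_mem fun k _ => h _ _

theorem exists_mul_mul_ne_zero [DecidableEq G] (hn : 0 < n) (hint : DirectSum.IsInternal ℛ)
    (hmul : ∀ g h : G, ∀ x ∈ ℛ g, ∀ y ∈ ℛ h, x * y ∈ ℛ (g * h))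
    {g : G} {x : Matrix (Fin n) (Fin n) F} (hxg : x ∈ ℛ g) (hx : x ≠ 0) :
    ∃ h k, h * g * k = 1 ∧ ∃ a ∈ ℛ h, ∃ b ∈ ℛ k, a * x * b ≠ 0 := by
  have : Nonempty (Fin n) := ⟨⟨0, hn⟩⟩
  by_contra! hc
  have htop := hint.submodule_iSup_eq_top
  have hhom : ∀ h, ∀ a ∈ ℛ h, ∀ k, ∀ b ∈ ℛ k, a * x * b ∈ ⨆ j, ⨆ _ : j ≠ 1, ℛ j := by
    intro h a ha k b hb
    by_cases hk : h * g * k = 1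
    · rw [hc h k hk a ha b hb]
      exact zero_mem _
    · exact (le_iSup₂_of_le (f := fun j (_ : j ≠ 1) => ℛ j) (h * g * k) hk le_rfl)
        (hmul _ _ _ (hmul _ _ _ ha _ hxg) _ hb)
  have hright : ∀ h, ∀ a ∈ ℛ h, ∀ B, a * x * B ∈ ⨆ j, ⨆ _ : j ≠ 1, ℛ j := by
    intro h a ha B
    have hle : (⊤ : Submodule F (Matrix (Fin n) (Fin n) F)) ≤
        (⨆ j, ⨆ _ : j ≠ 1, ℛ j).comap (LinearMap.mulLeft F (a * x)) := by
      rw [← htop]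
      exact iSup_le fun k b hb => hhom h a ha k b hb
    exact hle (Submodule.mem_top (x := B))
  have hall : ∀ A B, A * x * B ∈ ⨆ j, ⨆ _ : j ≠ 1, ℛ j := by
    intro A B
    have hle : (⊤ : Submodule F (Matrix (Fin n) (Fin n) F)) ≤
        (⨆ j, ⨆ _ : j ≠ 1, ℛ j).comap (LinearMap.mulRight F (x * B)) := by
      rw [← htop]
      exact iSup_le fun h a ha => by simpa [mul_assoc] using hright h a ha B
    simpa [mul_assoc] using hle (Submodule.mem_top (x := A))
  exact one_ne_zero (Submodule.disjoint_def.1 (hint.submodule_iSupIndep 1) _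
    (one_mem_of_isInternal hint hmul) (one_mem_of_forall_mul_mul_mem hx hall))

theorem exists_smul_eq_of_finrank_le_one {V : Type*} [AddCommGroup V] [Module F V]
    [FiniteDimensional F V] {W : Submodule F V} (hW : Module.finrank F W ≤ 1) {x y : V}
    (hx : x ∈ W) (hx0 : x ≠ 0) (hy : y ∈ W) : ∃ c : F, c • x = y := by
  obtain ⟨v, hv⟩ := finrank_le_one_iff.1 hW
  obtain ⟨c, hc⟩ := hv ⟨x, hx⟩
  obtain ⟨d, hd⟩ := hv ⟨y, hy⟩
  have hc0 : c ≠ 0 := by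
    rintro rfl
    exact hx0 (by simpa using (congrArg Subtype.val hc).symm)
  have hcx : c • (v : V) = x := congrArg Subtype.val hc
  have hdy : d • (v : V) = y := congrArg Subtype.val hd
  exact ⟨d * c⁻¹, by rw [← hcx, smul_smul, inv_mul_cancel_right₀ hc0, hdy]⟩

theorem isUnit_of_mem_of_ne_zero [DecidableEq G] (hn : 0 < n) (hint : DirectSum.IsInternal ℛ)
    (hmul : ∀ g h : G, ∀ x ∈ ℛ g, ∀ y ∈ ℛ h, x * y ∈ ℛ (g * h))
    (hdim : ∀ g : G, Module.finrank F (ℛ g) ≤ 1)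
    {g : G} {x : Matrix (Fin n) (Fin n) F} (hxg : x ∈ ℛ g) (hx : x ≠ 0) : IsUnit x := by
  have : Nonempty (Fin n) := ⟨⟨0, hn⟩⟩
  obtain ⟨h, k, hhk, a, ha, b, hb, hab⟩ := exists_mul_mul_ne_zero hn hint hmul hxg hx
  have hmem : a * x * b ∈ ℛ 1 := hhk ▸ hmul _ _ _ (hmul _ _ _ ha _ hxg) _ hb
  obtain ⟨c, hc⟩ := exists_smul_eq_of_finrank_le_one (hdim 1) hmem hab
    (one_mem_of_isInternal hint hmul)
  have hdet := congrArg Matrix.det hc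
  rw [Matrix.isUnit_iff_isUnit_det, isUnit_iff_ne_zero]
  intro h0
  simp [h0] at hdet

theorem trace_eq_zero_of_mem [DecidableEq G] (hn : 0 < n) (hint : DirectSum.IsInternal ℛ)
    (hmul : ∀ g h : G, ∀ x ∈ ℛ g, ∀ y ∈ ℛ h, x * y ∈ ℛ (g * h))
    (hdim : ∀ g : G, Module.finrank F (ℛ g) ≤ 1)
    {g : G} (hg : g ≠ 1) {x : Matrix (Fin n) (Fin n) F} (hxg : x ∈ ℛ g) : x.trace = 0 := by
  by_cases hx : x = 0
  · simp [hx]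
  have hux := isUnit_of_mem_of_ne_zero hn hint hmul hdim hxg hx
  obtain ⟨h, y, hyh, hxy⟩ : ∃ h, ∃ y ∈ ℛ h, y * x ≠ x * y := by
    by_contra! hc
    have hle : (⊤ : Submodule F (Matrix (Fin n) (Fin n) F)) ≤
        LinearMap.eqLocus (LinearMap.mulRight F x) (LinearMap.mulLeft F x) := by
      rw [← hint.submodule_iSup_eq_top]
      exact iSup_le fun h y hy => hc h y hy
    obtain ⟨c, hc⟩ := Matrix.mem_range_scalar_iff_commute_single.2
      (fun i j _ => (hle (Submodule.mem_top (x := Matrix.single i j (1 : F)))))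
    have hx1 : x ∈ ℛ 1 := by
      rw [← hc, Matrix.scalar_apply, ← Matrix.smul_one_eq_diagonal]
      exact Submodule.smul_mem _ _ (one_mem_of_isInternal hint hmul)
    exact hx (Submodule.disjoint_def.1 (hint.submodule_iSupIndep.pairwiseDisjoint hg) _ hxg hx1)
  have hy : y ≠ 0 := by
    rintro rfl
    simp at hxy
  have huy := isUnit_of_mem_of_ne_zero hn hint hmul hdim hyh hy
  have hxy0 : x * y ≠ 0 := by
    rw [Ne, huy.mul_left_eq_zero]
    exact hx
  obtain ⟨c, hc⟩ := exists_smul_eq_of_finrank_le_one (hdim (g * h)) (hmul _ _ _ hxg _ hyh) hxy0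
    (mul_comm h g ▸ hmul _ _ _ hyh _ hxg)
  obtain ⟨u, rfl⟩ := huy
  have htr : c * x.trace = x.trace := by
    have hconj := congrArg (fun z => Matrix.trace (z * (↑u⁻¹ : Matrix (Fin n) (Fin n) F))) hc
    rw [Matrix.trace_mul_cycle] at hconj
    simpa [mul_assoc] using hconj
  have hc1 : c ≠ 1 := by
    rintro rfl
    exact hxy (by simpa using hc.symm)
  by_contra h0
  exact hc1 (mul_right_cancel₀ h0 (by simpa using htr))

end MatrixGrading

/-- For a division `G`-grading on `Mₙ(F)`, the support is a subgroup of
order `n²`, every component supported there is one-dimensional, and `char F ∤ n`. -/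
theorem division_grading_support_subgroup
    {F : Type*} [Field F] [IsAlgClosed F]
    {G : Type*} [CommGroup G] [DecidableEq G] {n : ℕ} (hn : 0 < n)
    (ℛ : G → Submodule F (Matrix (Fin n) (Fin n) F))
    (hinternal : DirectSum.IsInternal ℛ)
    (hmul : ∀ g h : G, ∀ x ∈ ℛ g, ∀ y ∈ ℛ h, x * y ∈ ℛ (g * h))
    (hdim : ∀ g : G, Module.finrank F (ℛ g) ≤ 1) :
    (∃ T : Subgroup G, (T : Set G) = {g : G | ℛ g ≠ ⊥}) ∧
    Nat.card {g : G | ℛ g ≠ ⊥} = n ^ 2 ∧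
    (∀ g : G, ℛ g ≠ ⊥ → Module.finrank F (ℛ g) = 1) ∧
    ¬ (ringChar F ∣ n) := by
  have hone := one_mem_of_isInternal hinternal hmul
  have hunit : ∀ {g : G} {x}, x ∈ ℛ g → x ≠ 0 → IsUnit x :=
    fun hxg hx => isUnit_of_mem_of_ne_zero hn hinternal hmul hdim hxg hx
  have hNe : Nonempty (Fin n) := ⟨⟨0, hn⟩⟩
  have hsupp_mul : ∀ g h, ℛ g ≠ ⊥ → ℛ h ≠ ⊥ → ℛ (g * h) ≠ ⊥ := by
    intro g h hg hh
    obtain ⟨x, hx, hx0⟩ := Submodule.exists_mem_ne_zero_of_ne_bot hg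
    obtain ⟨y, hy, hy0⟩ := Submodule.exists_mem_ne_zero_of_ne_bot hh
    exact (Submodule.ne_bot_iff _).2
      ⟨x * y, hmul _ _ _ hx _ hy, ((hunit hx hx0).mul (hunit hy hy0)).ne_zero⟩
  have hfin : ∀ g, ℛ g ≠ ⊥ → Module.finrank F (ℛ g) = 1 := fun g hg =>
    le_antisymm (hdim g) (Nat.one_le_iff_ne_zero.2 (mt Submodule.finrank_eq_zero.1 hg))
  refine ⟨⟨{ carrier := {g | ℛ g ≠ ⊥}
             mul_mem' := fun {g h} hg hh => hsupp_mul g h hg hh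
             one_mem' := (Submodule.ne_bot_iff _).2 ⟨1, hone, one_ne_zero⟩
             inv_mem' := ?_ }, rfl⟩, ?_, hfin, ?_⟩
  · intro g hg
    obtain ⟨x, hx, hx0⟩ := Submodule.exists_mem_ne_zero_of_ne_bot hg
    obtain ⟨h, k, hhk, a, ha, b, hb, hab⟩ := exists_mul_mul_ne_zero hn hinternal hmul hx hx0
    have hinv : g⁻¹ = h * k :=
      inv_eq_of_mul_eq_one_right (by rw [← hhk, ← mul_assoc, mul_comm g h])
    change ℛ g⁻¹ ≠ ⊥
    rw [hinv]
    refine hsupp_mul h k ((Submodule.ne_bot_iff _).2 ⟨a, ha, ?_⟩)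
      ((Submodule.ne_bot_iff _).2 ⟨b, hb, ?_⟩) <;> rintro rfl <;> simp at hab
  · have hb := DirectSum.isInternal_ne_bot_iff.2 hinternal
    have hrank := Module.finrank_eq_nat_card_basis
      (hb.collectedBasis fun g => Module.finBasisOfFinrankEq F (ℛ g) (hfin g g.2))
    rw [Module.finrank_matrix, Nat.card_congr (Equiv.sigmaUnique _ _), Fintype.card_fin,
      Module.finrank_self, mul_one, ← sq] at hrank
    exact hrank.symm
  · intro hdvd
    have hn0 : (n : F) = 0 := (ringChar.spec F n).2 hdvd
    have hle : (⊤ : Submodule F (Matrix (Fin n) (Fin n) F)) ≤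
        LinearMap.ker (Matrix.traceLinearMap (Fin n) F F) := by
      rw [← hinternal.submodule_iSup_eq_top]
      refine iSup_le fun g x hx => ?_
      rw [LinearMap.mem_ker, Matrix.traceLinearMap_apply]
      by_cases hg : g = 1
      · subst hg
        obtain ⟨c, rfl⟩ := exists_smul_eq_of_finrank_le_one (hdim 1) hone one_ne_zero hx
        simp [hn0]
      · exact trace_eq_zero_of_mem hn hinternal hmul hdim hg hx
    have htr : Matrix.trace (Matrix.single (⟨0, hn⟩ : Fin n) ⟨0, hn⟩ (1 : F)) = 0 :=
      hle Submodule.mem_top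
    simp at htr
end

section
/- Let R = M_n(F) be endowed with a division G-grading with support T. Then there exists a unique map β : T × T → Fˣ such that X_u X_v = β(u,v) X_v X_u for all u,v ∈ T and all X_u ∈ R_u, X_v ∈ R_v. Moreover β is multiplicative in each variable, alternating (β(t,t) = 1 for all t ∈ T), and nondegenerate: if β(u,t) = 1 for all u ∈ T, then t = e. -/
namespace DivisionGrading

section Module

variable {F : Type*} [Field F] {G : Type*} [DecidableEq G]
  {M N : Type*} [AddCommGroup M] [Module F M] [AddCommGroup N] [Module F N]
  {ℛ : G → Submodule F M}

/-- Linear maps that agree on every component of a direct sum decomposition are equal. -/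
theorem linearMap_ext (hinternal : DirectSum.IsInternal ℛ) {f g : M →ₗ[F] N}
    (h : ∀ i, ∀ x ∈ ℛ i, f x = g x) (x : M) : f x = g x := by
  have hx : x ∈ ⨆ i, ℛ i := by
    rw [hinternal.submodule_iSup_eq_top]
    exact Submodule.mem_top
  induction hx using Submodule.iSup_induction' with
  | mem i x hx => exact h i x hx
  | zero => simp
  | add x y _ _ hx hy => rw [map_add, map_add, hx, hy]

/-- The projections onto the components of a direct sum decomposition. -/
theorem exists_projections (hinternal : DirectSum.IsInternal ℛ) :
    ∃ P : G → M →ₗ[F] M, (∀ g, ∀ x ∈ ℛ g, P g x = x) ∧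
      (∀ g h, h ≠ g → ∀ x ∈ ℛ h, P g x = 0) ∧ ∀ g x, P g x ∈ ℛ g := by
  let _ := hinternal.chooseDecomposition
  refine ⟨fun g => (ℛ g).subtype ∘ₗ DirectSum.component F G (fun i => ℛ i) g ∘ₗ
    (DirectSum.decomposeLinearEquiv ℛ).toLinearMap, fun g x hx => ?_, fun g h hne x hx => ?_,
    fun g x => ?_⟩
  · exact DirectSum.decompose_of_mem_same ℛ hx
  · exact DirectSum.decompose_of_mem_ne ℛ hx hne
  · exact Subtype.prop _

theorem eq_of_mem_of_mem (hinternal : DirectSum.IsInternal ℛ) {g h : G} {x : M}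
    (hg : x ∈ ℛ g) (hh : x ∈ ℛ h) (hx : x ≠ 0) : g = h := by
  obtain ⟨P, hsame, hne, -⟩ := exists_projections hinternal
  by_contra hgh
  exact hx ((hsame h x hh).symm.trans (hne h g hgh x hg))

end Module

section Algebra

variable {F : Type*} [Field F] {G : Type*} [CommGroup G] [DecidableEq G]

theorem one_mem {A : Type*} [Ring A] [Algebra F A] {ℛ : G → Submodule F A}
    (hinternal : DirectSum.IsInternal ℛ)
    (hmul : ∀ g h : G, ∀ x ∈ ℛ g, ∀ y ∈ ℛ h, x * y ∈ ℛ (g * h)) : (1 : A) ∈ ℛ 1 := by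
  obtain ⟨P, hsame, hne, hmem⟩ := exists_projections hinternal
  have hcomp : ∀ h, ∀ x ∈ ℛ h, ∀ y, P h (x * y) = x * P 1 y := by
    intro h x hx
    refine linearMap_ext hinternal (f := P h ∘ₗ LinearMap.mulLeft F x)
      (g := LinearMap.mulLeft F x ∘ₗ P 1) fun i y hy => ?_
    have hxy := hmul h i x hx y hy
    by_cases hi : i = 1
    · subst hi
      rw [mul_one] at hxy
      simp [hsame 1 y hy, hsame h _ hxy]
    · simp [hne 1 i hi y hy, hne h (h * i) (by simpa using hi) _ hxy]
  have hright : ∀ x, x * P 1 1 = x :=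
    linearMap_ext hinternal (f := LinearMap.mulRight F (P 1 1)) (g := LinearMap.id)
      fun i x hx => by simp [← hcomp i x hx, hsame i x hx]
  have hone : P 1 1 = (1 : A) := by simpa using hright 1
  exact hone ▸ hmem 1 1

theorem exists_smul_eq {M : Type*} [AddCommGroup M] [Module F M] [FiniteDimensional F M]
    {V : Submodule F M} (hV : Module.finrank F V ≤ 1)
    {x y : M} (hx : x ∈ V) (hx0 : x ≠ 0) (hy : y ∈ V) : ∃ c : F, c • x = y := by
  obtain ⟨v, hv⟩ := finrank_le_one_iff.mp hV
  obtain ⟨a, ha⟩ := hv ⟨x, hx⟩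
  obtain ⟨b, hb⟩ := hv ⟨y, hy⟩
  have ha : a • (v : M) = x := congrArg Subtype.val ha
  have hb : b • (v : M) = y := congrArg Subtype.val hb
  have ha0 : a ≠ 0 := by
    rintro rfl
    exact hx0 (by simpa using ha.symm)
  exact ⟨b * a⁻¹, by rw [← ha, ← hb, smul_smul, inv_mul_cancel_right₀ ha0]⟩

variable {n : ℕ} {ℛ : G → Submodule F (Matrix (Fin n) (Fin n) F)}

/-- Nonzero homogeneous elements of a division grading on matrices are invertible. -/
theorem isUnit_of_mem (hinternal : DirectSum.IsInternal ℛ)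
    (hmul : ∀ g h : G, ∀ x ∈ ℛ g, ∀ y ∈ ℛ h, x * y ∈ ℛ (g * h))
    (hdim : ∀ g : G, Module.finrank F (ℛ g) ≤ 1) {g : G} {x : Matrix (Fin n) (Fin n) F}
    (hx : x ∈ ℛ g) (hx0 : x ≠ 0) : IsUnit x := by
  have hone := one_mem hinternal hmul
  have hone0 : (1 : Matrix (Fin n) (Fin n) F) ≠ 0 := fun h => hx0 (by rw [← one_mul x, h, zero_mul])
  obtain ⟨P, hsame, hne, -⟩ := exists_projections hinternal
  by_contra hunit
  have hdet : x.det = 0 := by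
    simpa [Matrix.isUnit_iff_isUnit_det] using hunit
  have hhom : ∀ i, ∀ a ∈ ℛ i, ∀ j, ∀ b ∈ ℛ j, P 1 (a * x * b) = 0 := by
    intro i a ha j b hb
    have hab := hmul _ _ _ (hmul i g a ha x hx) b hb
    by_cases hdeg : i * g * j = 1
    · rw [hdeg] at hab
      obtain ⟨c, hc⟩ := exists_smul_eq (hdim 1) hone hone0 hab
      have hc0 : c ^ n = 0 := by
        have := congrArg Matrix.det hc
        simpa [Matrix.det_smul, hdet] using this
      rw [← hc, eq_zero_of_pow_eq_zero hc0, zero_smul, map_zero]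
    · exact hne 1 _ hdeg _ hab
  have hhom_left : ∀ i, ∀ a ∈ ℛ i, ∀ b, P 1 (a * x * b) = 0 := fun i a ha =>
    linearMap_ext hinternal (f := P 1 ∘ₗ LinearMap.mulLeft F (a * x)) (g := 0)
      fun j b hb => hhom i a ha j b hb
  have hall : ∀ b a, P 1 (a * x * b) = 0 := fun b =>
    linearMap_ext hinternal (f := P 1 ∘ₗ LinearMap.mulRight F b ∘ₗ LinearMap.mulRight F x)
      (g := 0) fun i a ha => hhom_left i a ha b
  obtain ⟨i, j, hij⟩ : ∃ i j, x i j ≠ 0 := by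
    by_contra! h
    exact hx0 (Matrix.ext h)
  have hsum : ∑ k, Matrix.single k i (1 : F) * x * Matrix.single j k (1 : F) =
      x i j • (1 : Matrix (Fin n) (Fin n) F) := by
    simp only [Matrix.single_mul_mul_single, one_mul, mul_one]
    rw [Matrix.smul_one_eq_diagonal, ← Matrix.sum_single_eq_diagonal]
  have hzero := congrArg (P 1) hsum
  rw [map_sum, Finset.sum_eq_zero fun k _ => hall _ _, map_smul, hsame 1 1 hone] at hzero
  exact (smul_ne_zero hij hone0) hzero.symm

/-- An element commuting with all homogeneous elements is homogeneous of trivial degree. -/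
theorem mem_one_of_commute (hinternal : DirectSum.IsInternal ℛ)
    (hmul : ∀ g h : G, ∀ x ∈ ℛ g, ∀ y ∈ ℛ h, x * y ∈ ℛ (g * h))
    {x : Matrix (Fin n) (Fin n) F} (hx : ∀ g, ∀ y ∈ ℛ g, y * x = x * y) : x ∈ ℛ 1 := by
  have hcomm : ∀ y, y * x = x * y :=
    linearMap_ext hinternal (f := LinearMap.mulRight F x) (g := LinearMap.mulLeft F x) hx
  obtain ⟨c, rfl⟩ := Matrix.mem_range_scalar_of_commute_single (M := x) fun i j _ => hcomm _
  rw [Matrix.scalar_apply, ← Matrix.smul_one_eq_diagonal]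
  exact (ℛ 1).smul_mem c (one_mem hinternal hmul)

theorem exists_commutation_factor (hinternal : DirectSum.IsInternal ℛ)
    (hmul : ∀ g h : G, ∀ x ∈ ℛ g, ∀ y ∈ ℛ h, x * y ∈ ℛ (g * h))
    (hdim : ∀ g : G, Module.finrank F (ℛ g) ≤ 1) (u v : G) :
    ∃ b : Fˣ, ∀ x ∈ ℛ u, ∀ y ∈ ℛ v, x * y = (b : F) • (y * x) := by
  by_cases hu : ℛ u = ⊥
  · refine ⟨1, fun x hx y _ => ?_⟩
    rw [hu, Submodule.mem_bot] at hx
    simp [hx]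
  by_cases hv : ℛ v = ⊥
  · refine ⟨1, fun x _ y hy => ?_⟩
    rw [hv, Submodule.mem_bot] at hy
    simp [hy]
  obtain ⟨x, hx, hx0⟩ := Submodule.exists_mem_ne_zero_of_ne_bot hu
  obtain ⟨y, hy, hy0⟩ := Submodule.exists_mem_ne_zero_of_ne_bot hv
  have hxu := isUnit_of_mem hinternal hmul hdim hx hx0
  have hxy0 : x * y ≠ 0 := fun h => hy0 (hxu.mul_right_eq_zero.mp h)
  have hyx0 : y * x ≠ 0 := fun h => hy0 (hxu.mul_left_eq_zero.mp h)
  have hyx : y * x ∈ ℛ (u * v) := mul_comm v u ▸ hmul v u y hy x hx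
  obtain ⟨c, hc⟩ := exists_smul_eq (hdim _) hyx hyx0 (hmul u v x hx y hy)
  have hc0 : c ≠ 0 := by
    rintro rfl
    exact hxy0 (by simpa using hc.symm)
  refine ⟨Units.mk0 c hc0, fun x' hx' y' hy' => ?_⟩
  obtain ⟨a, rfl⟩ := exists_smul_eq (hdim u) hx hx0 hx'
  obtain ⟨b, rfl⟩ := exists_smul_eq (hdim v) hy hy0 hy'
  simp only [smul_mul_assoc, mul_smul_comm, Units.val_mk0, ← hc, smul_smul]
  congr 1
  ring

end Algebra

end DivisionGrading

open DivisionGrading in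
/-- For a division `G`-grading on `Mₙ(F)` with support `T`, there is a
unique map `β : T × T → Fˣ` with `X_u X_v = β(u,v) X_v X_u`; it is multiplicative in
each variable, alternating, and nondegenerate. -/
theorem division_grading_bicharacter
    {F : Type*} [Field F] [IsAlgClosed F]
    {G : Type*} [CommGroup G] [DecidableEq G] {n : ℕ}
    (ℛ : G → Submodule F (Matrix (Fin n) (Fin n) F))
    (hinternal : DirectSum.IsInternal ℛ)
    (hmul : ∀ g h : G, ∀ x ∈ ℛ g, ∀ y ∈ ℛ h, x * y ∈ ℛ (g * h))
    (hdim : ∀ g : G, Module.finrank F (ℛ g) ≤ 1) :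
    ∃ β : G → G → Fˣ,
      -- the commutation relation on the support
      (∀ u ∈ {g : G | ℛ g ≠ ⊥}, ∀ v ∈ {g : G | ℛ g ≠ ⊥},
        ∀ x ∈ ℛ u, ∀ y ∈ ℛ v, x * y = (β u v : F) • (y * x)) ∧
      -- uniqueness on the support
      (∀ β' : G → G → Fˣ,
        (∀ u ∈ {g : G | ℛ g ≠ ⊥}, ∀ v ∈ {g : G | ℛ g ≠ ⊥},
          ∀ x ∈ ℛ u, ∀ y ∈ ℛ v, x * y = (β' u v : F) • (y * x)) →
        ∀ u ∈ {g : G | ℛ g ≠ ⊥}, ∀ v ∈ {g : G | ℛ g ≠ ⊥}, β' u v = β u v) ∧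
      -- multiplicative in each variable
      (∀ u ∈ {g : G | ℛ g ≠ ⊥}, ∀ v ∈ {g : G | ℛ g ≠ ⊥}, ∀ w ∈ {g : G | ℛ g ≠ ⊥},
        β u (v * w) = β u v * β u w ∧ β (u * v) w = β u w * β v w) ∧
      -- alternating
      (∀ t ∈ {g : G | ℛ g ≠ ⊥}, β t t = 1) ∧
      -- nondegenerate
      (∀ t ∈ {g : G | ℛ g ≠ ⊥}, (∀ u ∈ {g : G | ℛ g ≠ ⊥}, β u t = 1) → t = 1) := by
  choose β hβ using exists_commutation_factor hinternal hmul hdim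
  have hgen : ∀ g, ℛ g ≠ ⊥ → ∃ x ∈ ℛ g, IsUnit x ∧ x ≠ 0 := by
    intro g hg
    obtain ⟨x, hx, hx0⟩ := Submodule.exists_mem_ne_zero_of_ne_bot hg
    exact ⟨x, hx, isUnit_of_mem hinternal hmul hdim hx hx0, hx0⟩
  have hprod : ∀ {x y : Matrix (Fin n) (Fin n) F}, IsUnit x → y ≠ 0 → x * y ≠ 0 :=
    fun hx hy h => hy (hx.mul_right_eq_zero.mp h)
  have hcancel : ∀ {x : Matrix (Fin n) (Fin n) F} {a b : Fˣ}, x ≠ 0 →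
      (a : F) • x = (b : F) • x → a = b :=
    fun hx h => Units.ext (smul_left_injective F hx h)
  refine ⟨β, fun u _ v _ => hβ u v, fun β' hβ' u hu v hv => ?_,
    fun u hu v hv w hw => ⟨?_, ?_⟩, fun t ht => ?_, fun t ht hβt => ?_⟩
  · obtain ⟨x, hx, -, hx0⟩ := hgen u hu
    obtain ⟨y, hy, hyu, -⟩ := hgen v hv
    exact hcancel (hprod hyu hx0) ((hβ' u hu v hv x hx y hy).symm.trans (hβ u v x hx y hy))
  · obtain ⟨x, hx, -, hx0⟩ := hgen u hu
    obtain ⟨y, hy, hyu, -⟩ := hgen v hv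
    obtain ⟨z, hz, hzu, -⟩ := hgen w hw
    refine hcancel (hprod (hyu.mul hzu) hx0)
      ((hβ u (v * w) x hx (y * z) (hmul v w y hy z hz)).symm.trans ?_)
    rw [← mul_assoc, hβ u v x hx y hy, smul_mul_assoc, mul_assoc, hβ u w x hx z hz,
      mul_smul_comm, smul_smul, Units.val_mul, mul_assoc]
  · obtain ⟨x, hx, hxu, -⟩ := hgen u hu
    obtain ⟨y, hy, -, hy0⟩ := hgen v hv
    obtain ⟨z, hz, hzu, -⟩ := hgen w hw
    refine hcancel (hprod hzu (hprod hxu hy0))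
      ((hβ (u * v) w (x * y) (hmul u v x hx y hy) z hz).symm.trans ?_)
    rw [mul_assoc, hβ v w y hy z hz, mul_smul_comm, ← mul_assoc, hβ u w x hx z hz,
      smul_mul_assoc, smul_smul, Units.val_mul, mul_assoc, mul_comm (β v w : F)]
  · obtain ⟨x, hx, hxu, hx0⟩ := hgen t ht
    refine hcancel (hprod hxu hx0) ((hβ t t x hx x hx).symm.trans ?_)
    rw [Units.val_one, one_smul]
  · obtain ⟨x, hx, -, hx0⟩ := hgen t ht
    refine eq_of_mem_of_mem hinternal hx (mem_one_of_commute hinternal hmul fun g y hy => ?_) hx0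
    by_cases hg : ℛ g = ⊥
    · rw [hg, Submodule.mem_bot] at hy
      simp [hy]
    · rw [hβ g t y hy x hx, hβt g hg, Units.val_one, one_smul]
end

section
/- Let T be a subgroup of G. There exists a division G-grading on M_n(F) with support exactly T if and only if the characteristic of F does not divide n and there exist positive integers ℓ_1, …, ℓ_r with ℓ_1 ⋯ ℓ_r = n such that T is isomorphic to (Z/ℓ_1Z)² × ⋯ × (Z/ℓ_rZ)². -/
/-- The product of a family indexed by `Fin.cons m ℓ` splits off the factor indexed by `m`. -/
def piFinConsMulEquiv (α : ℕ → Type*) [∀ k, Mul (α k)] {r : ℕ} (m : ℕ) (ℓ : Fin r → ℕ) :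
    ((i : Fin (r + 1)) → α ((Fin.cons m ℓ : Fin (r + 1) → ℕ) i)) ≃* α m × ((i : Fin r) → α (ℓ i)) where
  toFun f := (f 0, fun i => f i.succ)
  invFun p := Fin.cons p.1 p.2
  left_inv f := by
    funext i
    refine Fin.cases ?_ (fun j => ?_) i <;> rfl
  right_inv p := rfl
  map_mul' f g := rfl

section Bicharacter
variable {F : Type*} [Field F] {A : Type*} [CommGroup A]

theorem bicharacter_swap (β : A →* A →* Fˣ) (halt : ∀ a, β a a = 1) (a b : A) :
    β b a = (β a b)⁻¹ := by
  have h := halt (a * b)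
  simp only [map_mul, MonoidHom.mul_apply, halt, one_mul, mul_one] at h
  exact eq_inv_of_mul_eq_one_left h

theorem exists_orderOf_bicharacter_eq_exponent [Finite A] (β : A →* A →* Fˣ)
    (hβ : Function.Injective β) :
    ∃ a b : A, orderOf (β a b) = Monoid.exponent A ∧ orderOf a = Monoid.exponent A ∧
      orderOf b = Monoid.exponent A := by
  obtain ⟨a, ha⟩ := Monoid.exists_orderOf_eq_exponent (G := A) Monoid.ExponentExists.of_finite
  have : Finite (β a).range := Set.finite_range (β a)
  obtain ⟨⟨_, b, rfl⟩, hb⟩ := IsCyclic.exists_ofOrder_eq_natCard (α := (β a).range)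
  rw [← Subgroup.orderOf_coe] at hb
  simp only at hb
  have hk : Monoid.exponent A ∣ orderOf (β a b) := by
    rw [hb, ← ha, orderOf_dvd_iff_pow_eq_one]
    apply hβ
    ext t : 1
    have := pow_card_eq_one' (x := (⟨β a t, t, rfl⟩ : (β a).range))
    simpa [Subtype.ext_iff] using this
  have h1 : orderOf (β a b) ∣ orderOf b := orderOf_map_dvd _ _
  have h2 := Monoid.order_dvd_exponent b
  exact ⟨a, b, (h1.trans h2).antisymm hk, ha, h2.antisymm (hk.trans h1)⟩

theorem zpowers_coprod_ker_bijective [Finite A] (β : A →* A →* Fˣ) (halt : ∀ a, β a a = 1)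
    {a b : A} (hab : orderOf (β a b) = Monoid.exponent A) (ha : orderOf a = Monoid.exponent A)
    (hb : orderOf b = Monoid.exponent A) :
    Function.Bijective (((Subgroup.zpowers a).subtype.coprod (Subgroup.zpowers b).subtype).coprod
      ((β a).ker ⊓ (β b).ker).subtype) := by
  have hba := bicharacter_swap β halt a b
  constructor
  · rw [injective_iff_map_eq_one]
    rintro ⟨⟨⟨_, i, rfl⟩, ⟨_, j, rfl⟩⟩, ⟨k, hka, hkb⟩⟩ h
    replace hka : β a k = 1 := hka
    replace hkb : β b k = 1 := hkb
    simp only [MonoidHom.coprod_apply, Subgroup.subtype_apply] at h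
    have h1 := congrArg (β a) h
    have h2 := congrArg (β b) h
    simp only [map_mul, map_zpow, halt, hka, hkb, one_zpow, one_mul, mul_one, map_one, hba] at h1 h2
    rw [← orderOf_dvd_iff_zpow_eq_one, hab, ← hb, orderOf_dvd_iff_zpow_eq_one] at h1
    rw [← orderOf_dvd_iff_zpow_eq_one, orderOf_inv, hab, ← ha, orderOf_dvd_iff_zpow_eq_one] at h2
    simp only [h1, h2, one_mul] at h
    simp [Prod.ext_iff, h1, h2, h]
  · intro t
    have : NeZero (Monoid.exponent A) := ⟨Monoid.exponent_ne_zero_of_finite⟩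
    have hζ : IsPrimitiveRoot (β a b) (Monoid.exponent A) := hab ▸ IsPrimitiveRoot.orderOf _
    have key (c : A) : ∃ i : ℤ, β a b ^ i = β c t := by
      have : β c t ∈ rootsOfUnity (Monoid.exponent A) F := by
        rw [mem_rootsOfUnity, ← map_pow, Monoid.pow_exponent_eq_one, map_one]
      rwa [← hζ.zpowers_eq] at this
    obtain ⟨j, hj⟩ := key a
    obtain ⟨i, hi⟩ := key b
    refine ⟨((⟨a ^ (-i), -i, rfl⟩, ⟨b ^ j, j, rfl⟩), ⟨t * (a ^ (-i) * b ^ j)⁻¹, ?_, ?_⟩), ?_⟩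
    · change β a _ = 1
      simp [halt, hj]
    · change β b _ = 1
      simp [halt, hba, hi]
    · exact mul_inv_cancel_comm_assoc _ _

theorem exists_mulEquiv_pi_zmod_sq_of_bicharacter [Finite A] (β : A →* A →* Fˣ)
    (halt : ∀ a, β a a = 1) (hβ : Function.Injective β) :
    ∃ (r : ℕ) (ℓ : Fin r → ℕ), (∀ i, 0 < ℓ i) ∧
      Nonempty (A ≃* ((i : Fin r) → Multiplicative (ZMod (ℓ i)) × Multiplicative (ZMod (ℓ i)))) := by
  induction hN : Nat.card A using Nat.strong_induction_on generalizing A with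
  | _ N ih =>
  subst hN
  rcases subsingleton_or_nontrivial A with hA | hA
  · refine ⟨0, Fin.elim0, fun i => i.elim0, ⟨?_⟩⟩
    have : Unique A := uniqueOfSubsingleton 1
    exact MulEquiv.ofUnique
  · obtain ⟨a, b, hab, ha, hb⟩ := exists_orderOf_bicharacter_eq_exponent β hβ
    have hbij := zpowers_coprod_ker_bijective β halt hab ha hb
    set K : Subgroup A := (β a).ker ⊓ (β b).ker
    let e := MulEquiv.ofBijective _ hbij
    set m := Monoid.exponent A with hm
    have hm0 : 0 < m := Nat.pos_of_ne_zero Monoid.exponent_ne_zero_of_finite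
    have hm1 : 1 < m := by
      have : m ≠ 1 := Monoid.exp_eq_one_iff.not.2 (not_subsingleton A)
      omega
    have : NeZero m := ⟨hm0.ne'⟩
    have hcard : Nat.card A = m * m * Nat.card K := by
      rw [← Nat.card_congr e.toEquiv, Nat.card_prod, Nat.card_prod, Nat.card_zpowers,
        Nat.card_zpowers, ha, hb]
    have hlt : Nat.card K < Nat.card A := by
      have : 0 < Nat.card K := Nat.card_pos
      rw [hcard]
      exact lt_mul_of_one_lt_left this (Nat.one_lt_mul_iff.2 ⟨hm0, hm0, .inl hm1⟩)
    obtain ⟨r, ℓ, hℓ, ⟨f⟩⟩ := ih _ hlt ((β.comp K.subtype).compl₂ K.subtype)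
      (fun k => halt k) (by
        rw [injective_iff_map_eq_one]
        intro k hk
        have hk' (u : K) : β k u = 1 := DFunLike.congr_fun hk u
        obtain ⟨k, hka, hkb⟩ := k
        replace hka : β a k = 1 := hka
        replace hkb : β b k = 1 := hkb
        ext1
        apply hβ
        ext1 t
        rw [OneMemClass.coe_one, map_one, MonoidHom.one_apply]
        obtain ⟨⟨⟨⟨_, i, rfl⟩, ⟨_, j, rfl⟩⟩, u⟩, rfl⟩ := hbij.2 t
        have := hk' u
        simp only at this
        simp [bicharacter_swap β halt a k, bicharacter_swap β halt b k, hka, hkb, this]) rfl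
    have ea : Subgroup.zpowers a ≃* Multiplicative (ZMod m) :=
      mulEquivOfCyclicCardEq (by simp [Nat.card_zpowers, ha])
    have eb : Subgroup.zpowers b ≃* Multiplicative (ZMod m) :=
      mulEquivOfCyclicCardEq (by simp [Nat.card_zpowers, hb])
    refine ⟨r + 1, Fin.cons m ℓ, fun i => ?_, ⟨?_⟩⟩
    · refine Fin.cases ?_ (fun j => ?_) i
      · exact hm0
      · exact hℓ j
    · exact e.symm.trans ((MulEquiv.prodCongr (MulEquiv.prodCongr ea eb) f).trans
        (piFinConsMulEquiv (fun k => Multiplicative (ZMod k) × Multiplicative (ZMod k)) m ℓ).symm)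

end Bicharacter

section TwistedBasis
variable {F : Type*} [Field F] {A : Type*} [CommGroup A] {ι : Type*} [Fintype ι] [DecidableEq ι]
  (b : Module.Basis A F (Matrix ι ι F)) {α : A → A → F}

theorem exists_one_eq_smul_of_twisted (hα : ∀ s t, b s * b t = α s t • b (s * t)) :
    ∃ c : F, (1 : Matrix ι ι F) = c • b 1 := by
  refine ⟨b.coord 1 1, ?_⟩
  have hcoord (s : A) : b.coord s ∘ₗ LinearMap.mulLeft F (b s) = α s 1 • b.coord 1 :=
    b.ext fun t => by
      rcases eq_or_ne t 1 with rfl | ht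
      · simp [hα]
      · simp [hα, ht]
  have hid : LinearMap.mulRight F (b.coord 1 1 • b 1) = LinearMap.id := b.ext fun s => by
    have h := LinearMap.congr_fun (hcoord s) 1
    simp only [LinearMap.comp_apply, LinearMap.mulLeft_apply, mul_one, LinearMap.smul_apply,
      Module.Basis.coord_apply, Module.Basis.repr_self, Finsupp.single_eq_same, smul_eq_mul] at h
    simp [hα, smul_smul, mul_comm, ← h]
  simpa using (LinearMap.congr_fun hid 1).symm

theorem isUnit_of_twisted [Nonempty ι] (hα : ∀ s t, b s * b t = α s t • b (s * t)) (s : A) :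
    IsUnit (b s) := by
  classical
  obtain ⟨c, hc⟩ := exists_one_eq_smul_of_twisted b hα
  have hc0 : c ≠ 0 := by
    rintro rfl
    simp at hc
  have hb1 : b 1 = c⁻¹ • (1 : Matrix ι ι F) := by rw [hc, smul_smul, inv_mul_cancel₀ hc0, one_smul]
  obtain ⟨t, u, htu⟩ : ∃ t u, b.coord 1 (b t * b s * b u) ≠ 0 := by
    by_contra! h
    have hl (u : A) : b.coord 1 ∘ₗ LinearMap.mulRight F (b s * b u) = 0 :=
      b.ext fun t => by simpa [mul_assoc] using h t u
    have hr (x : Matrix ι ι F) : b.coord 1 ∘ₗ LinearMap.mulLeft F (x * b s) = 0 :=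
      b.ext fun u => by simpa [mul_assoc] using LinearMap.congr_fun (hl u) x
    obtain ⟨p, q, hpq⟩ : ∃ p q, b s p q ≠ 0 := by
      by_contra! h0
      exact b.ne_zero s (Matrix.ext h0)
    have hsum : ∑ i, Matrix.single i p 1 * b s * Matrix.single q i 1 =
        (b s p q * c) • b 1 := by
      rw [mul_smul, ← hc]
      ext i j
      rcases eq_or_ne i j with rfl | hij
      · simp [Matrix.single_mul_mul_single, Matrix.sum_apply, Matrix.single_apply]
      · simp only [Matrix.single_mul_mul_single, Matrix.sum_apply, Matrix.single_apply,
          Matrix.smul_apply, Matrix.one_apply_ne hij, smul_zero]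
        exact Finset.sum_eq_zero fun k _ => if_neg fun hk => hij (hk.1.symm.trans hk.2)
    have h0 : b.coord 1 (∑ i, Matrix.single i p 1 * b s * Matrix.single q i 1) = 0 := by
      rw [map_sum]
      exact Finset.sum_eq_zero fun i _ => LinearMap.congr_fun (hr _) _
    rw [hsum] at h0
    simp [hpq, hc0] at h0
  have hprod : b t * b s * b u = (α t s * α (t * s) u) • b (t * s * u) := by
    rw [hα, smul_mul_assoc, hα, smul_smul]
  rw [hprod] at htu
  simp only [map_smul, Module.Basis.coord_apply, Module.Basis.repr_self, Finsupp.single_apply,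
    smul_eq_mul, mul_ite, mul_one, mul_zero, ne_eq, ite_eq_right_iff, Classical.not_imp] at htu
  rw [htu.1, hb1, smul_smul] at hprod
  have hu : IsUnit (b t * b s * b u) := by
    rw [hprod]
    exact (isUnit_one).smul (Units.mk0 _ (mul_ne_zero htu.2 (inv_ne_zero hc0)))
  exact (IsUnit.mul_iff.1 (IsUnit.mul_iff.1 hu).1).2

theorem exists_bicharacter_of_twisted [Nonempty ι] (hα : ∀ s t, b s * b t = α s t • b (s * t)) :
    ∃ β : A →* A →* Fˣ, (∀ a, β a a = 1) ∧ Function.Injective β := by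
  have hunit := isUnit_of_twisted b hα
  have hne (s t : A) : b s * b t ≠ 0 := ((hunit s).mul (hunit t)).ne_zero
  have hα0 (s t : A) : α s t ≠ 0 := fun h => hne s t (by rw [hα, h, zero_smul])
  have hex (s t : A) : ∃ c : Fˣ, b s * b t = (c : F) • (b t * b s) := by
    refine ⟨Units.mk0 (α s t * (α t s)⁻¹) (mul_ne_zero (hα0 _ _) (inv_ne_zero (hα0 _ _))), ?_⟩
    rw [hα, hα t s, Units.val_mk0, smul_smul, mul_assoc, inv_mul_cancel₀ (hα0 _ _), mul_one,
      mul_comm s t]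
  have huniq {s t : A} {c d : Fˣ} (hc : b s * b t = (c : F) • (b t * b s))
      (hd : b s * b t = (d : F) • (b t * b s)) : c = d :=
    Units.ext (smul_left_injective F (hne t s) (hc.symm.trans hd))
  choose β hβ using hex
  have halt (s : A) : β s s = 1 := huniq (hβ s s) (by simp)
  have hmul (s t u : A) : β s (t * u) = β s t * β s u := by
    refine huniq (hβ s (t * u)) (smul_right_injective _ (hα0 t u) ?_)
    simp only
    rw [← mul_smul_comm, ← hα, ← mul_assoc, hβ s t, smul_mul_assoc, mul_assoc, hβ s u,
      mul_smul_comm, ← mul_assoc, hα t u, smul_smul, smul_mul_assoc, smul_comm, Units.val_mul]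
  have hswap (s t : A) : β s t = (β t s)⁻¹ := by
    refine huniq (hβ s t) ?_
    rw [hβ t s, smul_smul, Units.inv_mul, one_smul]
  refine ⟨MonoidHom.mk' (fun s => MonoidHom.mk' (β s) (hmul s)) fun s t => ?_, halt, ?_⟩
  · ext1 u
    simp only [MonoidHom.mk'_apply, MonoidHom.mul_apply]
    rw [hswap, hmul, hswap s, hswap t, mul_inv]
  · rw [injective_iff_map_eq_one]
    intro s hs
    have hs' (t : A) : β s t = 1 := DFunLike.congr_fun hs t
    have hcomm : LinearMap.mulLeft F (b s) = LinearMap.mulRight F (b s) := b.ext fun t => by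
      simpa [hs'] using hβ s t
    obtain ⟨d, hd⟩ := Matrix.mem_range_scalar_iff_commute_single'.2 fun i j =>
      (LinearMap.congr_fun hcomm (Matrix.single i j 1)).symm
    obtain ⟨c, hc⟩ := exists_one_eq_smul_of_twisted b hα
    have hsc : b s = (d * c) • b 1 := by
      rw [← hd, mul_smul, ← hc, Matrix.scalar_apply, Matrix.smul_one_eq_diagonal]
    by_contra hs1
    have h := congrArg (fun x => b.repr x s) hsc
    simp [Ne.symm hs1] at h

end TwistedBasis

theorem not_ringChar_dvd_card_of_bicharacter {F A : Type*} [Field F] [CommGroup A] [Finite A]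
    (β : A →* A →* Fˣ) (hβ : Function.Injective β) : ¬ ringChar F ∣ Nat.card A := by
  intro hdvd
  rcases CharP.char_is_prime_or_zero F (ringChar F) with hp | h0
  · have := Fact.mk hp
    obtain ⟨t, ht⟩ := exists_prime_orderOf_dvd_card' _ hdvd
    have ht1 : t = 1 := by
      refine hβ (MonoidHom.ext fun s => Units.ext ?_)
      have h : ((β t s : Fˣ) : F) ^ ringChar F = 1 := by
        rw [← Units.val_pow_eq_pow_val, ← MonoidHom.pow_apply, ← map_pow, ← ht, pow_orderOf_eq_one]
        simp
      have h2 := sub_pow_char ((β t s : Fˣ) : F) 1 (p := ringChar F)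
      rw [h, one_pow, sub_self] at h2
      simpa [sub_eq_zero] using eq_zero_of_pow_eq_zero h2
    rw [ht1, orderOf_one] at ht
    exact hp.one_lt.ne ht
  · rw [h0, zero_dvd_iff] at hdvd
    exact Nat.card_pos.ne' hdvd

section Grading

theorem exists_twisted_basis_of_grading {F R G : Type*} [Field F] [Ring R] [Algebra F R]
    [FiniteDimensional F R] [CommGroup G] [DecidableEq G] {T : Subgroup G} {ℛ : G → Submodule F R}
    (hℛ : DirectSum.IsInternal ℛ)
    (hmul : ∀ g h : G, ∀ x ∈ ℛ g, ∀ y ∈ ℛ h, x * y ∈ ℛ (g * h))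
    (hrank : ∀ g : G, Module.finrank F (ℛ g) ≤ 1) (hsupp : ∀ g : G, ℛ g ≠ ⊥ ↔ g ∈ T) :
    ∃ (b : Module.Basis T F R) (α : T → T → F), ∀ s t, b s * b t = α s t • b (s * t) := by
  have hex (t : T) : ∃ x ∈ ℛ t, x ≠ 0 := (ℛ t).exists_mem_ne_zero_of_ne_bot ((hsupp t).2 t.2)
  choose v hv hv0 using hex
  have hspan (t : T) (y : R) (hy : y ∈ ℛ t) : ∃ c : F, y = c • v t := by
    obtain ⟨w, hw⟩ := finrank_le_one_iff.1 (hrank t)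
    obtain ⟨c, hc⟩ := hw ⟨y, hy⟩
    obtain ⟨d, hd⟩ := hw ⟨v t, hv t⟩
    replace hc : c • (w : R) = y := congrArg Subtype.val hc
    replace hd : d • (w : R) = v t := congrArg Subtype.val hd
    have hd0 : d ≠ 0 := by
      rintro rfl
      exact hv0 t (by rw [← hd, zero_smul])
    exact ⟨c * d⁻¹, by rw [← hd, smul_smul, mul_assoc, inv_mul_cancel₀ hd0, mul_one, hc]⟩
  have hli : LinearIndependent F v :=
    iSupIndep.linearIndependent (fun t : T => ℛ t)
      (hℛ.submodule_iSupIndep.comp Subtype.val_injective) hv hv0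
  have htop : ⊤ ≤ Submodule.span F (Set.range v) := by
    rw [← hℛ.submodule_iSup_eq_top, iSup_le_iff]
    intro g y hy
    by_cases hg : g ∈ T
    · obtain ⟨c, rfl⟩ := hspan ⟨g, hg⟩ y hy
      exact Submodule.smul_mem _ _ (Submodule.subset_span ⟨_, rfl⟩)
    · have : ℛ g = ⊥ := not_not.1 (mt (hsupp g).1 hg)
      rw [this, Submodule.mem_bot] at hy
      exact hy ▸ Submodule.zero_mem _
  choose α hα using fun s t : T => hspan (s * t) _ (hmul s t _ (hv s) _ (hv t))
  exact ⟨Module.Basis.mk hli htop, α, fun s t => by simpa using hα s t⟩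

theorem exists_grading_of_twisted_basis {F R G : Type*} [Field F] [Ring R] [Algebra F R]
    [CommGroup G] [DecidableEq G] {T : Subgroup G} (b : Module.Basis T F R) {α : T → T → F}
    (hα : ∀ s t, b s * b t = α s t • b (s * t)) :
    ∃ ℛ : G → Submodule F R,
      DirectSum.IsInternal ℛ ∧
      (∀ g h : G, ∀ x ∈ ℛ g, ∀ y ∈ ℛ h, x * y ∈ ℛ (g * h)) ∧
      (∀ g : G, Module.finrank F (ℛ g) ≤ 1) ∧
      (∀ g : G, ℛ g ≠ ⊥ ↔ g ∈ T) := by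
  have hmem (t : T) : Submodule.span F (b '' (Subtype.val ⁻¹' {(t : G)})) = F ∙ b t := by
    rw [← Set.image_singleton (f := Subtype.val), Set.preimage_image_eq _ Subtype.val_injective,
      Set.image_singleton]
  have hnot {g : G} (hg : g ∉ T) :
      Submodule.span F (b '' ((Subtype.val : T → G) ⁻¹' {g})) = ⊥ := by
    have : (Subtype.val : T → G) ⁻¹' {g} = ∅ := by
      ext t
      simp only [Set.mem_preimage, Set.mem_singleton_iff, Set.mem_empty_iff_false, iff_false]
      rintro rfl
      exact hg t.2
    rw [this, Set.image_empty, Submodule.span_empty]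
  refine ⟨fun g => Submodule.span F (b '' (Subtype.val ⁻¹' {g})),
    DirectSum.isInternal_submodule_of_iSupIndep_of_iSup_eq_top ?_ ?_, ?_, ?_, ?_⟩
  · intro g
    refine (b.linearIndependent.disjoint_span_image
      (s := Subtype.val ⁻¹' {g}) (t := Subtype.val ⁻¹' {g}ᶜ)
      (disjoint_compl_right.preimage _)).mono_right (iSup₂_le fun h hh => ?_)
    refine Submodule.span_mono (Set.image_mono (Set.preimage_mono ?_))
    simpa using hh.symm
  · rw [eq_top_iff, ← b.span_eq, Submodule.span_le]
    rintro _ ⟨t, rfl⟩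
    exact Submodule.mem_iSup_of_mem (t : G) (Submodule.subset_span ⟨t, rfl, rfl⟩)
  · intro g h x hx y hy
    have hxy := Submodule.mul_mem_mul hx hy
    rw [Submodule.span_mul_span] at hxy
    refine (Submodule.span_le.2 ?_) hxy
    rintro _ ⟨_, ⟨s, rfl, rfl⟩, _, ⟨t, rfl, rfl⟩, rfl⟩
    simp only [hα]
    exact Submodule.smul_mem _ _ (Submodule.subset_span ⟨s * t, rfl, rfl⟩)
  · intro g
    by_cases hg : g ∈ T
    · lift g to T using hg
      change Module.finrank F (Submodule.span F (b '' (Subtype.val ⁻¹' {(g : G)}))) ≤ 1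
      rw [hmem, finrank_span_singleton (b.ne_zero g)]
    · change Module.finrank F (Submodule.span F (b '' (Subtype.val ⁻¹' {g}))) ≤ 1
      rw [hnot hg, finrank_bot]
      exact zero_le_one
  · intro g
    by_cases hg : g ∈ T
    · lift g to T using hg
      simp only [hmem]
      simp [b.ne_zero]
    · simp [hnot hg, hg]

end Grading

section Weyl
variable {F : Type*} [Field F] {A : Type*} [CommGroup A] [DecidableEq A]

/-- The translation by `s.1` composed with multiplication by the character `s.2`, as a matrix. -/
def weylMatrix (s : A × (A →* Fˣ)) : Matrix A A F :=
  Matrix.of fun x y => if x = s.1 * y then (s.2 y : F) else 0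

theorem weylMatrix_mul [Fintype A] (s t : A × (A →* Fˣ)) :
    weylMatrix s * weylMatrix t = (s.2 t.1 : F) • weylMatrix (s * t) := by
  ext x z
  simp [weylMatrix, Matrix.mul_apply, mul_assoc]

theorem linearIndependent_weylMatrix :
    LinearIndependent F (weylMatrix : A × (A →* Fˣ) → Matrix A A F) := by
  have hchar : LinearIndependent F (fun (χ : A →* Fˣ) (y : A) => (χ y : F)) :=
    (linearIndependent_monoidHom A F).comp (fun χ : A →* Fˣ => (Units.coeHom F).comp χ)
      fun χ ψ h => MonoidHom.ext fun y => Units.ext (DFunLike.congr_fun h y)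
  rw [linearIndependent_iff] at hchar ⊢
  intro l hl
  ext ⟨a, χ⟩
  have h := hchar (l.comapDomain (Prod.mk a) (Prod.mk_right_injective a).injOn) ?_
  · exact DFunLike.congr_fun h χ
  · ext y
    have h2 := congrFun (congrFun hl (a * y)) y
    simp only [Finsupp.linearCombination_apply, Finsupp.sum, weylMatrix, Matrix.sum_apply,
      Matrix.smul_apply, Matrix.of_apply, Matrix.zero_apply, mul_left_inj] at h2
    simp only [Finsupp.linearCombination_apply, Finsupp.sum, Finset.sum_apply, Pi.smul_apply,
      Pi.zero_apply, Finsupp.comapDomain_support, Finsupp.comapDomain_apply]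
    rw [← h2, ← Finset.sum_preimage (Prod.mk a) l.support (Prod.mk_right_injective a).injOn]
    · simp
    · rintro ⟨c, ψ⟩ - hc
      have hac : a ≠ c := by
        rintro rfl
        exact hc ⟨ψ, rfl⟩
      simp [hac]

variable (F A) in
theorem exists_twisted_basis_prod_dual [IsAlgClosed F] [Fintype A]
    (hA : ¬ ringChar F ∣ Fintype.card A) :
    ∃ b : Module.Basis (A × A) F (Matrix A A F), ∃ α : A × A → A × A → F,
      ∀ s t, b s * b t = α s t • b (s * t) := by
  have hexp : ¬ ringChar F ∣ Monoid.exponent A := fun h =>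
    hA (h.trans (Nat.card_eq_fintype_card (α := A) ▸ Group.exponent_dvd_nat_card))
  have : NeZero (Monoid.exponent A : F) := ⟨fun h => hexp (ringChar.dvd h)⟩
  obtain ⟨e⟩ := CommGroup.monoidHom_mulEquiv_of_hasEnoughRootsOfUnity A F
  have : Finite (A →* Fˣ) := .of_equiv _ e.symm.toEquiv
  have : Fintype (A →* Fˣ) := .ofFinite _
  let e' : A × (A →* Fˣ) ≃* A × A := (MulEquiv.refl A).prodCongr e
  let b := basisOfLinearIndependentOfCardEqFinrank (linearIndependent_weylMatrix (F := F) (A := A))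
    (by rw [Fintype.card_congr e'.toEquiv, Module.finrank_matrix, Module.finrank_self, mul_one,
      Fintype.card_prod])
  refine ⟨b.reindex e'.toEquiv, fun s t => (e'.symm s).2 (e'.symm t).1, fun s t => ?_⟩
  have hb (u : A × A) : b.reindex e'.toEquiv u = weylMatrix (e'.symm u) := by
    simp [b, Module.Basis.reindex_apply]
  rw [hb, hb, hb, weylMatrix_mul, map_mul]

end Weyl

/-- A product of squares of multiplicative structures is the square of their product. -/
def piProdMulEquiv {ι : Type*} (M : ι → Type*) [∀ i, Mul (M i)] :
    ((i : ι) → M i × M i) ≃* ((i : ι) → M i) × ((i : ι) → M i) where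
  toEquiv := Equiv.arrowProdEquivProdArrow ι M M
  map_mul' _ _ := rfl

/-- A subgroup `T ≤ G` is the support of a division `G`-grading on
`Mₙ(F)` iff `char F ∤ n` and `T ≅ (ℤ/ℓ₁)² × ⋯ × (ℤ/ℓᵣ)²` with `ℓ₁ ⋯ ℓᵣ = n`. -/
theorem division_grading_exists_iff
    {F : Type*} [Field F] [IsAlgClosed F]
    {G : Type*} [CommGroup G] [DecidableEq G] {n : ℕ} (hn : 0 < n)
    (T : Subgroup G) :
    (∃ ℛ : G → Submodule F (Matrix (Fin n) (Fin n) F),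
      DirectSum.IsInternal ℛ ∧
      (∀ g h : G, ∀ x ∈ ℛ g, ∀ y ∈ ℛ h, x * y ∈ ℛ (g * h)) ∧
      (∀ g : G, Module.finrank F (ℛ g) ≤ 1) ∧
      (∀ g : G, ℛ g ≠ ⊥ ↔ g ∈ T)) ↔
    (¬ (ringChar F ∣ n) ∧
      ∃ (r : ℕ) (ℓ : Fin r → ℕ), (∀ i, 0 < ℓ i) ∧ (∏ i, ℓ i) = n ∧
        Nonempty (T ≃* ((i : Fin r) →
          Multiplicative (ZMod (ℓ i)) × Multiplicative (ZMod (ℓ i))))) := by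
  have : NeZero n := ⟨hn.ne'⟩
  constructor
  · rintro ⟨ℛ, hℛ, hmul, hrank, hsupp⟩
    obtain ⟨b, α, hα⟩ := exists_twisted_basis_of_grading hℛ hmul hrank hsupp
    obtain ⟨β, halt, hβ⟩ := exists_bicharacter_of_twisted b hα
    have : Finite T := Module.Finite.finite_basis b
    have hcard : Nat.card T = n * n := by
      rw [← Module.finrank_eq_nat_card_basis b]
      simp [Module.finrank_matrix]
    obtain ⟨r, ℓ, hℓ, ⟨e⟩⟩ := exists_mulEquiv_pi_zmod_sq_of_bicharacter β halt hβ
    refine ⟨fun h => not_ringChar_dvd_card_of_bicharacter β hβ (hcard ▸ h.mul_right n), r, ℓ, hℓ,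
      ?_, ⟨e⟩⟩
    rw [Nat.card_congr e.toEquiv, Nat.card_pi] at hcard
    simp only [Nat.card_prod, Nat.card_congr Multiplicative.toAdd, Nat.card_zmod,
      Finset.prod_mul_distrib] at hcard
    exact Nat.mul_self_inj.1 hcard
  · rintro ⟨hchar, r, ℓ, hℓ, hprod, ⟨e⟩⟩
    have (i : Fin r) : NeZero (ℓ i) := ⟨(hℓ i).ne'⟩
    let A := (i : Fin r) → Multiplicative (ZMod (ℓ i))
    have hA : Fintype.card A = n := by
      simp [A, Fintype.card_pi, ZMod.card, hprod]
    obtain ⟨b, α, hα⟩ := exists_twisted_basis_prod_dual F A (hA.symm ▸ hchar)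
    let f : T ≃* A × A := e.trans (piProdMulEquiv _)
    let φ := Matrix.reindexAlgEquiv F F (Fintype.equivFinOfCardEq hA)
    refine exists_grading_of_twisted_basis ((b.reindex f.symm.toEquiv).map φ.toLinearEquiv)
      (α := fun s t => α (f s) (f t)) fun s t => ?_
    have hb (u : T) : (b.reindex f.symm.toEquiv).map φ.toLinearEquiv u = φ (b (f u)) := by
      simp [Module.Basis.reindex_apply]
    rw [hb, hb, hb, ← map_mul, hα, map_smul, map_mul f]
end

section
/- Let R = M_n(F) carry two division G-gradings R = ⊕_{g∈G} R_g and R = ⊕_{g∈G} R'_g, with supports T and T' and associated bicharacters β and β', respectively. The two gradings are isomorphic, i.e., there exists an algebra automorphism ψ of R with ψ(R_g) = R'_g for all g ∈ G, if and only if T = T' and β = β'. -/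
open Matrix in
/-- A nonzero square matrix whose kernel is stable under every matrix is invertible. -/
theorem Matrix.isUnit_of_forall_mulVec_eq_zero {F : Type*} [Field F] {n : ℕ}
    {A : Matrix (Fin n) (Fin n) F} (hA : A ≠ 0)
    (h : ∀ (y : Matrix (Fin n) (Fin n) F) (v : Fin n → F), A *ᵥ v = 0 → A *ᵥ (y *ᵥ v) = 0) :
    IsUnit A := by
  rw [← Matrix.mulVec_injective_iff_isUnit]
  refine (injective_iff_map_eq_zero A.mulVecLin).2 fun v hv => ?_
  by_contra hv0
  obtain ⟨i, hi⟩ := Function.ne_iff.1 hv0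
  refine hA (Matrix.ext_of_mulVec_single fun j => ?_)
  have hsingle : Matrix.single j i (v i)⁻¹ *ᵥ v = Pi.single j 1 := by
    ext k
    rcases eq_or_ne k j with rfl | hk
    · simp [Matrix.single_mulVec, inv_mul_cancel₀ hi]
    · simp [Matrix.single_mulVec, hk]
  rw [← hsingle, h _ v hv, Matrix.zero_mulVec]

/-- A nonzero square matrix `A` with `A * y ∈ Mₙ(F) * A` for all `y` in a spanning family of
submodules is invertible. -/
theorem Matrix.isUnit_of_iSup_eq_top {F ι : Type*} [Field F] {n : ℕ}
    {ℛ : ι → Submodule F (Matrix (Fin n) (Fin n) F)} (htop : ⨆ g, ℛ g = ⊤)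
    {A : Matrix (Fin n) (Fin n) F} (hA : A ≠ 0)
    (h : ∀ g, ∀ y ∈ ℛ g, ∃ z, A * y = z * A) : IsUnit A := by
  refine Matrix.isUnit_of_forall_mulVec_eq_zero hA fun y v hv => ?_
  have hy : y ∈ ⨆ g, ℛ g := htop ▸ Submodule.mem_top
  induction hy using Submodule.iSup_induction' with
  | mem g y hy =>
    obtain ⟨z, hz⟩ := h g y hy
    rw [Matrix.mulVec_mulVec, hz, ← Matrix.mulVec_mulVec, hv, Matrix.mulVec_zero]
  | zero => simp
  | add y z _ _ hy hz => rw [Matrix.add_mulVec, Matrix.mulVec_add, hy, hz, add_zero]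

/-- Nonzero homogeneous elements are invertible if homogeneous elements commute up to scalars. -/
theorem Matrix.isUnit_of_homogeneous {F ι : Type*} [Field F] {n : ℕ}
    {ℛ : ι → Submodule F (Matrix (Fin n) (Fin n) F)} (htop : ⨆ g, ℛ g = ⊤)
    {β : ι → ι → Fˣ}
    (hβ : ∀ u ∈ {g | ℛ g ≠ ⊥}, ∀ v ∈ {g | ℛ g ≠ ⊥},
      ∀ x ∈ ℛ u, ∀ y ∈ ℛ v, x * y = (β u v : F) • (y * x))
    {u : ι} {x : Matrix (Fin n) (Fin n) F} (hx : x ∈ ℛ u) (hx0 : x ≠ 0) : IsUnit x := by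
  refine Matrix.isUnit_of_iSup_eq_top htop hx0 fun v y hy => ?_
  by_cases hy0 : y = 0
  · exact ⟨0, by simp [hy0]⟩
  · refine ⟨(β u v : F) • y, ?_⟩
    rw [hβ u ((ℛ u).ne_bot_iff.2 ⟨x, hx, hx0⟩) v ((ℛ v).ne_bot_iff.2 ⟨y, hy, hy0⟩) x hx y hy,
      smul_mul_assoc]

/-- A commuting family of endomorphisms of a nonzero finite-dimensional space over an
algebraically closed field has a common eigenvector. -/
theorem Module.End.exists_common_eigenvector {F V ι : Type*} [Field F] [IsAlgClosed F]
    [AddCommGroup V] [Module F V] [FiniteDimensional F V] [Nontrivial V]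
    (f : ι → Module.End F V) (hf : ∀ i j, Commute (f i) (f j)) :
    ∃ v : V, v ≠ 0 ∧ ∀ i, ∃ c : F, f i v = c • v := by
  let S : Set (Submodule F V) := {W | W ≠ ⊥ ∧ ∀ i, ∀ w ∈ W, f i w ∈ W}
  obtain ⟨W, ⟨hW0, hW⟩, hmin⟩ :=
    WellFounded.has_min (wellFounded_lt (α := Submodule F V)) S
      ⟨⊤, top_ne_bot, fun _ _ _ => Submodule.mem_top⟩
  obtain ⟨v, hv, hv0⟩ := W.ne_bot_iff.1 hW0
  refine ⟨v, hv0, fun i => ?_⟩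
  have : Nontrivial W := Submodule.nontrivial_iff_ne_bot.2 hW0
  obtain ⟨c, hc⟩ := Module.End.exists_eigenvalue ((f i).restrict (hW i))
  obtain ⟨w, hw⟩ := hc.exists_hasEigenvector
  have hwc : f i w = c • (w : V) := congrArg Subtype.val hw.apply_eq_smul
  have hmem : W ⊓ (f i).eigenspace c ∈ S := by
    refine ⟨(Submodule.ne_bot_iff _).2 ⟨w, ⟨w.2, Module.End.mem_eigenspace_iff.2 hwc⟩, ?_⟩, ?_⟩
    · exact fun h => hw.2 (Subtype.ext h)
    · rintro j z ⟨hzW, hz⟩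
      refine ⟨hW j z hzW, Module.End.mem_eigenspace_iff.2 ?_⟩
      have hz' := Module.End.mem_eigenspace_iff.1 hz
      rw [← Module.End.mul_apply, (hf i j).eq, Module.End.mul_apply, hz', map_smul]
  have heq : W ⊓ (f i).eigenspace c = W := by
    by_contra hne
    exact hmin _ hmem (lt_of_le_of_ne inf_le_left hne)
  rw [← heq] at hv
  exact ⟨c, Module.End.mem_eigenspace_iff.1 hv.2⟩

/-- If the commutation factor of `a₁, a₂` equals that of `b₁, b₂`, then the operators
`A ↦ bᵢ * A * aᵢ⁻¹` commute. -/
theorem LinearMap.commute_mulLeft_mulRight_inv {F R : Type*} [CommRing F] [Ring R] [Algebra F R]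
    {a₁ a₂ b₁ b₂ : Rˣ} {c : F} (ha : (a₁ * a₂ : R) = c • (a₂ * a₁ : R))
    (hb : (b₁ * b₂ : R) = c • (b₂ * b₁ : R)) :
    Commute (LinearMap.mulLeft F (b₁ : R) * LinearMap.mulRight F (↑a₁⁻¹ : R))
      (LinearMap.mulLeft F (b₂ : R) * LinearMap.mulRight F (↑a₂⁻¹ : R)) := by
  have hinv : (↑a₁⁻¹ * ↑a₂⁻¹ : R) = c • (↑a₂⁻¹ * ↑a₁⁻¹ : R) := by
    calc (↑a₁⁻¹ * ↑a₂⁻¹ : R)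
        = ↑a₁⁻¹ * ↑a₂⁻¹ * (a₁ * a₂) * (↑a₂⁻¹ * ↑a₁⁻¹) := by simp [mul_assoc]
      _ = c • (↑a₂⁻¹ * ↑a₁⁻¹ : R) := by
        rw [ha, mul_smul_comm, smul_mul_assoc]; simp [mul_assoc]
  ext A
  calc (b₁ * (b₂ * (A * ↑a₂⁻¹) * ↑a₁⁻¹) : R)
      = b₁ * b₂ * A * (↑a₂⁻¹ * ↑a₁⁻¹) := by simp only [mul_assoc]
    _ = b₂ * b₁ * A * (↑a₁⁻¹ * ↑a₂⁻¹) := by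
      rw [hb, hinv, smul_mul_assoc, smul_mul_assoc, mul_smul_comm]
    _ = b₂ * (b₁ * (A * ↑a₁⁻¹) * ↑a₂⁻¹) := by simp only [mul_assoc]

/-- Spanning families with the same support and the same commutation factors are intertwined by an
invertible matrix, up to scalars. -/
theorem Matrix.exists_unit_intertwining {F ι : Type*} [Field F] [IsAlgClosed F] {n : ℕ}
    [Nontrivial (Matrix (Fin n) (Fin n) F)]
    {ℛ ℛ' : ι → Submodule F (Matrix (Fin n) (Fin n) F)}
    (htop : ⨆ g, ℛ g = ⊤) (htop' : ⨆ g, ℛ' g = ⊤) {β β' : ι → ι → Fˣ}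
    (hβ : ∀ u ∈ {g | ℛ g ≠ ⊥}, ∀ v ∈ {g | ℛ g ≠ ⊥},
      ∀ x ∈ ℛ u, ∀ y ∈ ℛ v, x * y = (β u v : F) • (y * x))
    (hβ' : ∀ u ∈ {g | ℛ' g ≠ ⊥}, ∀ v ∈ {g | ℛ' g ≠ ⊥},
      ∀ x ∈ ℛ' u, ∀ y ∈ ℛ' v, x * y = (β' u v : F) • (y * x))
    (hT : {g | ℛ g ≠ ⊥} = {g | ℛ' g ≠ ⊥})
    (hββ' : ∀ u ∈ {g | ℛ g ≠ ⊥}, ∀ v ∈ {g | ℛ g ≠ ⊥}, β u v = β' u v) :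
    ∃ A : (Matrix (Fin n) (Fin n) F)ˣ, ∀ u, ∀ x ∈ ℛ u, x ≠ 0 → ∀ y ∈ ℛ' u, y ≠ 0 →
      ∃ c : Fˣ, (A * x : Matrix (Fin n) (Fin n) F) = (c : F) • (y * A) := by
  let M := Matrix (Fin n) (Fin n) F
  have hne {g} {x : M} (hx : x ∈ ℛ g) (hx0 : x ≠ 0) : g ∈ {g | ℛ g ≠ ⊥} :=
    (ℛ g).ne_bot_iff.2 ⟨x, hx, hx0⟩
  let f : {p : Mˣ × Mˣ // ∃ u, (p.1 : M) ∈ ℛ u ∧ (p.2 : M) ∈ ℛ' u} → Module.End F M :=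
    fun p => LinearMap.mulLeft F (p.1.2 : M) * LinearMap.mulRight F (↑p.1.1⁻¹ : M)
  obtain ⟨A, hA0, hA⟩ := Module.End.exists_common_eigenvector f (by
    rintro ⟨⟨a₁, b₁⟩, u, ha₁, hb₁⟩ ⟨⟨a₂, b₂⟩, v, ha₂, hb₂⟩
    have hu := hne ha₁ a₁.ne_zero
    have hv := hne ha₂ a₂.ne_zero
    refine LinearMap.commute_mulLeft_mulRight_inv (hβ u hu v hv _ ha₁ _ ha₂) ?_
    rw [hββ' u hu v hv]
    exact hβ' u (hT ▸ hu) v (hT ▸ hv) _ hb₁ _ hb₂)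
  have key : ∀ u, ∀ x ∈ ℛ u, x ≠ 0 → ∀ y ∈ ℛ' u, y ≠ 0 →
      ∃ c : Fˣ, A * x = (c : F) • (y * A) := by
    intro u x hx hx0 y hy hy0
    obtain ⟨a, rfl⟩ := Matrix.isUnit_of_homogeneous htop hβ hx hx0
    obtain ⟨b, rfl⟩ := Matrix.isUnit_of_homogeneous htop' hβ' hy hy0
    obtain ⟨c, hc⟩ := hA ⟨(a, b), u, hx, hy⟩
    have hc : (b : M) * (A * (↑a⁻¹ : M)) = c • A := hc
    have hc' : (b : M) * A = c • (A * (a : M)) := by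
      rw [← smul_mul_assoc, ← hc]; simp [mul_assoc]
    have hc0 : c ≠ 0 := by
      rintro rfl
      rw [zero_smul, Units.mul_right_eq_zero] at hc'
      exact hA0 hc'
    exact ⟨(Units.mk0 c hc0)⁻¹, by rw [hc', smul_smul]; simp [hc0]⟩
  have hAu : IsUnit A := by
    refine Matrix.isUnit_of_iSup_eq_top htop hA0 fun u x hx => ?_
    by_cases hx0 : x = 0
    · exact ⟨0, by simp [hx0]⟩
    · have hu : u ∈ {g | ℛ' g ≠ ⊥} := hT ▸ hne hx hx0
      obtain ⟨y, hy, hy0⟩ := (ℛ' u).ne_bot_iff.1 hu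
      obtain ⟨c, hc⟩ := key u x hx hx0 y hy hy0
      exact ⟨(c : F) • y, by rw [hc, smul_mul_assoc]⟩
  obtain ⟨A, rfl⟩ := hAu
  exact ⟨A, key⟩


/-- Two division `G`-gradings on `Mₙ(F)` are isomorphic iff they have the
same support and the same associated bicharacter. -/
theorem division_gradings_isomorphic_iff
    {F : Type*} [Field F] [IsAlgClosed F]
    {G : Type*} [CommGroup G] [DecidableEq G] {n : ℕ}
    (ℛ ℛ' : G → Submodule F (Matrix (Fin n) (Fin n) F))
    (hinternal : DirectSum.IsInternal ℛ) (hinternal' : DirectSum.IsInternal ℛ')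
    (hmul : ∀ g h : G, ∀ x ∈ ℛ g, ∀ y ∈ ℛ h, x * y ∈ ℛ (g * h))
    (hmul' : ∀ g h : G, ∀ x ∈ ℛ' g, ∀ y ∈ ℛ' h, x * y ∈ ℛ' (g * h))
    (hdim : ∀ g : G, Module.finrank F (ℛ g) ≤ 1)
    (hdim' : ∀ g : G, Module.finrank F (ℛ' g) ≤ 1)
    (β β' : G → G → Fˣ)
    (hβ : ∀ u ∈ {g : G | ℛ g ≠ ⊥}, ∀ v ∈ {g : G | ℛ g ≠ ⊥},
      ∀ x ∈ ℛ u, ∀ y ∈ ℛ v, x * y = (β u v : F) • (y * x))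
    (hβ' : ∀ u ∈ {g : G | ℛ' g ≠ ⊥}, ∀ v ∈ {g : G | ℛ' g ≠ ⊥},
      ∀ x ∈ ℛ' u, ∀ y ∈ ℛ' v, x * y = (β' u v : F) • (y * x)) :
    (∃ ψ : Matrix (Fin n) (Fin n) F ≃ₐ[F] Matrix (Fin n) (Fin n) F,
      ∀ g : G, (ℛ g).map ψ.toLinearMap = ℛ' g) ↔
    ({g : G | ℛ g ≠ ⊥} = {g : G | ℛ' g ≠ ⊥} ∧
      ∀ u ∈ {g : G | ℛ g ≠ ⊥}, ∀ v ∈ {g : G | ℛ g ≠ ⊥}, β u v = β' u v) := by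
  have htop := hinternal.submodule_iSup_eq_top
  have htop' := hinternal'.submodule_iSup_eq_top
  constructor
  · rintro ⟨ψ, hψ⟩
    have hψ_mem {g x} (hx : x ∈ ℛ g) : ψ x ∈ ℛ' g := hψ g ▸ Submodule.mem_map_of_mem hx
    have hT : {g : G | ℛ g ≠ ⊥} = {g : G | ℛ' g ≠ ⊥} := by
      ext g
      have h := (Submodule.map_injective_of_injective (f := ψ.toLinearMap) ψ.injective).ne_iff
        (x := ℛ g) (y := ⊥)
      rw [Submodule.map_bot, hψ g] at h
      exact h.symm
    refine ⟨hT, fun u hu v hv => ?_⟩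
    obtain ⟨x, hx, hx0⟩ := (ℛ u).ne_bot_iff.1 hu
    obtain ⟨y, hy, hy0⟩ := (ℛ v).ne_bot_iff.1 hv
    have hyx : ψ (y * x) ≠ 0 := by
      rw [Ne, map_eq_zero_iff ψ ψ.injective,
        (Matrix.isUnit_of_homogeneous htop hβ hy hy0).mul_right_eq_zero]
      exact hx0
    have h := congrArg ψ (hβ u hu v hv x hx y hy)
    rw [map_mul, hβ' u (hT ▸ hu) v (hT ▸ hv) _ (hψ_mem hx) _ (hψ_mem hy), map_smul,
      ← map_mul] at h
    exact Units.ext (smul_left_injective F hyx h).symm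
  · rintro ⟨hT, hββ'⟩
    rcases subsingleton_or_nontrivial (Matrix (Fin n) (Fin n) F) with hn | hn
    · exact ⟨AlgEquiv.refl, fun g => Subsingleton.elim _ _⟩
    obtain ⟨A, hA⟩ := Matrix.exists_unit_intertwining htop htop' hβ hβ' hT hββ'
    have hconj : ∀ g, ∀ x ∈ ℛ g, x ≠ 0 → ∀ y ∈ ℛ' g, y ≠ 0 → ∃ c : Fˣ,
        MulSemiringAction.toAlgEquiv F (Matrix (Fin n) (Fin n) F) (ConjAct.toConjAct A) x
          = (c : F) • y := by
      intro g x hx hx0 y hy hy0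
      obtain ⟨c, hc⟩ := hA g x hx hx0 y hy hy0
      refine ⟨c, ?_⟩
      rw [MulSemiringAction.toAlgEquiv_apply, ConjAct.units_smul_def, ConjAct.ofConjAct_toConjAct,
        hc, smul_mul_assoc, mul_assoc, Units.mul_inv, mul_one]
    refine ⟨MulSemiringAction.toAlgEquiv F _ (ConjAct.toConjAct A), fun g => le_antisymm ?_ ?_⟩
    · rintro _ ⟨x, hx, rfl⟩
      by_cases hx0 : x = 0
      · rw [hx0, map_zero]; exact zero_mem _
      have hg : g ∈ {g | ℛ' g ≠ ⊥} := hT ▸ (ℛ g).ne_bot_iff.2 ⟨x, hx, hx0⟩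
      obtain ⟨y, hy, hy0⟩ := (ℛ' g).ne_bot_iff.1 hg
      obtain ⟨c, hc⟩ := hconj g x hx hx0 y hy hy0
      rw [AlgEquiv.toLinearMap_apply, hc]
      exact (ℛ' g).smul_mem _ hy
    · intro y hy
      by_cases hy0 : y = 0
      · rw [hy0]; exact zero_mem _
      have hg : g ∈ {g | ℛ g ≠ ⊥} := hT ▸ (ℛ' g).ne_bot_iff.2 ⟨y, hy, hy0⟩
      obtain ⟨x, hx, hx0⟩ := (ℛ g).ne_bot_iff.1 hg
      obtain ⟨c, hc⟩ := hconj g x hx hx0 y hy hy0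
      refine ⟨(↑c⁻¹ : F) • x, (ℛ g).smul_mem _ hx, ?_⟩
      rw [map_smul, AlgEquiv.toLinearMap_apply, hc, smul_smul, Units.inv_mul, one_smul]
end

section
/- Let R = M_n(F) be endowed with a division G-grading with support T, and assume that every element of T satisfies t² = e and that char F ≠ 2. Then every F-linear anti-automorphism φ of R satisfying φ(R_g) = R_g for all g ∈ G is an involution, i.e., φ ∘ φ = id. -/
open DirectSum in
/-- In an algebra graded by a group, the unit is homogeneous of trivial degree. -/
theorem one_mem_of_mul_mem {F R G : Type*} [CommSemiring F] [Semiring R] [Algebra F R]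
    [Group G] [DecidableEq G] (ℛ : G → Submodule F R) [Decomposition ℛ]
    (hmul : ∀ g h : G, ∀ x ∈ ℛ g, ∀ y ∈ ℛ h, x * y ∈ ℛ (g * h)) :
    (1 : R) ∈ ℛ 1 := by
  have key (h : G) (y : R) (hy : y ∈ ℛ h) (z : R) :
      (decompose ℛ (z * y) h : R) = decompose ℛ z 1 * y := by
    induction z using Decomposition.inductionOn ℛ with
    | zero => simp
    | @homogeneous g z =>
      by_cases hg : g = 1
      · subst hg
        have hzy := hmul 1 h z z.2 y hy
        rw [one_mul] at hzy
        rw [decompose_of_mem_same ℛ hzy, decompose_of_mem_same ℛ z.2]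
      · rw [decompose_of_mem_ne ℛ (hmul g h z z.2 y hy) (by simpa using hg),
          decompose_of_mem_ne ℛ z.2 hg, zero_mul]
    | add z w hz hw => simp [add_mul, hz, hw]
  have left_one (y : R) : (decompose ℛ (1 : R) 1 : R) * y = y := by
    induction y using Decomposition.inductionOn ℛ with
    | zero => simp
    | @homogeneous h y =>
      rw [← key h y y.2 1, one_mul, decompose_of_mem_same ℛ y.2]
    | add y w hy hw => rw [mul_add, hy, hw]
  have h := left_one 1
  rw [mul_one] at h
  exact h ▸ (decompose ℛ (1 : R) 1).2

/-- If `p` is a linear map with `p 1 ≠ 0`, then a matrix `x` with `p (a * x * b) = 0` for all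
matrices `a` and `b` is zero. -/
theorem Matrix.eq_zero_of_forall_map_mul_mul_eq_zero {F M ι : Type*} [Field F] [AddCommGroup M]
    [Module F M] [Fintype ι] [DecidableEq ι] (p : Matrix ι ι F →ₗ[F] M) (hp : p 1 ≠ 0)
    {x : Matrix ι ι F} (hx : ∀ a b : Matrix ι ι F, p (a * x * b) = 0) : x = 0 := by
  ext i j
  by_contra hij
  rw [Matrix.zero_apply] at hij
  have h1 : x i j • (1 : Matrix ι ι F) =
      ∑ k, Matrix.single k i (1 : F) * x * Matrix.single j k (1 : F) := by
    simp_rw [Matrix.single_mul_mul_single, one_mul, mul_one]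
    rw [← Matrix.diagonal_one, ← Matrix.diagonal_smul, ← Matrix.sum_single_eq_diagonal]
    simp
  have h2 := congrArg p h1
  rw [map_smul, map_sum, Finset.sum_eq_zero fun k _ => hx _ _] at h2
  exact (smul_eq_zero.mp h2).elim hij hp

open DirectSum in
/-- Nonzero homogeneous elements of a matrix algebra graded by a group, with one-dimensional
identity component, are invertible. -/
theorem Matrix.isUnit_of_mem_of_ne_zero {F G ι : Type*} [Field F] [Group G] [DecidableEq G]
    [Fintype ι] [DecidableEq ι] (ℛ : G → Submodule F (Matrix ι ι F)) [Decomposition ℛ]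
    (hmul : ∀ g h : G, ∀ x ∈ ℛ g, ∀ y ∈ ℛ h, x * y ∈ ℛ (g * h))
    (hone : ∀ y ∈ ℛ 1, ∃ c : F, c • (1 : Matrix ι ι F) = y)
    {t : G} {x : Matrix ι ι F} (hxt : x ∈ ℛ t) (hx : x ≠ 0) : IsUnit x := by
  have h1 := one_mem_of_mul_mem ℛ hmul
  have h10 : (1 : Matrix ι ι F) ≠ 0 := fun h => hx (by rw [← one_mul x, h, zero_mul])
  let p : Matrix ι ι F →ₗ[F] ℛ 1 :=
    (DirectSum.component F G (fun g => ℛ g) 1) ∘ₗ (decomposeLinearEquiv ℛ).toLinearMap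
  have hp (y) : p y = decompose ℛ y 1 := rfl
  by_contra hunit
  have homog (g h : G) (a b : Matrix ι ι F) (ha : a ∈ ℛ g) (hb : b ∈ ℛ h) :
      p (a * x * b) = 0 := by
    have hm := hmul _ _ _ (hmul g t a ha x hxt) b hb
    by_contra hne
    by_cases hg : g * t * h = 1
    · rw [hg] at hm
      obtain ⟨c, hc⟩ := hone _ hm
      have hc0 : c ≠ 0 := by
        rintro rfl
        rw [← hc, zero_smul, map_zero] at hne
        exact hne rfl
      have hu : IsUnit (a * x * b) := by
        rw [← hc, ← Algebra.algebraMap_eq_smul_one]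
        exact (isUnit_iff_ne_zero.mpr hc0).map _
      rw [Matrix.isUnit_iff_isUnit_det, Matrix.det_mul, Matrix.det_mul] at hu
      exact hunit ((Matrix.isUnit_iff_isUnit_det x).mpr
        (isUnit_of_mul_isUnit_right (isUnit_of_mul_isUnit_left hu)))
    · exact hne (Subtype.ext (by rw [hp, decompose_of_mem_ne ℛ hm hg]; rfl))
  refine hx (Matrix.eq_zero_of_forall_map_mul_mul_eq_zero p ?_ fun a b => ?_)
  · intro h
    have h' := congrArg Subtype.val h
    rw [hp, decompose_of_mem_same ℛ h1] at h'
    exact h10 h'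
  · induction a using Decomposition.inductionOn ℛ with
    | zero => simp
    | @homogeneous g a =>
      induction b using Decomposition.inductionOn ℛ with
      | zero => simp
      | @homogeneous h b => exact homog g h a b a.2 b.2
      | add b b' hb hb' => rw [mul_add, map_add, hb, hb', add_zero]
    | add a a' ha ha' => rw [add_mul, add_mul, map_add, ha, ha', add_zero]

/-- If a division `G`-grading on `Mₙ(F)` has elementary 2-group support
and `char F ≠ 2`, then every grading-preserving `F`-linear anti-automorphism of
`Mₙ(F)` is an involution. -/
theorem division_grading_antiautomorphism_is_involution
    {F : Type*} [Field F] [IsAlgClosed F] (hchar : ringChar F ≠ 2)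
    {G : Type*} [CommGroup G] [DecidableEq G] {n : ℕ}
    (ℛ : G → Submodule F (Matrix (Fin n) (Fin n) F))
    (hinternal : DirectSum.IsInternal ℛ)
    (hmul : ∀ g h : G, ∀ x ∈ ℛ g, ∀ y ∈ ℛ h, x * y ∈ ℛ (g * h))
    (hdim : ∀ g : G, Module.finrank F (ℛ g) ≤ 1)
    (hT : ∀ t : G, ℛ t ≠ ⊥ → t ^ 2 = 1)
    (φ : Matrix (Fin n) (Fin n) F ≃ₗ[F] Matrix (Fin n) (Fin n) F)
    (hanti : ∀ x y : Matrix (Fin n) (Fin n) F, φ (x * y) = φ y * φ x)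
    (hpres : ∀ g : G, (ℛ g).map
      (φ : Matrix (Fin n) (Fin n) F →ₗ[F] Matrix (Fin n) (Fin n) F) = ℛ g) :
    ∀ x : Matrix (Fin n) (Fin n) F, φ (φ x) = x := by
  let := hinternal.chooseDecomposition
  have h1 := one_mem_of_mul_mem ℛ hmul
  intro x
  induction x using DirectSum.Decomposition.inductionOn ℛ with
  | zero => simp
  | add x y hx hy => rw [map_add, map_add, hx, hy]
  | @homogeneous t x =>
    obtain ⟨x, hxt⟩ := x
    change φ (φ x) = x
    by_cases hx : x = 0
    · simp [hx]
    have span (g : G) (y z : Matrix (Fin n) (Fin n) F) (hy : y ∈ ℛ g) (hy0 : y ≠ 0)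
        (hz : z ∈ ℛ g) : ∃ c : F, c • y = z := by
      obtain ⟨v, hv⟩ := finrank_le_one_iff.mp (hdim g)
      obtain ⟨a, ha⟩ := hv ⟨y, hy⟩
      obtain ⟨b, hb⟩ := hv ⟨z, hz⟩
      have ha' : a • (v : Matrix (Fin n) (Fin n) F) = y := congrArg Subtype.val ha
      have hb' : b • (v : Matrix (Fin n) (Fin n) F) = z := congrArg Subtype.val hb
      have ha0 : a ≠ 0 := by
        rintro rfl
        exact hy0 (by rw [← ha', zero_smul])
      exact ⟨b / a, by rw [← ha', ← hb', smul_smul, div_mul_cancel₀ _ ha0]⟩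
    have h10 : (1 : Matrix (Fin n) (Fin n) F) ≠ 0 :=
      fun h => hx (by rw [← one_mul x, h, zero_mul])
    have hone (y) (hy : y ∈ ℛ 1) := span 1 1 y h1 h10 hy
    have hunit := Matrix.isUnit_of_mem_of_ne_zero ℛ hmul hone hxt hx
    have ht : t * t = 1 := by
      rw [← pow_two]
      exact hT t fun h => hx (by simpa [h] using hxt)
    have hφ1 : φ 1 = 1 := by
      have h := hanti (φ.symm 1) 1
      simpa using h.symm
    obtain ⟨l, hl⟩ := span t x (φ x) hxt hx (hpres t ▸ Submodule.mem_map_of_mem hxt)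
    obtain ⟨c, hc⟩ := hone (x * x) (ht ▸ hmul t t x hxt x hxt)
    have hsq : (l * l) • (x * x) = x * x := by
      have h := hanti x x
      rw [← hc, map_smul, hφ1, hc, ← hl, smul_mul_smul_comm] at h
      exact h.symm
    rw [← hl, map_smul, ← hl, smul_smul]
    rw [← smul_mul_assoc] at hsq
    exact hunit.mul_right_cancel hsq
end

section
/- Let n ≥ 2, char F ≠ 2, and let R = M_n(F) be endowed with a division G-grading with support T such that every element of T satisfies t² = e. Then the set of all F-linear bijections of R that preserve every homogeneous component (ψ(R_g) = R_g for all g) and are either algebra automorphisms or anti-automorphisms forms, under composition, an abelian group isomorphic to T × Z/2Z; in particular it has order 2n². -/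
theorem exists_quadratic_of_isAlt {V W : Type*} [AddCommGroup V] [Module (ZMod 2) V]
    [AddCommGroup W] [Module (ZMod 2) W] (B : V →ₗ[ZMod 2] V →ₗ[ZMod 2] W) (hB : ∀ x, B x x = 0) :
    ∃ Q : V → W, ∀ x y, Q (x + y) = Q x + Q y + B x y := by
  classical
  let b := Module.Basis.ofVectorSpace (ZMod 2) V
  let := linearOrderOfSTO (WellOrderingRel (α := Module.Basis.ofVectorSpaceIndex (ZMod 2) V))
  let C : V →ₗ[ZMod 2] V →ₗ[ZMod 2] W :=
    b.constr ℕ fun i => b.constr ℕ fun j => if i < j then B (b i) (b j) else 0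
  have hneg : ∀ x y, B x y = B y x := by
    intro x y
    have h := hB (x + y)
    simp only [map_add, LinearMap.add_apply, hB, zero_add, add_zero] at h
    rw [add_eq_zero_iff_eq_neg, ZModModule.neg_eq_self] at h
    exact h.symm
  have hC : C + C.flip = B := by
    refine b.ext fun i => b.ext fun j => ?_
    simp only [C, LinearMap.add_apply, LinearMap.flip_apply, Module.Basis.constr_basis]
    rcases lt_trichotomy i j with h | h | h
    · simp [h, h.asymm]
    · simp [h, hB]
    · simp [h, h.asymm, hneg (b i)]
  refine ⟨fun x => C x x, fun x y => ?_⟩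
  rw [← hC]
  simp only [map_add, LinearMap.add_apply, LinearMap.flip_apply]
  abel

theorem exists_quadratic_of_alternating {T K : Type*} [CommGroup T] [CommGroup K]
    (hT : ∀ t : T, t ^ 2 = 1) (hK : ∀ k : K, k ^ 2 = 1) (β : T →* T →* K) (hβ : ∀ t, β t t = 1) :
    ∃ η : T → K, ∀ s t, η (s * t) = η s * η t * β s t := by
  let : Module (ZMod 2) (Additive T) := AddCommGroup.zmodModule hT
  let : Module (ZMod 2) (Additive K) := AddCommGroup.zmodModule hK
  let B : Additive T →+ Additive T →+ Additive K :=
    AddMonoidHom.mk' (fun s => MonoidHom.toAdditive (β s.toMul)) fun s t => by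
      ext u; simp
  let B' : Additive T →ₗ[ZMod 2] Additive T →ₗ[ZMod 2] Additive K :=
    AddMonoidHom.toZModLinearMap 2 (AddMonoidHom.mk' (fun s => (B s).toZModLinearMap 2) fun s t => by
      ext u; simp)
  obtain ⟨Q, hQ⟩ := exists_quadratic_of_isAlt B' hβ
  exact ⟨fun t => (Q (.ofMul t)).toMul, hQ⟩

open Module in
/-- The linear automorphism scaling each vector of a basis by a unit. -/
noncomputable def basisScaling {F A T : Type*} [Field F] [AddCommGroup A] [Module F A]
    (b : Basis T F A) : (T → Fˣ) →* (A ≃ₗ[F] A) where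
  toFun χ := b.equiv (b.unitsSMul χ) (Equiv.refl T)
  map_one' := LinearEquiv.toLinearMap_injective <| b.ext fun t => by
    simp [Basis.equiv_apply, Basis.unitsSMul_apply]
  map_mul' χ ψ := LinearEquiv.toLinearMap_injective <| b.ext fun t => by
    simp [Basis.equiv_apply, Basis.unitsSMul_apply, Units.smul_def, smul_smul, mul_comm]

open Module in
@[simp]
theorem basisScaling_apply_basis {F A T : Type*} [Field F] [AddCommGroup A] [Module F A]
    (b : Basis T F A) (χ : T → Fˣ) (t : T) : basisScaling b χ (b t) = (χ t : F) • b t := by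
  simp [basisScaling, Basis.equiv_apply, Basis.unitsSMul_apply, Units.smul_def]

open Module in
theorem basisScaling_injective {F A T : Type*} [Field F] [AddCommGroup A] [Module F A]
    (b : Basis T F A) : Function.Injective (basisScaling b) := by
  intro χ ψ h
  ext t
  have := congr($h (b t))
  simpa [b.ne_zero t] using this

section TwistedGroupAlgebra

open Module

variable {F A T : Type*} [Field F] [Ring A] [Algebra F A] [CommGroup T]
  {b : Basis T F A} {σ : T → T → Fˣ}

theorem twisted_cocycle (hσ : ∀ s t, b s * b t = (σ s t : F) • b (s * t)) (r s t : T) :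
    σ r s * σ (r * s) t = σ s t * σ r (s * t) := by
  have h := mul_assoc (b r) (b s) (b t)
  simp only [hσ, smul_mul_assoc, mul_smul_comm, smul_smul, mul_assoc] at h
  exact Units.ext (smul_left_injective F (b.ne_zero _) h)

theorem twisted_mul_basis (hσ : ∀ s t, b s * b t = (σ s t : F) • b (s * t)) (s t : T) :
    b s * b t = ((σ s t / σ t s : Fˣ) : F) • (b t * b s) := by
  rw [hσ, hσ t s, smul_smul, mul_comm t s, ← Units.val_mul, div_mul_cancel]

theorem twisted_commutator_mul_left (hσ : ∀ s t, b s * b t = (σ s t : F) • b (s * t))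
    (r s t : T) :
    σ (r * s) t / σ t (r * s) = (σ r t / σ t r) * (σ s t / σ t s) := by
  have h₁ := congrArg Units.val (twisted_cocycle hσ r s t)
  have h₂ := congrArg Units.val (twisted_cocycle hσ t r s)
  have h₃ := congrArg Units.val (twisted_cocycle hσ r t s)
  rw [mul_comm t s] at h₃
  rw [mul_comm t r] at h₂
  ext
  push_cast at *
  rw [div_mul_div_comm, div_eq_div_iff (by simp) (by simp)]
  apply mul_left_cancel₀ (Units.ne_zero (σ r s))
  apply mul_left_cancel₀ (Units.ne_zero (σ (r * t) s))
  linear_combination (↑(σ t r) * ↑(σ t s) * ↑(σ (r * t) s) : F) * h₁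
    - (↑(σ s t) * ↑(σ r t) * ↑(σ (r * t) s) : F) * h₂.symm
    - (↑(σ s t) * ↑(σ t r) * ↑(σ (r * t) s) : F) * h₃

theorem twisted_exists_quadratic (hσ : ∀ s t, b s * b t = (σ s t : F) • b (s * t))
    (hT : ∀ t : T, t ^ 2 = 1) :
    ∃ η : T → Fˣ, (∀ t, η t ^ 2 = 1) ∧
      ∀ s t, η (s * t) = η s * η t * (σ s t / σ t s) := by
  let β : T → T → Fˣ := fun s t => σ s t / σ t s
  have hl : ∀ r s t, β (r * s) t = β r t * β s t := twisted_commutator_mul_left hσ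
  have hinv : ∀ s t, β s t = (β t s)⁻¹ := fun s t => (inv_div _ _).symm
  have hr : ∀ r s t, β r (s * t) = β r s * β r t := fun r s t => by
    rw [hinv, hl, mul_inv, ← hinv, ← hinv]
  have hone : ∀ t, β 1 t = 1 := fun t => by simpa using hl 1 1 t
  have hsq : ∀ s t, β s t ^ 2 = 1 := fun s t => by rw [sq, ← hl, ← sq, hT, hone]
  let β' : T →* T →* rootsOfUnity 2 F :=
    MonoidHom.mk' (fun s => MonoidHom.mk' (fun t => ⟨β s t, hsq s t⟩)
      fun t u => Subtype.ext (hr s t u)) fun r s => MonoidHom.ext fun t => Subtype.ext (hl r s t)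
  obtain ⟨η, hη⟩ := exists_quadratic_of_alternating hT (fun k => Subtype.ext k.2) β'
    fun t => Subtype.ext (div_self' _)
  exact ⟨fun t => η t, fun t => (η t).2, fun s t => congrArg Subtype.val (hη s t)⟩

theorem twisted_map_mul_iff (hσ : ∀ s t, b s * b t = (σ s t : F) • b (s * t)) (χ : T → Fˣ) :
    (∀ x y, basisScaling b χ (x * y) = basisScaling b χ x * basisScaling b χ y) ↔
      ∀ s t, χ (s * t) = χ s * χ t := by
  constructor
  · intro h s t
    have := h (b s) (b t)
    simp only [hσ, map_smul, basisScaling_apply_basis, smul_mul_assoc, mul_smul_comm,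
      smul_smul] at this
    have := smul_left_injective F (b.ne_zero _) this
    ext
    apply mul_left_cancel₀ (Units.ne_zero (σ s t))
    push_cast
    linear_combination this
  · intro h
    refine (LinearMap.ext_iff₂ (f := (LinearMap.mul F A).compr₂ (basisScaling b χ).toLinearMap)
      (g := (LinearMap.mul F A).compl₁₂ (basisScaling b χ).toLinearMap
        (basisScaling b χ).toLinearMap)).mp (b.ext fun s => b.ext fun t => ?_)
    simp [hσ, h, smul_smul, mul_comm, mul_left_comm]

theorem twisted_map_mul_rev_iff (hσ : ∀ s t, b s * b t = (σ s t : F) • b (s * t))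
    (χ : T → Fˣ) :
    (∀ x y, basisScaling b χ (x * y) = basisScaling b χ y * basisScaling b χ x) ↔
      ∀ s t, χ (s * t) = χ s * χ t * (σ t s / σ s t) := by
  constructor
  · intro h s t
    have := h (b s) (b t)
    simp only [hσ, map_smul, basisScaling_apply_basis, smul_mul_assoc, mul_smul_comm,
      smul_smul, mul_comm t s] at this
    have := smul_left_injective F (b.ne_zero _) this
    ext
    apply mul_left_cancel₀ (Units.ne_zero (σ s t))
    push_cast
    field_simp
    linear_combination this
  · intro h
    refine (LinearMap.ext_iff₂ (f := (LinearMap.mul F A).compr₂ (basisScaling b χ).toLinearMap)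
      (g := (LinearMap.mul F A).flip.compl₁₂ (basisScaling b χ).toLinearMap
        (basisScaling b χ).toLinearMap)).mp (b.ext fun s => b.ext fun t => ?_)
    simp only [LinearMap.compr₂_apply, LinearMap.compl₁₂_apply, LinearMap.smul_apply,
      LinearMap.flip_apply, LinearMap.mul_apply', LinearEquiv.coe_coe, hσ, map_smul,
      basisScaling_apply_basis, smul_smul, mul_comm t s, h]
    congr 1
    push_cast
    field_simp

/-- Scalings of a twisted group algebra of an elementary abelian 2-group that are automorphisms or
anti-automorphisms, parametrized by a character and a sign. -/
theorem exists_twisted_scaling_hom (hσ : ∀ s t, b s * b t = (σ s t : F) • b (s * t))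
    (hT : ∀ t : T, t ^ 2 = 1) (hA : ∃ x y : A, x * y ≠ y * x) :
    ∃ Φ : (T →* Fˣ) × Multiplicative (ZMod 2) →* (T → Fˣ), Function.Injective Φ ∧
      ∀ χ, (∃ p, Φ p = χ) ↔
        (∀ x y, basisScaling b χ (x * y) = basisScaling b χ x * basisScaling b χ y) ∨
        (∀ x y, basisScaling b χ (x * y) = basisScaling b χ y * basisScaling b χ x) := by
  obtain ⟨η, hη, hq⟩ := twisted_exists_quadratic hσ hT
  have hsym : ∀ s t, σ t s / σ s t = σ s t / σ t s := fun s t => by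
    have h₁ := hq s t
    rw [mul_comm s t, hq t s, mul_comm (η t)] at h₁
    exact mul_left_cancel h₁
  have hη2 : η * η = 1 := funext fun t => by simpa [sq] using hη t
  let e : Multiplicative (ZMod 2) →* (T → Fˣ) :=
    AddMonoidHom.toMultiplicativeLeft (ZMod.lift 2 ⟨zmultiplesHom _ (Additive.ofMul η), by
      simpa [two_zsmul] using congrArg Additive.ofMul hη2⟩)
  have he : e (Multiplicative.ofAdd 1) = η := by
    simp only [e, AddMonoidHom.toMultiplicativeLeft_apply_apply, toAdd_ofAdd]
    rw [← Int.cast_one, ZMod.lift_coe]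
    simp
  let c : (T →* Fˣ) →* (T → Fˣ) := MonoidHom.mk' (fun φ => φ) fun _ _ => rfl
  have hcases : ∀ k : Multiplicative (ZMod 2), k = 1 ∨ k = Multiplicative.ofAdd 1 := by decide
  have hnot : ¬ ∀ s t, η (s * t) = η s * η t := by
    intro h
    obtain ⟨x, y, hxy⟩ := hA
    refine hxy ((LinearMap.ext_iff₂ (f := LinearMap.mul F A) (g := (LinearMap.mul F A).flip)).mp
      (b.ext fun s => b.ext fun t => ?_) x y)
    have := hq s t
    rw [h, left_eq_mul] at this
    simp [twisted_mul_basis hσ s t, this]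
  refine ⟨c.coprod e, ?_, fun χ => ?_⟩
  · rw [injective_iff_map_eq_one]
    rintro ⟨φ, k⟩ h
    rcases hcases k with rfl | rfl
    · simp only [MonoidHom.coprod_apply, map_one, mul_one] at h
      have : φ = 1 := DFunLike.coe_injective h
      rw [this]
      rfl
    · refine (hnot fun s t => ?_).elim
      simp only [MonoidHom.coprod_apply, he] at h
      have h' : η = ⇑φ⁻¹ := eq_inv_of_mul_eq_one_right h
      rw [h', map_mul]
  · rw [twisted_map_mul_iff hσ, twisted_map_mul_rev_iff hσ]
    constructor
    · rintro ⟨⟨φ, k⟩, rfl⟩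
      rcases hcases k with rfl | rfl
      · left
        simp [c]
      · right
        intro s t
        simp only [MonoidHom.coprod_apply, he, Pi.mul_apply, hq, hsym]
        simp only [c, MonoidHom.mk'_apply, map_mul]
        rw [mul_assoc, mul_assoc, mul_mul_mul_comm]
        simp only [mul_assoc]
    · rintro (h | h)
      · exact ⟨(MonoidHom.mk' χ h, 1), by simp [c]⟩
      · refine ⟨(MonoidHom.mk' (χ * η) fun s t => ?_, Multiplicative.ofAdd 1), ?_⟩
        · have h2 : (σ s t / σ t s) * (σ s t / σ t s) = 1 := by
            nth_rw 1 [← hsym]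
            simp
          simp only [Pi.mul_apply, h, hq, hsym]
          calc _ = (χ s * η s * (χ t * η t)) * ((σ s t / σ t s) * (σ s t / σ t s)) := by
                simp only [mul_left_comm, mul_comm]
            _ = _ := by rw [h2, mul_one]
        · simp only [MonoidHom.coprod_apply, he, c]
          exact (mul_assoc χ η η).trans (by rw [hη2, mul_one])

end TwistedGroupAlgebra

section Grading

theorem graded_mul_mem_iSup_ne {F A G : Type*} [CommSemiring F] [Semiring A] [Algebra F A]
    [Group G] {ℛ : G → Submodule F A}
    (hmul : ∀ g h : G, ∀ x ∈ ℛ g, ∀ y ∈ ℛ h, x * y ∈ ℛ (g * h))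
    {g k : G} {x y : A} (hx : x ∈ ℛ g) (hy : y ∈ ⨆ (i) (_ : i ≠ k), ℛ i) :
    x * y ∈ ⨆ (i) (_ : i ≠ g * k), ℛ i := by
  have : (⨆ (i) (_ : i ≠ k), ℛ i) ≤
      (⨆ (i) (_ : i ≠ g * k), ℛ i).comap (LinearMap.mulLeft F x) :=
    iSup₂_le fun i hi z hz => Submodule.mem_iSup_of_mem (g * i) <|
      Submodule.mem_iSup_of_mem (fun h => hi (mul_left_cancel h)) (hmul g i x hx z hz)
  exact this hy

theorem graded_one_mem {F A G : Type*} [CommRing F] [Ring A] [Algebra F A]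
    [Group G] {ℛ : G → Submodule F A} (hind : iSupIndep ℛ) (htop : iSup ℛ = ⊤)
    (hmul : ∀ g h : G, ∀ x ∈ ℛ g, ∀ y ∈ ℛ h, x * y ∈ ℛ (g * h)) : (1 : A) ∈ ℛ 1 := by
  have h1 : (1 : A) ∈ ℛ 1 ⊔ ⨆ (i) (_ : i ≠ 1), ℛ i := by
    rw [← iSup_split_single, htop]
    trivial
  obtain ⟨e, he, f, hf, hef⟩ := Submodule.mem_sup.mp h1
  have hxf : iSup ℛ ≤ LinearMap.ker (LinearMap.mulRight F f) := iSup_le fun g x hx => by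
    have h₁ := graded_mul_mem_iSup_ne hmul hx hf
    have h₂ : x * f ∈ ℛ g := by
      have h₃ := hmul g 1 x hx e he
      have : x * f = x - x * e := by rw [eq_sub_iff_add_eq', ← mul_add, hef, mul_one]
      rw [mul_one] at h₃
      exact this ▸ (ℛ g).sub_mem hx h₃
    rw [mul_one] at h₁
    exact (Submodule.disjoint_def.mp (hind g)) _ h₂ h₁
  have hf0 : 1 * f = 0 := hxf (htop ▸ Submodule.mem_top)
  rw [one_mul] at hf0
  rwa [← hef, hf0, add_zero]

theorem exists_smul_of_finrank_le_one {F V : Type*} [Field F] [AddCommGroup V] [Module F V]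
    [FiniteDimensional F V] {W : Submodule F V} (hW : Module.finrank F W ≤ 1) {x y : V}
    (hx : x ∈ W) (hx0 : x ≠ 0) (hy : y ∈ W) : ∃ c : F, y = c • x := by
  have h1 : Module.finrank F W = 1 := by
    refine le_antisymm hW (Module.finrank_pos_iff_exists_ne_zero.mpr ⟨⟨x, hx⟩, ?_⟩)
    simpa using hx0
  obtain ⟨c, hc⟩ := exists_smul_eq_of_finrank_eq_one h1 (x := ⟨x, hx⟩) (by simpa using hx0)
    (⟨y, hy⟩ : W)
  exact ⟨c, (congrArg Subtype.val hc).symm⟩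

theorem graded_matrix_isUnit {F G ι : Type*} [Field F] [Group G] [Fintype ι] [DecidableEq ι]
    {ℛ : G → Submodule F (Matrix ι ι F)} (hind : iSupIndep ℛ) (htop : iSup ℛ = ⊤)
    (hmul : ∀ g h : G, ∀ x ∈ ℛ g, ∀ y ∈ ℛ h, x * y ∈ ℛ (g * h))
    (hdim : ∀ g : G, Module.finrank F (ℛ g) ≤ 1) {g : G} {x : Matrix ι ι F}
    (hx : x ∈ ℛ g) (hx0 : x ≠ 0) : IsUnit x := by
  obtain ⟨i, j, hij⟩ : ∃ i j, x i j ≠ 0 := by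
    contrapose! hx0
    exact Matrix.ext hx0
  have : Nonempty ι := ⟨i⟩
  have hone := graded_one_mem hind htop hmul
  by_cases hunit : ∃ s t, ∃ a ∈ ℛ s, ∃ b ∈ ℛ t, s * g * t = 1 ∧ a * x * b ≠ 0
  · obtain ⟨s, t, a, ha, b, hb, hst, hne⟩ := hunit
    have hmem := hmul _ _ _ (hmul _ _ _ ha _ hx) _ hb
    rw [hst] at hmem
    obtain ⟨c, hc⟩ := exists_smul_of_finrank_le_one (hdim 1) hone one_ne_zero hmem
    have hc0 : c ≠ 0 := by
      rintro rfl
      exact hne (by simpa using hc)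
    have hdet := congrArg Matrix.det hc
    simp only [Matrix.det_mul, Matrix.det_smul, Matrix.det_one, mul_one] at hdet
    rw [Matrix.isUnit_iff_isUnit_det, isUnit_iff_ne_zero]
    intro h0
    rw [h0] at hdet
    exact pow_ne_zero (Fintype.card ι) hc0 (by simpa using hdet.symm)
  · push Not at hunit
    set W := ⨆ (k) (_ : k ≠ 1), ℛ k
    have hW : ∀ a b, a * x * b ∈ W := by
      intro a b
      have ha : a ∈ iSup ℛ := htop ▸ Submodule.mem_top
      have hb : b ∈ iSup ℛ := htop ▸ Submodule.mem_top
      refine Submodule.iSup_induction ℛ (motive := fun a => a * x * b ∈ W) ha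
        (fun s a ha => ?_) (by simp) fun _ _ h₁ h₂ => by simpa [add_mul] using W.add_mem h₁ h₂
      refine Submodule.iSup_induction ℛ (motive := fun b => a * x * b ∈ W) hb
        (fun t b hb => ?_) (by simp) fun _ _ h₁ h₂ => by simpa [mul_add] using W.add_mem h₁ h₂
      by_cases hst : s * g * t = 1
      · simp [hunit s t a ha b hb hst]
      · exact Submodule.mem_iSup_of_mem _ <| Submodule.mem_iSup_of_mem hst
          (hmul _ _ _ (hmul _ _ _ ha _ hx) _ hb)
    have hsum : ∑ k, Matrix.single k i (1 : F) * x * Matrix.single j k 1 = x i j • 1 := by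
      rw [← Matrix.sum_single_one, Finset.smul_sum]
      refine Finset.sum_congr rfl fun k _ => ?_
      rw [Matrix.single_mul_mul_single]
      simp
    have h1W : (1 : Matrix ι ι F) ∈ W := by
      rw [← W.smul_mem_iff hij, ← hsum]
      exact W.sum_mem fun k _ => hW _ _
    exact absurd ((Submodule.disjoint_def.mp (hind 1)) _ hone h1W) one_ne_zero

theorem exists_homogeneous_basis {F G : Type*} [Field F] [CommGroup G] {n : ℕ} [NeZero n]
    {ℛ : G → Submodule F (Matrix (Fin n) (Fin n) F)} (hind : iSupIndep ℛ) (htop : iSup ℛ = ⊤)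
    (hmul : ∀ g h : G, ∀ x ∈ ℛ g, ∀ y ∈ ℛ h, x * y ∈ ℛ (g * h))
    (hdim : ∀ g : G, Module.finrank F (ℛ g) ≤ 1)
    (hT2 : ∀ t : G, ℛ t ≠ ⊥ → t ^ 2 = 1) :
    ∃ (T : Subgroup G) (b : Module.Basis T F (Matrix (Fin n) (Fin n) F)) (σ : T → T → Fˣ),
      (T : Set G) = {g : G | ℛ g ≠ ⊥} ∧ (∀ t : T, b t ∈ ℛ t) ∧
      ∀ s t, b s * b t = (σ s t : F) • b (s * t) := by
  have hone := graded_one_mem hind htop hmul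
  have hunit : ∀ {g x}, x ∈ ℛ g → x ≠ 0 → IsUnit x :=
    fun hx hx0 => graded_matrix_isUnit hind htop hmul hdim hx hx0
  have hprod : ∀ {g h x y}, x ∈ ℛ g → x ≠ 0 → y ∈ ℛ h → y ≠ 0 → x * y ≠ 0 :=
    fun hx hx0 hy hy0 => ((hunit hx hx0).mul (hunit hy hy0)).ne_zero
  let T : Subgroup G :=
    { carrier := {g | ℛ g ≠ ⊥}
      one_mem' := (Submodule.ne_bot_iff _).mpr ⟨1, hone, one_ne_zero⟩
      mul_mem' := by
        intro g h hg hh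
        obtain ⟨x, hx, hx0⟩ := (Submodule.ne_bot_iff _).mp hg
        obtain ⟨y, hy, hy0⟩ := (Submodule.ne_bot_iff _).mp hh
        exact (Submodule.ne_bot_iff _).mpr ⟨x * y, hmul _ _ _ hx _ hy, hprod hx hx0 hy hy0⟩
      inv_mem' := by
        intro g hg
        have : g⁻¹ = g := inv_eq_of_mul_eq_one_left (by rw [← sq, hT2 g hg])
        rwa [this] }
  choose X hX hX0 using fun t : T => (Submodule.ne_bot_iff _).mp t.2
  have hspan : ∀ (t : T) y, y ∈ ℛ t → ∃ c : F, y = c • X t := fun t y hy =>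
    exists_smul_of_finrank_le_one (hdim t) (hX t) (hX0 t) hy
  have hbot : ∀ g, g ∉ T → ℛ g = ⊥ := fun g hg => not_not.mp hg
  have hli : LinearIndependent F X :=
    (hind.comp Subtype.val_injective).linearIndependent (fun t : T => ℛ t) hX hX0
  have hsp : ⊤ ≤ Submodule.span F (Set.range X) := by
    rw [← htop]
    refine iSup_le fun g => ?_
    by_cases hg : g ∈ T
    · intro y hy
      obtain ⟨c, rfl⟩ := hspan ⟨g, hg⟩ y hy
      exact Submodule.smul_mem _ _ (Submodule.subset_span ⟨_, rfl⟩)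
    · rw [hbot g hg]
      exact bot_le
  let b := Module.Basis.mk hli hsp
  have hb : ∀ t, b t = X t := fun t => Module.Basis.mk_apply hli hsp t
  have hσ : ∀ s t, ∃ c : Fˣ, b s * b t = (c : F) • b (s * t) := by
    intro s t
    obtain ⟨c, hc⟩ := hspan (s * t) _ (hmul _ _ _ (hX s) _ (hX t))
    have hc0 : c ≠ 0 := by
      rintro rfl
      exact hprod (hX s) (hX0 s) (hX t) (hX0 t) (by simpa using hc)
    exact ⟨Units.mk0 c hc0, by simpa [hb] using hc⟩
  choose σ hσ using hσ
  exact ⟨T, b, σ, rfl, fun t => hb t ▸ hX t, hσ⟩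

theorem map_homogeneous_eq_iff_exists_basisScaling {F A G : Type*} [Field F] [AddCommGroup A]
    [Module F A] [FiniteDimensional F A] {ℛ : G → Submodule F A}
    (hdim : ∀ g : G, Module.finrank F (ℛ g) ≤ 1) {T : Set G} (hT : T = {g : G | ℛ g ≠ ⊥})
    (b : Module.Basis T F A) (hb : ∀ t : T, b t ∈ ℛ t) (ψ : A ≃ₗ[F] A) :
    (∀ g : G, (ℛ g).map ψ.toLinearMap = ℛ g) ↔ ∃ χ, basisScaling b χ = ψ := by
  have hspan : ∀ (t : T) y, y ∈ ℛ t → ∃ c : F, y = c • b t := fun t y hy =>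
    exists_smul_of_finrank_le_one (hdim t) (hb t) (b.ne_zero t) hy
  constructor
  · intro hψ
    have hχ : ∀ t : T, ∃ c : Fˣ, ψ (b t) = (c : F) • b t := by
      intro t
      have hmem : ψ (b t) ∈ ℛ t := by
        rw [← hψ]
        exact ⟨b t, hb t, rfl⟩
      obtain ⟨c, hc⟩ := hspan t _ hmem
      have hc0 : c ≠ 0 := by
        rintro rfl
        exact b.ne_zero t (by simpa using hc)
      exact ⟨Units.mk0 c hc0, hc⟩
    choose χ hχ using hχ
    exact ⟨χ, LinearEquiv.toLinearMap_injective <| b.ext fun t => by simp [hχ]⟩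
  · rintro ⟨χ, rfl⟩ g
    have hle : ∀ χ, (ℛ g).map (basisScaling b χ).toLinearMap ≤ ℛ g := by
      rintro χ _ ⟨y, hy, rfl⟩
      by_cases hg : g ∈ T
      · obtain ⟨c, rfl⟩ := hspan ⟨g, hg⟩ y hy
        rw [map_smul, LinearEquiv.coe_coe, basisScaling_apply_basis]
        exact (ℛ g).smul_mem c ((ℛ g).smul_mem _ (hb ⟨g, hg⟩))
      · rw [hT, Set.mem_ofPred_eq, not_not] at hg
        rw [hg, SetLike.mem_coe, Submodule.mem_bot] at hy
        simp [hy]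
    refine le_antisymm (hle χ) fun y hy => ⟨basisScaling b χ⁻¹ y, hle χ⁻¹ ⟨y, hy, rfl⟩, ?_⟩
    change (basisScaling b χ * basisScaling b χ⁻¹) y = y
    rw [← map_mul, mul_inv_cancel, map_one]
    rfl

theorem exists_subgroup_mulEquiv_of_injective {X Y K : Type*} [Group X] [Group Y] [Group K]
    (f : X × Y →* K) (hf : Function.Injective f) :
    ∃ H : Subgroup K, (H : Set K) = Set.range f ∧ Nonempty (H ≃* X × Y) :=
  ⟨f.range, f.coe_range, ⟨(MonoidHom.ofInjective hf).symm⟩⟩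

theorem exists_matrix_mul_ne_mul (F : Type*) [Field F] {n : ℕ} (hn : 2 ≤ n) :
    ∃ x y : Matrix (Fin n) (Fin n) F, x * y ≠ y * x := by
  have : Nontrivial (Fin n) := Fin.nontrivial_iff_two_le.mpr hn
  obtain ⟨i, j, hij⟩ := exists_pair_ne (Fin n)
  refine ⟨Matrix.single i j 1, Matrix.single j i 1, fun h => ?_⟩
  simpa [hij] using congr($h i i)

theorem nonempty_monoidHom_units_mulEquiv {F T : Type*} [Field F] [IsAlgClosed F]
    (hchar : ringChar F ≠ 2) [CommGroup T] [Finite T] (hT : ∀ t : T, t ^ 2 = 1) :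
    Nonempty ((T →* Fˣ) ≃* T) := by
  have : NeZero (Monoid.exponent T : F) := by
    obtain ⟨m, hm⟩ := Monoid.exponent_dvd_of_forall_pow_eq_one hT
    refine ⟨fun h => Ring.two_ne_zero hchar ?_⟩
    have := congrArg (Nat.cast (R := F)) hm
    simpa [h] using this
  exact CommGroup.monoidHom_mulEquiv_of_hasEnoughRootsOfUnity T F

end Grading

/-- For a division `G`-grading on `Mₙ(F)` (`n ≥ 2`, `char F ≠ 2`) with
elementary 2-group support `T`, the grading-preserving linear bijections that are
automorphisms or anti-automorphisms form, under composition, an abelian group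
isomorphic to `T × ℤ/2ℤ`; in particular it has order `2n²`. -/
theorem division_grading_aut_antiaut_group
    {F : Type*} [Field F] [IsAlgClosed F] (hchar : ringChar F ≠ 2)
    {G : Type*} [CommGroup G] [DecidableEq G] {n : ℕ} (hn : 2 ≤ n)
    (ℛ : G → Submodule F (Matrix (Fin n) (Fin n) F))
    (hinternal : DirectSum.IsInternal ℛ)
    (hmul : ∀ g h : G, ∀ x ∈ ℛ g, ∀ y ∈ ℛ h, x * y ∈ ℛ (g * h))
    (hdim : ∀ g : G, Module.finrank F (ℛ g) ≤ 1)
    (hT2 : ∀ t : G, ℛ t ≠ ⊥ → t ^ 2 = 1) :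
    ∃ (T : Subgroup G)
      (H : Subgroup (Matrix (Fin n) (Fin n) F ≃ₗ[F] Matrix (Fin n) (Fin n) F)),
      (T : Set G) = {g : G | ℛ g ≠ ⊥} ∧
      (H : Set (Matrix (Fin n) (Fin n) F ≃ₗ[F] Matrix (Fin n) (Fin n) F)) =
        {ψ : Matrix (Fin n) (Fin n) F ≃ₗ[F] Matrix (Fin n) (Fin n) F |
          (∀ g : G, (ℛ g).map ψ.toLinearMap = ℛ g) ∧
          ((∀ x y : Matrix (Fin n) (Fin n) F, ψ (x * y) = ψ x * ψ y) ∨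
           (∀ x y : Matrix (Fin n) (Fin n) F, ψ (x * y) = ψ y * ψ x))} ∧
      (∀ a ∈ H, ∀ b ∈ H, a * b = b * a) ∧
      Nonempty (H ≃* T × Multiplicative (ZMod 2)) ∧
      Nat.card H = 2 * n ^ 2 := by
  have hind := hinternal.submodule_iSupIndep
  have htop := hinternal.submodule_iSup_eq_top
  have : NeZero n := ⟨by lia⟩
  obtain ⟨T, b, σ, hT, hb, hσ⟩ := exists_homogeneous_basis hind htop hmul hdim hT2
  have hTsq : ∀ t : T, t ^ 2 = 1 := fun t =>
    Subtype.ext (hT2 t (Set.ext_iff.mp hT t |>.mp t.2))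
  obtain ⟨Φ, hΦ, hrange⟩ := exists_twisted_scaling_hom hσ hTsq (exists_matrix_mul_ne_mul F hn)
  have : Finite T := Module.Finite.finite_basis b
  obtain ⟨e⟩ := nonempty_monoidHom_units_mulEquiv hchar hTsq
  obtain ⟨H, hH, ⟨E₁⟩⟩ := exists_subgroup_mulEquiv_of_injective ((basisScaling b).comp Φ)
    (by rw [MonoidHom.coe_comp]; exact (basisScaling_injective b).comp hΦ)
  let E : H ≃* T × Multiplicative (ZMod 2) := E₁.trans (e.prodCongr (MulEquiv.refl _))
  have hcard : Nat.card T = n ^ 2 := by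
    rw [← Module.finrank_eq_nat_card_basis b, Module.finrank_matrix]
    simp [sq]
  have hscaling := map_homogeneous_eq_iff_exists_basisScaling hdim hT b hb
  refine ⟨T, H, hT, ?_, fun x hx y hy => ?_, ⟨E⟩, ?_⟩
  · rw [hH]
    ext ψ
    rw [Set.mem_ofPred_eq, hscaling]
    constructor
    · rintro ⟨p, rfl⟩
      exact ⟨⟨Φ p, rfl⟩, (hrange _).mp ⟨p, rfl⟩⟩
    · rintro ⟨⟨χ, rfl⟩, hχ⟩
      obtain ⟨p, rfl⟩ := (hrange χ).mpr hχ
      exact ⟨p, rfl⟩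
  · exact congrArg Subtype.val <| E.injective (a₁ := ⟨x, hx⟩ * ⟨y, hy⟩) (a₂ := ⟨y, hy⟩ * ⟨x, hx⟩)
      (by rw [map_mul, mul_comm, map_mul])
  · rw [Nat.card_congr E.toEquiv, Nat.card_prod, hcard, mul_comm]
    simp
end

section
/- Let T be a finite abelian group, F a field, and β : T × T → Fˣ a nondegenerate alternating bicharacter, i.e., β is multiplicative in each variable, β(t,t) = 1 for all t, and β(u,t) = 1 for all u ∈ T implies t = e. Then there exist elements a_1, b_1, …, a_r, b_r of T such that T is the internal direct product of the cyclic subgroups ⟨a_1⟩, ⟨b_1⟩, …, ⟨a_r⟩, ⟨b_r⟩, the orders of a_i and b_i are both equal to some ℓ_i, the element β(a_i, b_i) has multiplicative order ℓ_i in Fˣ (a primitive ℓ_i-th root of unity), and all other pairings among the generators are trivial: β(a_i, a_j) = β(b_i, b_j) = 1 for all i, j, and β(a_i, b_j) = 1 for i ≠ j. -/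
section AlternatingBicharacter

variable {R : Type*} [CommRing R] [IsDomain R]

theorem MonoidHom.swap_eq_inv_of_alternating {T M : Type*} [CommGroup T] [CommGroup M]
    (B : T →* T →* M) (halt : ∀ t, B t t = 1) (s t : T) : B s t = (B t s)⁻¹ := by
  have h := halt (s * t)
  simp only [map_mul, MonoidHom.mul_apply, halt, one_mul, mul_one] at h
  rwa [mul_eq_one_iff_eq_inv'] at h

/-- An element of maximal order in a finite abelian group with a nondegenerate bicharacter pairs
with another element of maximal order to a value of that same order. -/
theorem exists_orderOf_pairing_eq_exponent {T M : Type*} [CommGroup T] [Finite T] [CommGroup M]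
    (B : T →* T →* M) (hnd : ∀ t, B t = 1 → t = 1) :
    ∃ a b : T, orderOf a = Monoid.exponent T ∧ orderOf b = Monoid.exponent T ∧
      orderOf (B a b) = Monoid.exponent T := by
  obtain ⟨a, ha⟩ := Monoid.exists_orderOf_eq_exponent (Monoid.ExponentExists.of_finite (G := T))
  have : Finite (B a).range := Set.finite_range (B a)
  obtain ⟨⟨_, b, rfl⟩, hb⟩ :=
    Monoid.exists_orderOf_eq_exponent (Monoid.ExponentExists.of_finite (G := (B a).range))
  have hpow : a ^ orderOf (B a b) = 1 := by
    refine hnd _ (MonoidHom.ext fun t => ?_)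
    have h := Monoid.pow_exponent_eq_one (⟨B a t, MonoidHom.mem_range.mpr ⟨t, rfl⟩⟩ : (B a).range)
    rw [← hb, ← Subgroup.orderOf_coe] at h
    simpa using congrArg Subtype.val h
  have hab : Monoid.exponent T ∣ orderOf (B a b) := ha ▸ orderOf_dvd_of_pow_eq_one hpow
  have hb : orderOf b = Monoid.exponent T :=
    (Monoid.order_dvd_exponent b).antisymm (hab.trans (orderOf_map_dvd (B a) b))
  exact ⟨a, b, ha, hb, (hb ▸ orderOf_map_dvd (B a) b).antisymm hab⟩

/-- If `a` and `b` pair to a root of unity of order the exponent of `T`, then `T` is the product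
of `⟨a⟩`, `⟨b⟩` and their common orthogonal complement. -/
theorem exists_eq_pow_mul_pow_mul_of_orderOf_pairing {T : Type*} [CommGroup T] [Finite T]
    (B : T →* T →* Rˣ) (halt : ∀ t, B t t = 1) {a b : T}
    (hab : orderOf (B a b) = Monoid.exponent T) (t : T) :
    ∃ (j k : ℕ), ∃ h ∈ (B a).ker ⊓ (B b).ker, t = a ^ j * b ^ k * h := by
  have hprim : IsPrimitiveRoot (B b a) (Monoid.exponent T) := by
    rw [MonoidHom.swap_eq_inv_of_alternating B halt b a, ← hab]
    exact (IsPrimitiveRoot.orderOf _).inv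
  have hprim' : IsPrimitiveRoot (B a b) (Monoid.exponent T) := hab ▸ IsPrimitiveRoot.orderOf _
  have : NeZero (Monoid.exponent T) := ⟨Monoid.exponent_ne_zero_of_finite⟩
  have hpow (s : T) : B s t ^ Monoid.exponent T = 1 := by
    rw [← map_pow, Monoid.pow_exponent_eq_one, map_one]
  have hpowers {ζ : Rˣ} (hζ : IsPrimitiveRoot ζ (Monoid.exponent T)) (s : T) :
      ∃ k : ℕ, ζ ^ k = B s t := by
    obtain ⟨k, -, hk⟩ := (IsPrimitiveRoot.coe_units_iff.mpr hζ).eq_pow_of_pow_eq_one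
      (ξ := (B s t : R)) (by rw [← Units.val_pow_eq_pow_val, hpow, Units.val_one])
    exact ⟨k, Units.ext (by exact_mod_cast hk)⟩
  obtain ⟨j, hj⟩ := hpowers hprim b
  obtain ⟨k, hk⟩ := hpowers hprim' a
  refine ⟨j, k, (a ^ j * b ^ k)⁻¹ * t, ⟨?_, ?_⟩, (mul_inv_cancel_left _ _).symm⟩
  · simp [halt, hk]
  · simp [halt, hj]

/-- Elements `a i`, `b i` generating `T` with standard symplectic pairings. -/
theorem exists_symplectic_generators (n : ℕ) {T : Type*} [CommGroup T] [Finite T]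
    (hn : Nat.card T = n) (B : T →* T →* Rˣ) (halt : ∀ t, B t t = 1)
    (hnd : ∀ t, B t = 1 → t = 1) :
    ∃ (r : ℕ) (a b : Fin r → T),
      (∀ i, orderOf (b i) = orderOf (a i)) ∧
      (∀ i, orderOf (B (a i) (b i)) = orderOf (a i)) ∧
      (∀ i j, B (a i) (a j) = 1) ∧
      (∀ i j, B (b i) (b j) = 1) ∧
      (∀ i j, i ≠ j → B (a i) (b j) = 1) ∧
      ∀ t, ∃ x y : Fin r → ℕ, t = ∏ i, a i ^ x i * b i ^ y i := by
  induction n using Nat.strong_induction_on generalizing T with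
  | h n ih =>
  rcases subsingleton_or_nontrivial T with hT | hT
  · exact ⟨0, Fin.elim0, Fin.elim0, fun i => i.elim0, fun i => i.elim0, fun i => i.elim0,
      fun i => i.elim0, fun i => i.elim0, fun t => ⟨Fin.elim0, Fin.elim0, Subsingleton.elim _ _⟩⟩
  obtain ⟨a, b, ha, hb, hab⟩ := exists_orderOf_pairing_eq_exponent B hnd
  have hdecomp := exists_eq_pow_mul_pow_mul_of_orderOf_pairing B halt hab
  have swap := MonoidHom.swap_eq_inv_of_alternating B halt
  set H : Subgroup T := (B a).ker ⊓ (B b).ker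
  have haH (h : H) : B a h = 1 := h.2.1
  have hbH (h : H) : B b h = 1 := h.2.2
  have hHa (h : H) : B h a = 1 := by rw [swap, haH, inv_one]
  have hHb (h : H) : B h b = 1 := by rw [swap, hbH, inv_one]
  have hlt : Nat.card H < n := by
    refine hn ▸ lt_of_le_of_ne (Subgroup.card_le_card_group H) fun h => ?_
    have hbtop : b ∈ H := (Subgroup.eq_top_of_card_eq H h) ▸ Subgroup.mem_top b
    rw [haH ⟨b, hbtop⟩, orderOf_one, eq_comm, Monoid.exp_eq_one_iff] at hab
    exact not_subsingleton T hab
  obtain ⟨r, a', b', hord, hpair, haa, hbb, hne, hgen⟩ := ih _ hlt (T := H) rfl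
    ((MonoidHom.compHom' H.subtype).comp (B.comp H.subtype)) (fun h => halt h) (fun h hh => by
      refine Subtype.ext (hnd _ (MonoidHom.ext fun t => ?_))
      obtain ⟨j, k, s, hs, rfl⟩ := hdecomp t
      have hhs : B h s = 1 := DFunLike.congr_fun hh (⟨s, hs⟩ : H)
      simp [hHa, hHb, hhs])
  refine ⟨r + 1, Fin.cons a fun i => a' i, Fin.cons b fun i => b' i, ?_, ?_, ?_, ?_, ?_, ?_⟩
  · refine Fin.cases (hb.trans ha.symm) fun i => ?_
    simpa using hord i
  · refine Fin.cases (hab.trans ha.symm) fun i => ?_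
    simpa using hpair i
  · refine Fin.cases (Fin.cases (halt a) fun j => haH _) fun i => Fin.cases (hHa _) fun j => haa i j
  · refine Fin.cases (Fin.cases (halt b) fun j => hbH _) fun i => Fin.cases (hHb _) fun j => hbb i j
  · refine Fin.cases (Fin.cases (fun h => absurd rfl h) fun j _ => haH _) fun i =>
      Fin.cases (fun _ => hHb _) fun j hij => hne i j fun h => hij (congrArg _ h)
  · intro t
    obtain ⟨j, k, s, hs, rfl⟩ := hdecomp t
    obtain ⟨x, y, hxy⟩ := hgen ⟨s, hs⟩
    refine ⟨Fin.cons j x, Fin.cons k y, ?_⟩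
    simpa [Fin.prod_univ_succ] using congrArg Subtype.val hxy

end AlternatingBicharacter


/-- A finite abelian group with a nondegenerate alternating
`Fˣ`-valued bicharacter decomposes as an internal direct product of pairs of cyclic
subgroups `⟨aᵢ⟩, ⟨bᵢ⟩` of order `ℓᵢ`, with `⟨aᵢ⟩` and `⟨bᵢ⟩` in duality by `β`
(`β(aᵢ,bᵢ)` a primitive `ℓᵢ`-th root of unity) and all other pairings trivial. -/
theorem alternating_bicharacter_symplectic_basis
    {F : Type*} [Field F] {T : Type*} [CommGroup T] [Finite T]
    (β : T → T → Fˣ)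
    (hmul₁ : ∀ u v w : T, β (u * v) w = β u w * β v w)
    (hmul₂ : ∀ u v w : T, β u (v * w) = β u v * β u w)
    (halt : ∀ t : T, β t t = 1)
    (hnd : ∀ t : T, (∀ u : T, β u t = 1) → t = 1) :
    ∃ (r : ℕ) (ℓ : Fin r → ℕ) (a b : Fin r → T),
      (∀ i, 0 < ℓ i) ∧
      (∀ i, orderOf (a i) = ℓ i) ∧
      (∀ i, orderOf (b i) = ℓ i) ∧
      (∀ i, orderOf (β (a i) (b i)) = ℓ i) ∧
      (∀ i j, β (a i) (a j) = 1) ∧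
      (∀ i j, β (b i) (b j) = 1) ∧
      (∀ i j, i ≠ j → β (a i) (b j) = 1) ∧
      Function.Bijective (fun x : (i : Fin r) → ZMod (ℓ i) × ZMod (ℓ i) =>
        ∏ i, a i ^ ((x i).1.val) * b i ^ ((x i).2.val)) := by
  let B : T →* T →* Fˣ := MonoidHom.mk' (fun u => MonoidHom.mk' (β u) (hmul₂ u))
    fun u v => MonoidHom.ext (hmul₁ u v)
  have hB (u v : T) : B u v = β u v := rfl
  have hinv := MonoidHom.swap_eq_inv_of_alternating B halt
  obtain ⟨r, a, b, hord, hpair, haa, hbb, hne, hgen⟩ := exists_symplectic_generators _ rfl B halt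
    fun t ht => hnd t fun u => by rw [← hB, hinv, ht, MonoidHom.one_apply, inv_one]
  have hpos (i : Fin r) : 0 < orderOf (a i) := orderOf_pos (a i)
  have (i : Fin r) : NeZero (orderOf (a i)) := ⟨(hpos i).ne'⟩
  refine ⟨r, fun i => orderOf (a i), a, b, hpos, fun _ => rfl, hord, hpair, haa, hbb, hne, ?_, ?_⟩
  · have hfst (x : (i : Fin r) → ZMod (orderOf (a i)) × ZMod (orderOf (a i))) (i : Fin r) :
        B (∏ j, a j ^ (x j).1.val * b j ^ (x j).2.val) (b i) = B (a i) (b i) ^ (x i).1.val := by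
      rw [map_prod, MonoidHom.finsetProd_apply, Finset.prod_eq_single i]
      · simp [hbb]
      · intro j _ hji
        simp [hbb, hne j i hji]
      · simp
    have hsnd (x : (i : Fin r) → ZMod (orderOf (a i)) × ZMod (orderOf (a i))) (i : Fin r) :
        B (a i) (∏ j, a j ^ (x j).1.val * b j ^ (x j).2.val) = B (a i) (b i) ^ (x i).2.val := by
      rw [map_prod, Finset.prod_eq_single i]
      · simp [haa]
      · intro j _ hji
        simp [haa, hne i j hji.symm]
      · simp
    have hcancel (i : Fin r) {u v : ZMod (orderOf (a i))}
        (h : B (a i) (b i) ^ u.val = B (a i) (b i) ^ v.val) : u = v :=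
      ZMod.val_injective _ (pow_injOn_Iio_orderOf (by simpa [hpair] using u.val_lt)
        (by simpa [hpair] using v.val_lt) h)
    intro x y hxy
    refine funext fun i => Prod.ext (hcancel i ?_) (hcancel i ?_)
    · rw [← hfst, ← hfst]
      exact congrArg (fun t => B t (b i)) hxy
    · rw [← hsnd, ← hsnd]
      exact congrArg (B (a i)) hxy
  · intro t
    obtain ⟨x, y, rfl⟩ := hgen t
    refine ⟨fun i => (x i, y i), Finset.prod_congr rfl fun i _ => ?_⟩
    simp only [ZMod.val_natCast]
    rw [pow_mod_orderOf, ← hord i, pow_mod_orderOf]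
end

section
/- Let F be an algebraically closed field and let R = M_n(F) be endowed with a G-grading. Then there exist graded unital subalgebras C and D of R with the following properties: C has an F-basis consisting of homogeneous elements E_{ij} (1 ≤ i,j ≤ k, for some k) satisfying E_{ij}E_{pq} = δ_{jp}E_{iq} and E_{11} + ⋯ + E_{kk} = 1 (so C ≅ M_k(F) with an elementary grading); every homogeneous component of D has dimension at most 1 (so D carries a division grading); the linear map C ⊗ D → R sending c ⊗ d to cd is an algebra isomorphism; and the intersection of the support of the grading on C with the support of the grading on D is {e}. -/
open TensorProduct

open DirectSum

section GradedPrime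

variable {F A ι : Type*} [Field F] [Ring A] [Algebra F A] [AddCommGroup ι] [DecidableEq ι]
  (𝒜 : ι → Submodule F A) [GradedAlgebra 𝒜]

/-- In a graded prime algebra, nonzero elements can be joined by a homogeneous element. -/
theorem exists_homogeneous_mul_mul_ne_zero
    (hp : ∀ a b : A, a ≠ 0 → b ≠ 0 → ∃ r, a * r * b ≠ 0) {a b : A} (ha : a ≠ 0) (hb : b ≠ 0) :
    ∃ g, ∃ r ∈ 𝒜 g, a * r * b ≠ 0 := by
  by_contra! h
  obtain ⟨r, hr⟩ := hp a b ha hb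
  apply hr
  clear hr
  induction r using Decomposition.inductionOn 𝒜 with
  | zero => simp
  | homogeneous m => exact h _ _ m.2
  | add m m' h h' => rw [mul_add, add_mul, h, h', add_zero]

variable {𝒜}

/-- A left quotient of homogeneous elements can be chosen homogeneous. -/
theorem exists_homogeneous_left_factor {i j : ι} {u a b : A} (ha : a ∈ 𝒜 j) (hb : b ∈ 𝒜 (i + j))
    (h : u * a = b) : ∃ v ∈ 𝒜 i, v * a = b := by
  refine ⟨decompose 𝒜 u i, SetLike.coe_mem _, ?_⟩
  rw [← coe_decompose_mul_add_of_right_mem 𝒜 ha, h, decompose_of_mem_same _ hb]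

variable (𝒜) in
/-- A nonzero idempotent `e` of degree zero such that every nonzero homogeneous element of the left
ideal `A e` generates `A e`. -/
structure IsGradedPrimitive (e : A) : Prop where
  mem : e ∈ 𝒜 0
  ne_zero : e ≠ 0
  idem : e * e = e
  exists_left_inv : ∀ g, ∀ x ∈ 𝒜 g, x * e = x → x ≠ 0 → ∃ y ∈ 𝒜 (-g), y * x = e

variable (𝒜) in
/-- A nonzero homogeneous element generating a left ideal of minimal dimension. -/
theorem exists_homogeneous_generating_minimal [FiniteDimensional F A] [Nontrivial A] :
    ∃ g, ∃ a ∈ 𝒜 g, a ≠ 0 ∧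
      ∀ h, ∀ b ∈ 𝒜 h, b ≠ 0 → (∃ r, r * a = b) → ∀ s, ∃ r, r * b = s * a := by
  let S : Set A := {a | a ≠ 0 ∧ ∃ g, a ∈ 𝒜 g}
  let d : A → ℕ := fun a => Module.finrank F (LinearMap.range (LinearMap.mulRight F a))
  have hS : S.Nonempty := ⟨1, one_ne_zero, 0, SetLike.GradedOne.one_mem⟩
  obtain ⟨a, ⟨ha0, g, hag⟩, hmin⟩ := (measure d).wf.has_min S hS
  refine ⟨g, a, hag, ha0, fun h b hb hb0 ⟨r, hr⟩ s => ?_⟩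
  have hle : LinearMap.range (LinearMap.mulRight F b) ≤ LinearMap.range (LinearMap.mulRight F a) := by
    rintro _ ⟨t, rfl⟩
    exact ⟨t * r, by simp [← hr, mul_assoc]⟩
  have heq := Submodule.eq_of_le_of_finrank_le hle (not_lt.1 (hmin b ⟨hb0, h, hb⟩))
  have hmem : s * a ∈ LinearMap.range (LinearMap.mulRight F b) := heq ▸ ⟨s, rfl⟩
  exact hmem

variable (𝒜) in
theorem exists_isGradedPrimitive [FiniteDimensional F A] [Nontrivial A]
    (hp : ∀ a b : A, a ≠ 0 → b ≠ 0 → ∃ r, a * r * b ≠ 0) : ∃ e, IsGradedPrimitive 𝒜 e := by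
  obtain ⟨g, a, ha, ha0, hmin⟩ := exists_homogeneous_generating_minimal 𝒜
  obtain ⟨h, c, hc, hac⟩ := exists_homogeneous_mul_mul_ne_zero 𝒜 hp ha0 ha0
  have hca0 : c * a ≠ 0 := fun h0 => hac (by rw [mul_assoc, h0, mul_zero])
  have hca : c * a ∈ 𝒜 (h + g) := SetLike.mul_mem_graded hc ha
  have haca : a * c * a ∈ 𝒜 (g + h + g) := SetLike.mul_mem_graded (SetLike.mul_mem_graded ha hc) ha
  obtain ⟨u, hu⟩ := hmin _ _ haca hac ⟨_, rfl⟩ c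
  obtain ⟨v, hv, hvca⟩ := exists_homogeneous_left_factor (i := -g) haca
    (by convert hca using 2; abel) hu
  have hve : v * a ∈ 𝒜 0 := by simpa using SetLike.mul_mem_graded hv ha
  have hvca' : v * a * (c * a) = c * a := by simpa only [mul_assoc] using hvca
  have hidem : v * a * (v * a) = v * a := by
    by_contra hne
    have h0 := sub_ne_zero.2 hne
    have hmem : v * a * (v * a) - v * a ∈ 𝒜 0 :=
      sub_mem (by simpa using SetLike.mul_mem_graded hve hve) hve
    obtain ⟨r, hr⟩ := hmin _ _ hmem h0 ⟨v * a * v - v, by rw [sub_mul]; simp only [mul_assoc]⟩ 1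
    apply hac
    calc a * c * a = r * (v * a * (v * a) - v * a) * (c * a) := by rw [hr, one_mul, mul_assoc]
      _ = 0 := by
        rw [mul_assoc, sub_mul, mul_assoc (v * a), hvca', hvca', sub_self, mul_zero]
  have hne : v * a ≠ 0 := fun h0 => hca0 (by rw [← hvca', h0, zero_mul])
  refine ⟨v * a, hve, hne, hidem, fun k x hx hxe hx0 => ?_⟩
  obtain ⟨r, hr⟩ := hmin _ _ hx hx0 ⟨x * v, by rw [mul_assoc, hxe]⟩ v
  exact exists_homogeneous_left_factor hx (by simpa using hve) hr

namespace IsGradedPrimitive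

variable {e : A} (he : IsGradedPrimitive 𝒜 e)
include he

/-- Nonzero homogeneous elements of the corner `e A e` are invertible in it. -/
theorem exists_inv {g : ι} {d : A} (hd : d ∈ 𝒜 g) (hd0 : d ≠ 0) (hed : e * d = d) (hde : d * e = d) :
    ∃ d' ∈ 𝒜 (-g), d' ≠ 0 ∧ e * d' = d' ∧ d' * e = d' ∧ d' * d = e ∧ d * d' = e := by
  have key : ∀ g, ∀ d ∈ 𝒜 g, d ≠ 0 → e * d = d → d * e = d →
      ∃ d' ∈ 𝒜 (-g), d' ≠ 0 ∧ e * d' = d' ∧ d' * e = d' ∧ d' * d = e := by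
    intro g d hd hd0 hed hde
    obtain ⟨y, hy, hyd⟩ := he.exists_left_inv g d hd hde hd0
    have h1 : e * y * e * d = e := by rw [mul_assoc _ e, hed, mul_assoc, hyd, he.idem]
    refine ⟨e * y * e, ?_, fun h0 => he.ne_zero ?_, ?_, ?_, h1⟩
    · simpa using SetLike.mul_mem_graded (SetLike.mul_mem_graded he.mem hy) he.mem
    · rw [← h1, h0, zero_mul]
    · rw [← mul_assoc, ← mul_assoc, he.idem]
    · rw [mul_assoc, he.idem]
  obtain ⟨y, hy, hy0, hey, hye, hyd⟩ := key g d hd hd0 hed hde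
  obtain ⟨z, -, -, -, hze, hzy⟩ := key _ y hy hy0 hey hye
  have hzd : z = d := by rw [← hze, ← hyd, ← mul_assoc, hzy, hed]
  exact ⟨y, hy, hy0, hey, hye, hyd, hzd ▸ hzy⟩

omit [DecidableEq ι] [GradedAlgebra 𝒜] in
/-- Over an algebraically closed field the degree zero part of the corner is one-dimensional. -/
theorem exists_eq_smul_of_mem_zero [IsAlgClosed F] [FiniteDimensional F A] {d : A} (hd : d ∈ 𝒜 0)
    (hed : e * d = d) (hde : d * e = d) : ∃ c : F, d = c • e := by
  let W : Submodule F A := LinearMap.ker (LinearMap.mulLeft F e - LinearMap.id)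
  have hW : ∀ w, w ∈ W ↔ e * w = w := fun w => by simp [W, sub_eq_zero]
  have : Nontrivial W := ⟨⟨e, (hW e).2 he.idem⟩, 0, fun h => he.ne_zero (congrArg Subtype.val h)⟩
  let L : Module.End F W := (LinearMap.mulLeft F d).restrict (p := W) (q := W)
    fun w _ => (hW _).2 (by rw [LinearMap.mulLeft_apply, ← mul_assoc, hed])
  obtain ⟨c, hc⟩ := Module.End.exists_eigenvalue L
  obtain ⟨w, hw⟩ := hc.exists_hasEigenvector
  have hdw : d * w = c • (w : A) := congrArg Subtype.val hw.apply_eq_smul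
  have hew : e * w = (w : A) := (hW _).1 w.2
  refine ⟨c, ?_⟩
  by_contra hne
  obtain ⟨y, -, hy⟩ := he.exists_left_inv 0 (d - c • e) (sub_mem hd (Submodule.smul_mem _ _ he.mem))
    (by rw [sub_mul, hde, smul_mul_assoc, he.idem]) (sub_ne_zero.2 hne)
  apply hw.2
  apply Subtype.ext
  calc (w : A) = y * (d - c • e) * w := by rw [hy, hew]
    _ = 0 := by rw [mul_assoc, sub_mul, hdw, smul_mul_assoc, hew, sub_self, mul_zero]

theorem exists_eq_smul [IsAlgClosed F] [FiniteDimensional F A] {g : ι} {d d' : A} (hd : d ∈ 𝒜 g)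
    (hd0 : d ≠ 0) (hed : e * d = d) (hde : d * e = d) (hd' : d' ∈ 𝒜 g)
    (hed' : e * d' = d') (hde' : d' * e = d') : ∃ c : F, d' = c • d := by
  obtain ⟨y, hy, -, hey, -, -, hdy⟩ := he.exists_inv hd hd0 hed hde
  obtain ⟨c, hc⟩ := he.exists_eq_smul_of_mem_zero (d := y * d')
    (by simpa using SetLike.mul_mem_graded hy hd') (by rw [← mul_assoc, hey])
    (by rw [mul_assoc, hde'])
  exact ⟨c, by rw [← hed', ← hdy, mul_assoc, hc, mul_smul_comm, hde]⟩

/-- The support of the corner `e A e`. -/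
def cornerSupport : AddSubgroup ι where
  carrier := {t | ∃ d ∈ 𝒜 t, d ≠ 0 ∧ e * d = d ∧ d * e = d}
  zero_mem' := ⟨e, he.mem, he.ne_zero, he.idem, he.idem⟩
  add_mem' := by
    rintro s t ⟨a, ha, ha0, hea, hae⟩ ⟨b, hb, hb0, heb, hbe⟩
    obtain ⟨y, -, -, -, -, hya, -⟩ := he.exists_inv ha ha0 hea hae
    refine ⟨a * b, SetLike.mul_mem_graded ha hb, fun h0 => hb0 ?_, ?_, ?_⟩
    · rw [← heb, ← hya, mul_assoc, h0, mul_zero]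
    · rw [← mul_assoc, hea]
    · rw [mul_assoc, hbe]
  neg_mem' := by
    rintro t ⟨a, ha, ha0, hea, hae⟩
    obtain ⟨y, hy, hy0, hey, hye, -⟩ := he.exists_inv ha ha0 hea hae
    exact ⟨y, hy, hy0, hey, hye⟩

end IsGradedPrimitive

variable (𝒜) in
/-- Dual homogeneous families in `A e` and `e A`, with degrees in a prescribed set. -/
structure HomogeneousFrame (S : Set ι) (e : A) (κ : Type*) [DecidableEq κ] where
  x : κ → A
  y : κ → A
  deg : κ → ι
  deg_mem : ∀ i, deg i ∈ S
  x_mem : ∀ i, x i ∈ 𝒜 (deg i)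
  y_mem : ∀ i, y i ∈ 𝒜 (-deg i)
  x_mul : ∀ i, x i * e = x i
  mul_y : ∀ i, e * y i = y i
  y_mul_x : ∀ i j, y i * x j = if i = j then e else 0

omit [DecidableEq ι] [GradedAlgebra 𝒜] in
theorem HomogeneousFrame.linearIndependent {S : Set ι} {e : A} {m : ℕ}
    (he : IsGradedPrimitive 𝒜 e) (φ : HomogeneousFrame 𝒜 S e (Fin m)) :
    LinearIndependent F φ.x := by
  rw [Fintype.linearIndependent_iff]
  intro c hc j
  have := congrArg (φ.y j * ·) hc
  simpa [Finset.mul_sum, φ.y_mul_x, he.ne_zero] using this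

namespace IsGradedPrimitive

variable {e : A} (he : IsGradedPrimitive 𝒜 e)
include he

theorem exists_dual_pair (hp : ∀ a b : A, a ≠ 0 → b ≠ 0 → ∃ r, a * r * b ≠ 0) {f : A}
    (hf : f ∈ 𝒜 0) (hf0 : f ≠ 0) (hff : f * f = f) :
    ∃ g ∈ Set.range (Quotient.out : ι ⧸ he.cornerSupport → ι), ∃ x ∈ 𝒜 g, ∃ y ∈ 𝒜 (-g),
      x * e = x ∧ f * x = x ∧ e * y = y ∧ y * f = y ∧ y * x = e := by
  obtain ⟨h, r, hr, hfre⟩ := exists_homogeneous_mul_mul_ne_zero 𝒜 hp hf0 he.ne_zero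
  have hx0 : f * r * e ∈ 𝒜 h := by
    simpa using SetLike.mul_mem_graded (SetLike.mul_mem_graded hf hr) he.mem
  obtain ⟨y, hy, hyx⟩ := he.exists_left_inv h _ hx0 (by rw [mul_assoc, he.idem]) hfre
  let g : ι := Quotient.out (h : ι ⧸ he.cornerSupport)
  have hg : -h + g ∈ he.cornerSupport := QuotientAddGroup.eq.1 (QuotientAddGroup.out_eq' _).symm
  obtain ⟨d, hd, hd0, hed, hde⟩ := hg
  obtain ⟨d', hd', -, hed', hde', hdd, -⟩ := he.exists_inv hd hd0 hed hde
  refine ⟨g, ⟨_, rfl⟩, f * r * e * d, ?_, d' * y * f, ?_, ?_, ?_, ?_, ?_, ?_⟩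
  · simpa using SetLike.mul_mem_graded hx0 hd
  · have := SetLike.mul_mem_graded (SetLike.mul_mem_graded hd' hy) hf
    convert this using 2
    abel
  · rw [mul_assoc, hde]
  · simp only [← mul_assoc, hff]
  · simp only [← mul_assoc, hed']
  · rw [mul_assoc, hff]
  · calc d' * y * f * (f * r * e * d) = d' * (y * ((f * f) * r * e)) * d := by
          simp only [mul_assoc]
      _ = e := by rw [hff, hyx, hde', hdd]

theorem exists_frame_succ (hp : ∀ a b : A, a ≠ 0 → b ≠ 0 → ∃ r, a * r * b ≠ 0) {m : ℕ}
    (φ : HomogeneousFrame 𝒜 (Set.range (Quotient.out : ι ⧸ he.cornerSupport → ι)) e (Fin m))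
    (hφ : ∑ i, φ.x i * φ.y i ≠ 1) :
    Nonempty (HomogeneousFrame 𝒜 (Set.range (Quotient.out : ι ⧸ he.cornerSupport → ι)) e
      (Fin (m + 1))) := by
  set f : A := 1 - ∑ i, φ.x i * φ.y i with hf
  have hfx : ∀ j, f * φ.x j = 0 := fun j => by
    simp [hf, sub_mul, Finset.sum_mul, mul_assoc, φ.y_mul_x, φ.x_mul]
  have hyf : ∀ j, φ.y j * f = 0 := fun j => by
    simp [hf, mul_sub, Finset.mul_sum, ← mul_assoc, φ.y_mul_x, φ.mul_y]
  have hff : f * f = f := by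
    nth_rw 2 [hf]
    simp [mul_sub, Finset.mul_sum, ← mul_assoc, hfx]
  have hfm : f ∈ 𝒜 0 := by
    refine sub_mem SetLike.GradedOne.one_mem (sum_mem fun i _ => ?_)
    simpa using SetLike.mul_mem_graded (φ.x_mem i) (φ.y_mem i)
  obtain ⟨g, hg, x, hx, y, hy, hxe, hfx', hey, hyf', hyx⟩ :=
    he.exists_dual_pair hp hfm (sub_ne_zero.2 (Ne.symm hφ)) hff
  have hyx' : ∀ j, y * φ.x j = 0 := fun j => by rw [← hyf', mul_assoc, hfx, mul_zero]
  have hy'x : ∀ j, φ.y j * x = 0 := fun j => by rw [← hfx', ← mul_assoc, hyf, zero_mul]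
  refine ⟨⟨Fin.cons x φ.x, Fin.cons y φ.y, Fin.cons g φ.deg, ?_, ?_, ?_, ?_, ?_, ?_⟩⟩
  · exact Fin.forall_fin_succ.2 ⟨hg, φ.deg_mem⟩
  · exact Fin.forall_fin_succ.2 ⟨hx, φ.x_mem⟩
  · exact Fin.forall_fin_succ.2 ⟨hy, φ.y_mem⟩
  · exact Fin.forall_fin_succ.2 ⟨hxe, φ.x_mul⟩
  · exact Fin.forall_fin_succ.2 ⟨hey, φ.mul_y⟩
  · simp [Fin.forall_fin_succ, hyx, hyx', hy'x, φ.y_mul_x, (Fin.succ_ne_zero _).symm]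

theorem exists_complete_frame [FiniteDimensional F A]
    (hp : ∀ a b : A, a ≠ 0 → b ≠ 0 → ∃ r, a * r * b ≠ 0) :
    ∃ (m : ℕ) (φ : HomogeneousFrame 𝒜 (Set.range (Quotient.out : ι ⧸ he.cornerSupport → ι)) e
      (Fin m)), ∑ i, φ.x i * φ.y i = 1 := by
  by_contra! h
  have key : ∀ m : ℕ, Nonempty (HomogeneousFrame 𝒜
      (Set.range (Quotient.out : ι ⧸ he.cornerSupport → ι)) e (Fin m)) := by
    intro m
    induction m with
    | zero => exact ⟨⟨Fin.elim0, Fin.elim0, Fin.elim0, fun i => i.elim0, fun i => i.elim0,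
        fun i => i.elim0, fun i => i.elim0, fun i => i.elim0, fun i => i.elim0⟩⟩
    | succ m ih =>
      obtain ⟨φ⟩ := ih
      exact he.exists_frame_succ hp φ (h m φ)
  obtain ⟨φ⟩ := key (Module.finrank F A + 1)
  have := (φ.linearIndependent he).fintype_card_le_finrank
  simp at this

end IsGradedPrimitive

namespace HomogeneousFrame

section Complete

variable {S : Set ι} {e : A} {κ : Type*} [DecidableEq κ] [Fintype κ]
  (φ : HomogeneousFrame 𝒜 S e κ)

/-- The matrix units `x i * y j` of a frame. -/
def unit (i j : κ) : A := φ.x i * φ.y j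

/-- The block-diagonal map `r ↦ ∑ i, x i * r * y i`. -/
def diag : A →ₗ[F] A := ∑ i, LinearMap.mulLeftRight F (φ.x i, φ.y i)

omit [DecidableEq ι] [GradedAlgebra 𝒜] in
theorem diag_apply (r : A) : φ.diag r = ∑ i, φ.x i * r * φ.y i := by
  simp [diag]

omit [DecidableEq ι] [GradedAlgebra 𝒜] [Fintype κ] in
theorem x_mul_mul (i : κ) (r : A) : φ.x i * (e * r) = φ.x i * r := by
  rw [← mul_assoc, φ.x_mul]

omit [DecidableEq ι] [GradedAlgebra 𝒜] [Fintype κ] in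
theorem unit_mul_unit (i j p q : κ) :
    φ.unit i j * φ.unit p q = if j = p then φ.unit i q else 0 := by
  rw [unit, unit, mul_assoc, ← mul_assoc (φ.y j), φ.y_mul_x]
  split_ifs
  · rw [φ.mul_y, unit]
  · rw [zero_mul, mul_zero]

omit [DecidableEq ι] [GradedAlgebra 𝒜] in
theorem y_mul_diag (i : κ) (r : A) : φ.y i * φ.diag r = e * r * φ.y i := by
  simp [diag_apply, Finset.mul_sum, ← mul_assoc, φ.y_mul_x]

omit [DecidableEq ι] [GradedAlgebra 𝒜] in
theorem diag_mul_x (i : κ) (r : A) : φ.diag r * φ.x i = φ.x i * r * e := by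
  simp [diag_apply, Finset.sum_mul, mul_assoc, φ.y_mul_x]

omit [DecidableEq ι] [GradedAlgebra 𝒜] in
theorem unit_mul_diag (i j : κ) (r : A) : φ.unit i j * φ.diag r = φ.x i * r * φ.y j := by
  rw [unit, mul_assoc, y_mul_diag, mul_assoc e, x_mul_mul, mul_assoc]

omit [DecidableEq ι] [GradedAlgebra 𝒜] in
theorem diag_mul_unit (i j : κ) (r : A) : φ.diag r * φ.unit i j = φ.x i * r * φ.y j := by
  rw [unit, ← mul_assoc, diag_mul_x, mul_assoc, φ.mul_y]

omit [DecidableEq ι] [GradedAlgebra 𝒜] in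
theorem diag_mul_diag (r s : A) : φ.diag r * φ.diag s = φ.diag (r * e * s) := by
  rw [φ.diag_apply s, Finset.mul_sum, φ.diag_apply (r * e * s)]
  refine Finset.sum_congr rfl fun i _ => ?_
  rw [← mul_assoc, ← mul_assoc, diag_mul_x]
  simp only [mul_assoc]

omit [DecidableEq ι] [GradedAlgebra 𝒜] in
theorem diag_corner (r : A) : φ.diag (e * r * e) = φ.diag r := by
  simp only [diag_apply, mul_assoc, φ.mul_y, φ.x_mul_mul]

omit [Fintype κ] in
theorem unit_mem (i j : κ) : φ.unit i j ∈ 𝒜 (φ.deg i - φ.deg j) := by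
  rw [sub_eq_add_neg]
  exact SetLike.mul_mem_graded (φ.x_mem i) (φ.y_mem j)

theorem diag_mem {g : ι} {r : A} (hr : r ∈ 𝒜 g) : φ.diag r ∈ 𝒜 g := by
  rw [diag_apply]
  refine sum_mem fun i _ => ?_
  have := SetLike.mul_mem_graded (SetLike.mul_mem_graded (φ.x_mem i) hr) (φ.y_mem i)
  convert this using 2
  abel

variable (h1 : ∑ i, φ.x i * φ.y i = 1)
include h1

omit [DecidableEq ι] [GradedAlgebra 𝒜] in
theorem diag_one : φ.diag 1 = 1 := by
  simpa [diag_apply] using h1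

omit [DecidableEq ι] [GradedAlgebra 𝒜] in
theorem sum_unit : ∑ i, φ.unit i i = 1 := h1

/-- The algebra spanned by the matrix units of a complete frame. -/
def unitAlgebra : Subalgebra F A :=
  (Submodule.span F (Set.range fun p : κ × κ => φ.unit p.1 p.2)).toSubalgebra
    (by
      rw [← φ.sum_unit h1]
      exact sum_mem fun i _ => Submodule.subset_span ⟨(i, i), rfl⟩)
    (by
      intro a b ha hb
      induction ha, hb using Submodule.span_induction₂ with
      | mem_mem a b ha hb =>
        obtain ⟨p, rfl⟩ := ha
        obtain ⟨q, rfl⟩ := hb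
        dsimp only
        rw [unit_mul_unit]
        split_ifs
        · exact Submodule.subset_span ⟨(p.1, q.2), rfl⟩
        · exact zero_mem _
      | zero_left => simp
      | zero_right => simp
      | add_left _ _ _ _ _ _ h h' => rw [add_mul]; exact add_mem h h'
      | add_right _ _ _ _ _ _ h h' => rw [mul_add]; exact add_mem h h'
      | smul_left c _ _ _ _ h => rw [smul_mul_assoc]; exact Submodule.smul_mem _ _ h
      | smul_right c _ _ _ _ h => rw [mul_smul_comm]; exact Submodule.smul_mem _ _ h)

/-- The algebra of block-diagonal elements of a complete frame. -/
def diagAlgebra : Subalgebra F A :=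
  (LinearMap.range φ.diag).toSubalgebra ⟨1, φ.diag_one h1⟩ (by
    rintro _ _ ⟨r, rfl⟩ ⟨s, rfl⟩
    exact ⟨_, (φ.diag_mul_diag r s).symm⟩)

omit [DecidableEq ι] [GradedAlgebra 𝒜] in
theorem toSubmodule_unitAlgebra : Subalgebra.toSubmodule (φ.unitAlgebra h1) =
    Submodule.span F (Set.range fun p : κ × κ => φ.unit p.1 p.2) :=
  Submodule.toSubalgebra_toSubmodule ..

omit [DecidableEq ι] [GradedAlgebra 𝒜] in
theorem unit_mem_unitAlgebra (i j : κ) : φ.unit i j ∈ φ.unitAlgebra h1 :=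
  Submodule.subset_span ⟨(i, j), rfl⟩

omit [DecidableEq ι] [GradedAlgebra 𝒜] in
theorem diag_mem_diagAlgebra (r : A) : φ.diag r ∈ φ.diagAlgebra h1 := ⟨r, rfl⟩

omit [DecidableEq ι] [GradedAlgebra 𝒜] in
theorem commute_of_mem {c d : A} (hc : c ∈ φ.unitAlgebra h1) (hd : d ∈ φ.diagAlgebra h1) :
    Commute c d := by
  obtain ⟨r, rfl⟩ := hd
  rw [← Subalgebra.mem_toSubmodule, toSubmodule_unitAlgebra] at hc
  induction hc using Submodule.span_induction with
  | mem c hc =>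
    obtain ⟨p, rfl⟩ := hc
    exact (φ.unit_mul_diag ..).trans (φ.diag_mul_unit ..).symm
  | zero => exact Commute.zero_left _
  | add _ _ _ _ h h' => exact h.add_left h'
  | smul c _ _ h => exact h.smul_left c

/-- The multiplication homomorphism from the tensor product of the two algebras of a frame. -/
noncomputable def mulHom : (φ.unitAlgebra h1) ⊗[F] (φ.diagAlgebra h1) →ₐ[F] A :=
  Algebra.TensorProduct.lift (φ.unitAlgebra h1).val (φ.diagAlgebra h1).val
    fun c d => φ.commute_of_mem h1 c.2 d.2

omit [DecidableEq ι] [GradedAlgebra 𝒜] in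
theorem mulHom_tmul (c : φ.unitAlgebra h1) (d : φ.diagAlgebra h1) :
    φ.mulHom h1 (c ⊗ₜ[F] d) = (c : A) * d := by
  simp [mulHom]

/-- The inverse of the multiplication homomorphism, as a linear map. -/
noncomputable def mulInv : A →ₗ[F] (φ.unitAlgebra h1) ⊗[F] (φ.diagAlgebra h1) :=
  ∑ i, ∑ j, TensorProduct.mk F _ _ ⟨φ.unit i j, φ.unit_mem_unitAlgebra h1 i j⟩ ∘ₗ
    φ.diag.codRestrict (Subalgebra.toSubmodule (φ.diagAlgebra h1)) (φ.diag_mem_diagAlgebra h1) ∘ₗ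
      LinearMap.mulLeftRight F (φ.y i, φ.x j)

omit [DecidableEq ι] [GradedAlgebra 𝒜] in
theorem mulInv_apply (r : A) : φ.mulInv h1 r = ∑ i, ∑ j,
    (⟨φ.unit i j, φ.unit_mem_unitAlgebra h1 i j⟩ : φ.unitAlgebra h1) ⊗ₜ[F]
      (⟨φ.diag (φ.y i * r * φ.x j), φ.diag_mem_diagAlgebra h1 _⟩ : φ.diagAlgebra h1) := by
  simp only [mulInv, LinearMap.sum_apply]
  rfl

omit [DecidableEq ι] [GradedAlgebra 𝒜] in
theorem mulHom_mulInv (r : A) : φ.mulHom h1 (φ.mulInv h1 r) = r := by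
  simp only [mulInv_apply, map_sum, mulHom_tmul, unit_mul_diag]
  calc ∑ i, ∑ j, φ.x i * (φ.y i * r * φ.x j) * φ.y j
      = (∑ i, φ.x i * φ.y i) * r * ∑ j, φ.x j * φ.y j := by
        simp only [Finset.sum_mul, Finset.mul_sum, mul_assoc]
        exact Finset.sum_comm
    _ = r := by rw [h1, one_mul, mul_one]

omit [DecidableEq ι] [GradedAlgebra 𝒜] in
theorem mulInv_mulHom (t : (φ.unitAlgebra h1) ⊗[F] (φ.diagAlgebra h1)) :
    φ.mulInv h1 (φ.mulHom h1 t) = t := by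
  induction t using TensorProduct.induction_on with
  | zero => simp
  | add a b ha hb => rw [map_add, map_add, ha, hb]
  | tmul c d =>
    obtain ⟨_, r, rfl⟩ := d
    obtain ⟨c, hc⟩ := c
    have hc' := hc
    rw [← Subalgebra.mem_toSubmodule, toSubmodule_unitAlgebra] at hc'
    induction hc' using Submodule.span_induction with
    | mem c hc'' =>
      obtain ⟨⟨p, q⟩, rfl⟩ := hc''
      have key : ∀ i j, φ.diag (φ.y i * (φ.unit p q * φ.diag r) * φ.x j) =
          if i = p then if q = j then φ.diag r else 0 else 0 := by
        intro i j
        have : φ.y i * (φ.x p * r * φ.y q) * φ.x j = (φ.y i * φ.x p) * r * (φ.y q * φ.x j) := by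
          simp only [mul_assoc]
        rw [unit_mul_diag, this, φ.y_mul_x, φ.y_mul_x]
        split_ifs <;> simp [diag_corner]
      change φ.mulInv h1 (φ.mulHom h1 ((⟨φ.unit p q, hc⟩ : φ.unitAlgebra h1) ⊗ₜ[F]
        (⟨φ.diag r, φ.diag_mem_diagAlgebra h1 r⟩ : φ.diagAlgebra h1))) = _
      rw [mulHom_tmul, mulInv_apply, Finset.sum_eq_single p, Finset.sum_eq_single q]
      · congr 1
        apply Subtype.ext
        simpa using key p q
      · intro j _ hj
        rw [show (⟨φ.diag _, _⟩ : φ.diagAlgebra h1) = 0 from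
          Subtype.ext ((key p j).trans (by simp [hj.symm])), TensorProduct.tmul_zero]
      · simp
      · intro i _ hi
        refine Finset.sum_eq_zero fun j _ => ?_
        rw [show (⟨φ.diag _, _⟩ : φ.diagAlgebra h1) = 0 from
          Subtype.ext ((key i j).trans (by simp [hi])), TensorProduct.tmul_zero]
      · simp
    | zero =>
      rw [show (⟨0, hc⟩ : φ.unitAlgebra h1) = 0 from rfl, TensorProduct.zero_tmul, map_zero,
        map_zero]
    | add a b ha hb iha ihb =>
      rw [← toSubmodule_unitAlgebra φ h1] at ha hb
      rw [show (⟨a + b, hc⟩ : φ.unitAlgebra h1) = ⟨a, ha⟩ + ⟨b, hb⟩ from rfl,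
        TensorProduct.add_tmul, map_add, map_add, iha, ihb]
    | smul k a ha iha =>
      rw [← toSubmodule_unitAlgebra φ h1] at ha
      rw [show (⟨k • a, hc⟩ : φ.unitAlgebra h1) = k • ⟨a, ha⟩ from rfl,
        ← TensorProduct.smul_tmul', map_smul, map_smul, iha]

/-- Multiplication identifies the tensor product of the two algebras with the whole algebra. -/
noncomputable def mulEquiv : (φ.unitAlgebra h1) ⊗[F] (φ.diagAlgebra h1) ≃ₐ[F] A :=
  AlgEquiv.ofBijective (φ.mulHom h1)
    ⟨Function.LeftInverse.injective (φ.mulInv_mulHom h1),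
      Function.RightInverse.surjective (φ.mulHom_mulInv h1)⟩

omit [DecidableEq ι] [GradedAlgebra 𝒜] in
theorem mulEquiv_tmul (c : φ.unitAlgebra h1) (d : φ.diagAlgebra h1) :
    φ.mulEquiv h1 (c ⊗ₜ[F] d) = (c : A) * d := by
  exact φ.mulHom_tmul h1 c d

theorem unitAlgebra_graded : Subalgebra.toSubmodule (φ.unitAlgebra h1) =
    ⨆ g, Subalgebra.toSubmodule (φ.unitAlgebra h1) ⊓ 𝒜 g := by
  refine le_antisymm ?_ (iSup_le fun g => inf_le_left)
  nth_rw 1 [toSubmodule_unitAlgebra]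
  rw [Submodule.span_le]
  rintro _ ⟨p, rfl⟩
  exact Submodule.mem_iSup_of_mem _ ⟨φ.unit_mem_unitAlgebra h1 p.1 p.2, φ.unit_mem p.1 p.2⟩

theorem diagAlgebra_graded : Subalgebra.toSubmodule (φ.diagAlgebra h1) =
    ⨆ g, Subalgebra.toSubmodule (φ.diagAlgebra h1) ⊓ 𝒜 g := by
  refine le_antisymm ?_ (iSup_le fun g => inf_le_left)
  rintro _ ⟨r, rfl⟩
  induction r using Decomposition.inductionOn 𝒜 with
  | zero => rw [map_zero]; exact zero_mem _
  | homogeneous r =>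
    exact Submodule.mem_iSup_of_mem _ ⟨φ.diag_mem_diagAlgebra h1 r, φ.diag_mem r.2⟩
  | add a b ha hb => rw [map_add]; exact add_mem ha hb

variable (he : IsGradedPrimitive 𝒜 e)
include he

omit [DecidableEq ι] [GradedAlgebra 𝒜] in
theorem nonempty_index : Nonempty κ := by
  by_contra hκ
  rw [not_nonempty_iff] at hκ
  apply he.ne_zero
  rw [← mul_one e, ← h1, Finset.univ_eq_empty, Finset.sum_empty, mul_zero]

/-- Homogeneous elements of the diagonal algebra come from the corner. -/
theorem exists_corner_of_mem {g : ι} {d : A} (hd : d ∈ φ.diagAlgebra h1) (hdg : d ∈ 𝒜 g) :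
    ∃ r ∈ 𝒜 g, e * r = r ∧ r * e = r ∧ φ.diag r = d := by
  obtain ⟨r, rfl⟩ := hd
  obtain ⟨i⟩ := φ.nonempty_index h1 he
  refine ⟨e * r * e, ?_, ?_, ?_, φ.diag_corner r⟩
  · have : e * r * e = φ.y i * φ.diag r * φ.x i := by
      rw [y_mul_diag, mul_assoc _ (φ.y i), φ.y_mul_x, if_pos rfl]
    rw [this]
    have := SetLike.mul_mem_graded (SetLike.mul_mem_graded (φ.y_mem i) hdg) (φ.x_mem i)
    convert this using 2
    abel
  · rw [← mul_assoc, ← mul_assoc, he.idem]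
  · rw [mul_assoc, he.idem]

theorem finrank_diagAlgebra_inf_le_one [IsAlgClosed F] [FiniteDimensional F A] (g : ι) :
    Module.finrank F ↥(Subalgebra.toSubmodule (φ.diagAlgebra h1) ⊓ 𝒜 g) ≤ 1 := by
  rw [finrank_le_one_iff]
  by_cases h : ∃ d ∈ 𝒜 g, d ≠ 0 ∧ e * d = d ∧ d * e = d
  · obtain ⟨d, hd, hd0, hed, hde⟩ := h
    refine ⟨⟨φ.diag d, φ.diag_mem_diagAlgebra h1 d, φ.diag_mem hd⟩, fun w => ?_⟩
    obtain ⟨r, hr, her, hre, hrw⟩ := φ.exists_corner_of_mem h1 he w.2.1 w.2.2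
    obtain ⟨c, rfl⟩ := he.exists_eq_smul hd hd0 hed hde hr her hre
    exact ⟨c, Subtype.ext (by simpa using hrw)⟩
  · refine ⟨0, fun w => ⟨0, ?_⟩⟩
    obtain ⟨r, hr, her, hre, hrw⟩ := φ.exists_corner_of_mem h1 he w.2.1 w.2.2
    have hr0 : r = 0 := by
      by_contra hr0
      exact h ⟨r, hr, hr0, her, hre⟩
    apply Subtype.ext
    rw [← hrw, hr0]
    simp

theorem mem_cornerSupport {g : ι}
    (hg : Subalgebra.toSubmodule (φ.diagAlgebra h1) ⊓ 𝒜 g ≠ ⊥) : g ∈ he.cornerSupport := by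
  obtain ⟨d, hd, hd0⟩ := Submodule.exists_mem_ne_zero_of_ne_bot hg
  obtain ⟨r, hr, her, hre, rfl⟩ := φ.exists_corner_of_mem h1 he hd.1 hd.2
  exact ⟨r, hr, fun h0 => hd0 (by rw [h0, map_zero]), her, hre⟩

omit [DecidableEq ι] [GradedAlgebra 𝒜] in
omit h1 in
theorem y_mul_sum_mul_x (c : κ × κ → F) (p : κ × κ) :
    φ.y p.1 * (∑ q, c q • φ.unit q.1 q.2) * φ.x p.2 = c p • e := by
  rw [Finset.mul_sum, Finset.sum_mul, Finset.sum_eq_single p]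
  · rw [mul_smul_comm, smul_mul_assoc, unit, ← mul_assoc, mul_assoc, φ.y_mul_x, φ.y_mul_x,
      if_pos rfl, if_pos rfl, he.idem]
  · intro q _ hq
    rw [mul_smul_comm, smul_mul_assoc, unit, ← mul_assoc, mul_assoc, φ.y_mul_x, φ.y_mul_x]
    split_ifs with h h'
    · exact (hq (Prod.ext h.symm h')).elim
    all_goals simp
  · simp

omit [DecidableEq ι] [GradedAlgebra 𝒜] in
omit h1 in
theorem linearIndependent_unit :
    LinearIndependent F (fun p : κ × κ => φ.unit p.1 p.2) := by
  rw [Fintype.linearIndependent_iff]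
  intro c hc p
  have := φ.y_mul_sum_mul_x he c p
  rw [hc, mul_zero, zero_mul] at this
  exact (smul_eq_zero.1 this.symm).resolve_right he.ne_zero

theorem exists_eq_sub_of_mem_support {g : ι}
    (hg : Subalgebra.toSubmodule (φ.unitAlgebra h1) ⊓ 𝒜 g ≠ ⊥) :
    ∃ i j, g = φ.deg i - φ.deg j := by
  obtain ⟨a, ⟨ha, hag⟩, ha0⟩ := Submodule.exists_mem_ne_zero_of_ne_bot hg
  rw [SetLike.mem_coe, toSubmodule_unitAlgebra, Submodule.mem_span_range_iff_exists_fun] at ha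
  obtain ⟨c, rfl⟩ := ha
  obtain ⟨p, hp⟩ : ∃ p, c p ≠ 0 := by
    by_contra! h
    exact ha0 (by simp [h])
  have hmem := SetLike.mul_mem_graded (SetLike.mul_mem_graded (φ.y_mem p.1) hag) (φ.x_mem p.2)
  rw [φ.y_mul_sum_mul_x he] at hmem
  have hdeg := degree_eq_of_mem_mem 𝒜 hmem (Submodule.smul_mem _ (c p) he.mem)
    (smul_ne_zero hp he.ne_zero)
  refine ⟨p.1, p.2, ?_⟩
  rw [eq_sub_iff_add_eq, ← sub_eq_zero, ← hdeg]
  abel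

end Complete

end HomogeneousFrame

/-- A finite-dimensional graded prime algebra over an algebraically closed field is the product of
an elementary graded matrix algebra and a graded division algebra with independent supports. -/
theorem exists_elementary_division_decomposition [IsAlgClosed F] [FiniteDimensional F A]
    [Nontrivial A] (hp : ∀ a b : A, a ≠ 0 → b ≠ 0 → ∃ r, a * r * b ≠ 0) :
    ∃ (k : ℕ) (C D : Subalgebra F A) (E : Fin k → Fin k → A) (ψ : (↥C ⊗[F] ↥D) ≃ₐ[F] A),
      (∀ i j, ∃ g : ι, E i j ∈ 𝒜 g) ∧
      (∀ i j p q, E i j * E p q = if j = p then E i q else 0) ∧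
      (∑ i, E i i) = 1 ∧
      LinearIndependent F (fun p : Fin k × Fin k => E p.1 p.2) ∧
      Submodule.span F (Set.range fun p : Fin k × Fin k => E p.1 p.2)
        = Subalgebra.toSubmodule C ∧
      (Subalgebra.toSubmodule C = ⨆ g : ι, (Subalgebra.toSubmodule C ⊓ 𝒜 g)) ∧
      (Subalgebra.toSubmodule D = ⨆ g : ι, (Subalgebra.toSubmodule D ⊓ 𝒜 g)) ∧
      (∀ g : ι, Module.finrank F ↥(Subalgebra.toSubmodule D ⊓ 𝒜 g) ≤ 1) ∧
      (∀ (c : C) (d : D), ψ (c ⊗ₜ[F] d) = (c : A) * (d : A)) ∧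
      ({g : ι | Subalgebra.toSubmodule C ⊓ 𝒜 g ≠ ⊥}
        ∩ {g : ι | Subalgebra.toSubmodule D ⊓ 𝒜 g ≠ ⊥} = ({0} : Set ι)) := by
  obtain ⟨e, he⟩ := exists_isGradedPrimitive 𝒜 hp
  obtain ⟨k, φ, h1⟩ := he.exists_complete_frame hp
  refine ⟨k, φ.unitAlgebra h1, φ.diagAlgebra h1, φ.unit, φ.mulEquiv h1,
    fun i j => ⟨_, φ.unit_mem i j⟩, φ.unit_mul_unit, φ.sum_unit h1, φ.linearIndependent_unit he,
    (φ.toSubmodule_unitAlgebra h1).symm, φ.unitAlgebra_graded h1, φ.diagAlgebra_graded h1,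
    φ.finrank_diagAlgebra_inf_le_one h1 he, φ.mulEquiv_tmul h1, ?_⟩
  refine Set.Subset.antisymm ?_ ?_
  · rintro g ⟨hgC, hgD⟩
    obtain ⟨i, j, rfl⟩ := φ.exists_eq_sub_of_mem_support h1 he hgC
    have hmem := φ.mem_cornerSupport h1 he hgD
    obtain ⟨s, hs⟩ := φ.deg_mem i
    obtain ⟨t, ht⟩ := φ.deg_mem j
    have hst : s = t := by
      rw [← QuotientAddGroup.out_eq' s, ← QuotientAddGroup.out_eq' t, eq_comm, QuotientAddGroup.eq]
      rw [← hs, ← ht] at hmem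
      rwa [neg_add_eq_sub]
    rw [Set.mem_singleton_iff, ← hs, ← ht, hst, sub_self]
  · rintro _ rfl
    have hone : (1 : A) ∈ 𝒜 0 := SetLike.GradedOne.one_mem
    constructor <;> intro hbot
    · exact one_ne_zero ((Submodule.mem_bot F).1 (hbot.le ⟨(φ.unitAlgebra h1).one_mem, hone⟩))
    · exact one_ne_zero ((Submodule.mem_bot F).1 (hbot.le ⟨(φ.diagAlgebra h1).one_mem, hone⟩))

end GradedPrime

/-- Matrix algebras over a field are prime. -/
theorem Matrix.exists_mul_mul_ne_zero {F m : Type*} [Field F] [Fintype m] [DecidableEq m]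
    (a b : Matrix m m F) (ha : a ≠ 0) (hb : b ≠ 0) : ∃ r, a * r * b ≠ 0 := by
  obtain ⟨i, j, hij⟩ : ∃ i j, a i j ≠ 0 := by
    by_contra! h
    exact ha (Matrix.ext h)
  obtain ⟨k, l, hkl⟩ : ∃ k l, b k l ≠ 0 := by
    by_contra! h
    exact hb (Matrix.ext h)
  refine ⟨Matrix.single j k 1, fun h => mul_ne_zero hij hkl ?_⟩
  have := congrFun (congrFun h i) l
  rw [Matrix.mul_apply, Finset.sum_eq_single k] at this
  · simpa using this
  · intro x _ hx
    rw [Matrix.mul_single_apply_of_ne _ _ _ _ _ hx, zero_mul]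
  · simp

/-- The unit of an internally graded algebra has trivial degree. -/
theorem one_mem_of_isInternal_s13 {F A ι : Type*} [Field F] [Ring A] [Algebra F A] [AddGroup ι]
    [DecidableEq ι] (𝒜 : ι → Submodule F A) (h : DirectSum.IsInternal 𝒜)
    (hmul : ∀ g h : ι, ∀ x ∈ 𝒜 g, ∀ y ∈ 𝒜 h, x * y ∈ 𝒜 (g + h)) : (1 : A) ∈ 𝒜 0 := by
  classical
  let _ := h.chooseDecomposition
  let u : A := (decompose 𝒜 (1 : A) 0 : 𝒜 0)
  have key : ∀ r : A, r * u = r := by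
    intro r
    induction r using Decomposition.inductionOn 𝒜 with
    | zero => simp
    | add a b ha hb => rw [add_mul, ha, hb]
    | @homogeneous g x =>
      have hx : (x : A) = ∑ i ∈ (decompose 𝒜 (1 : A)).support,
          (x : A) * (decompose 𝒜 (1 : A) i : A) := by
        rw [← Finset.mul_sum, sum_support_decompose, mul_one]
      let P : A →+ A := (AddSubmonoidClass.subtype (𝒜 g)).comp
        ((DFinsupp.evalAddMonoidHom g).comp (decomposeAddEquiv 𝒜).toAddMonoidHom)
      have hP : ∀ r, P r = (decompose 𝒜 r g : A) := fun _ => rfl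
      have hx' := (congrArg P hx).trans (map_sum P _ _)
      simp only [hP] at hx'
      rw [decompose_of_mem_same _ x.2, Finset.sum_eq_single 0] at hx'
      · have hxu : (x : A) * u ∈ 𝒜 g := by simpa using hmul g 0 x x.2 u (SetLike.coe_mem _)
        exact (decompose_of_mem_same _ hxu).symm.trans hx'.symm
      · intro i _ hi
        have hgi : g + i ≠ g := by simpa using hi
        exact decompose_of_mem_ne _ (hmul g i x x.2 _ (SetLike.coe_mem _)) hgi
      · intro h0
        rw [DFinsupp.notMem_support_iff.1 h0]
        simp
  rw [← key 1, one_mul]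
  exact SetLike.coe_mem _

set_option synthInstance.maxHeartbeats 1000000 in
set_option maxHeartbeats 1000000 in
/-- Structure theorem: any `G`-graded `Mₙ(F)` decomposes as `C ⊗ D`
where `C` is a graded subalgebra with a homogeneous matrix-unit basis (elementary
grading) and `D` is a graded subalgebra carrying a division grading, the
multiplication map `C ⊗ D → R`, `c ⊗ d ↦ cd`, being an algebra isomorphism, and the
supports of `C` and `D` meeting only in `{e}`. -/
theorem matrix_grading_structure
    {F : Type*} [Field F] [IsAlgClosed F]
    {G : Type*} [CommGroup G] [DecidableEq G] {n : ℕ} (hn : 0 < n)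
    (ℛ : G → Submodule F (Matrix (Fin n) (Fin n) F))
    (hinternal : DirectSum.IsInternal ℛ)
    (hmul : ∀ g h : G, ∀ x ∈ ℛ g, ∀ y ∈ ℛ h, x * y ∈ ℛ (g * h)) :
    ∃ (k : ℕ) (C D : Subalgebra F (Matrix (Fin n) (Fin n) F))
      (E : Fin k → Fin k → Matrix (Fin n) (Fin n) F)
      (ψ : (↥C ⊗[F] ↥D) ≃ₐ[F] Matrix (Fin n) (Fin n) F),
      -- E is a basis of C consisting of homogeneous matrix units
      (∀ i j, ∃ g : G, E i j ∈ ℛ g) ∧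
      (∀ i j p q, E i j * E p q = if j = p then E i q else 0) ∧
      (∑ i, E i i) = 1 ∧
      LinearIndependent F (fun p : Fin k × Fin k => E p.1 p.2) ∧
      Submodule.span F (Set.range fun p : Fin k × Fin k => E p.1 p.2)
        = Subalgebra.toSubmodule C ∧
      -- C and D are graded subalgebras
      (Subalgebra.toSubmodule C
        = ⨆ g : G, (Subalgebra.toSubmodule C ⊓ ℛ g)) ∧
      (Subalgebra.toSubmodule D
        = ⨆ g : G, (Subalgebra.toSubmodule D ⊓ ℛ g)) ∧
      -- D carries a division grading
      (∀ g : G, Module.finrank F ↥(Subalgebra.toSubmodule D ⊓ ℛ g) ≤ 1) ∧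
      -- the multiplication map is an algebra isomorphism
      (∀ (c : C) (d : D), ψ (c ⊗ₜ[F] d)
        = (c : Matrix (Fin n) (Fin n) F) * (d : Matrix (Fin n) (Fin n) F)) ∧
      -- the supports of C and D intersect in {e}
      ({g : G | Subalgebra.toSubmodule C ⊓ ℛ g ≠ ⊥}
        ∩ {g : G | Subalgebra.toSubmodule D ⊓ ℛ g ≠ ⊥} = ({1} : Set G)) := by
  have : Nonempty (Fin n) := ⟨⟨0, hn⟩⟩
  let _ : GradedAlgebra (ι := Additive G) ℛ :=
    { hinternal.chooseDecomposition with
      one_mem := one_mem_of_isInternal_s13 (ι := Additive G) ℛ hinternal hmul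
      mul_mem := fun {g h} x y hx hy => hmul g h x hx y hy }
  exact exists_elementary_division_decomposition (ι := Additive G) (𝒜 := ℛ)
    Matrix.exists_mul_mul_ne_zero
end
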